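/- arXiv:1410.1913 — 3 statements merged into one kernel-verified Lean document; each statement's English description precedes it below -/
import Mathlib

section
/- If Ω is an open subset of ℝⁿ (n ≥ 3) with Ω ⊂ ℝⁿ₊ and 0 ∈ ∂Ω, then γ_H(Ω) ≥ n²/4, i.e. for every u ∈ C_c^∞(Ω), (n²/4) ∫_Ω u²/|x|² dx ≤ ∫_Ω |∇u|² dx. -/
open MeasureTheory

noncomputable section

/-- Components of the field `∇φ / φ` with `φ = x₁ |x|^{-n/2}`. -/
def hardyV (n : ℕ) (i0 i : Fin n) (x : EuclideanSpace ℝ (Fin n)) : ℝ :=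
  (if i = i0 then (x i0)⁻¹ else 0) - (n : ℝ) / 2 * (x i * (‖x‖ ^ 2)⁻¹)

lemma hardy_norm_pos {n : ℕ} {i0 : Fin n} {x : EuclideanSpace ℝ (Fin n)} (hx : 0 < x i0) :
    0 < ‖x‖ ^ 2 := by
  have : x ≠ 0 := by
    rintro rfl
    simp at hx
  positivity

lemma hardy_coord_contDiff {n : ℕ} (i : Fin n) :
    ContDiff ℝ 1 (fun x : EuclideanSpace ℝ (Fin n) => x i) :=
  (EuclideanSpace.proj i : EuclideanSpace ℝ (Fin n) →L[ℝ] ℝ).contDiff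

lemma hardyV_contDiffAt {n : ℕ} (i0 i : Fin n) {x : EuclideanSpace ℝ (Fin n)} (hx : 0 < x i0) :
    ContDiffAt ℝ 1 (hardyV n i0 i) x := by
  have h1 := hardy_norm_pos hx
  unfold hardyV
  refine ContDiffAt.sub ?_ (contDiffAt_const.mul ((hardy_coord_contDiff i).contDiffAt.mul
    ((contDiff_norm_sq ℝ).contDiffAt.inv h1.ne')))
  split_ifs
  · exact (hardy_coord_contDiff i0).contDiffAt.inv hx.ne'
  · exact contDiffAt_const

lemma hardyV_fderiv {n : ℕ} (i0 i : Fin n) {x : EuclideanSpace ℝ (Fin n)} (hx : 0 < x i0) :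
    fderiv ℝ (hardyV n i0 i) x (EuclideanSpace.single i 1) =
      (if i = i0 then -((x i0) ^ 2)⁻¹ else 0)
        - (n : ℝ) / 2 * ((‖x‖ ^ 2)⁻¹ - 2 * x i ^ 2 * ((‖x‖ ^ 2) ^ 2)⁻¹) := by
  have h1 := hardy_norm_pos hx
  have hc : ∀ j : Fin n, HasFDerivAt (fun x : EuclideanSpace ℝ (Fin n) => x j)
      (EuclideanSpace.proj j : EuclideanSpace ℝ (Fin n) →L[ℝ] ℝ) x := fun j =>
    (EuclideanSpace.proj j : EuclideanSpace ℝ (Fin n) →L[ℝ] ℝ).hasFDerivAt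
  have hN : HasFDerivAt (fun x : EuclideanSpace ℝ (Fin n) => ‖x‖ ^ 2) (2 • innerSL ℝ x) x :=
    (hasStrictFDerivAt_norm_sq x).hasFDerivAt
  have hNi := (hasDerivAt_inv h1.ne').comp_hasFDerivAt x hN
  have hP := ((hc i).mul hNi).const_mul ((n : ℝ) / 2)
  by_cases h : i = i0
  · subst h
    have hQ := ((hasDerivAt_inv hx.ne').comp_hasFDerivAt x (hc i)).sub hP
    have hR := hQ.congr_of_eventuallyEq (f₁ := hardyV n i i)
      (Filter.Eventually.of_forall fun y => by simp [hardyV])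
    rw [hR.fderiv]
    simp [EuclideanSpace.inner_single_right]
    ring
  · have hQ := (hasFDerivAt_const (0 : ℝ) x).sub hP
    have hR := hQ.congr_of_eventuallyEq (f₁ := hardyV n i0 i)
      (Filter.Eventually.of_forall fun y => by simp [hardyV, h])
    rw [hR.fderiv]
    simp [EuclideanSpace.inner_single_right, h]
    ring

lemma hardy_integral_zero {n : ℕ} (f : EuclideanSpace ℝ (Fin n) → ℝ) (hf : ContDiff ℝ 1 f)
    (hcs : HasCompactSupport f) (v : EuclideanSpace ℝ (Fin n)) :
    Integrable (fun x => fderiv ℝ f x v) ∧ ∫ x, fderiv ℝ f x v = 0 := by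
  have hc : Continuous (fun x => fderiv ℝ f x v) :=
    (hf.continuous_fderiv (by norm_num)).clm_apply continuous_const
  have hi : Integrable (fun x => fderiv ℝ f x v) :=
    hc.integrable_of_hasCompactSupport (hcs.fderiv_apply (𝕜 := ℝ) v)
  refine ⟨hi, ?_⟩
  have := integral_mul_fderiv_eq_neg_fderiv_mul_of_integrable (𝕜 := ℝ) (μ := volume)
    (f := fun _ : EuclideanSpace ℝ (Fin n) => (1 : ℝ)) (g := f) (v := v)
    (by simp) (by simpa using hi)
    (by simpa using hf.continuous.integrable_of_hasCompactSupport hcs)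
    (by fun_prop) (fun x _ => hf.differentiable (by norm_num) x)
  simpa using this

lemma hardy_norm_fderiv {n : ℕ} (L : EuclideanSpace ℝ (Fin n) →L[ℝ] ℝ) :
    ‖L‖ ^ 2 = ∑ i, (L (EuclideanSpace.single i 1)) ^ 2 := by
  obtain ⟨y, rfl⟩ := (InnerProductSpace.toDual ℝ (EuclideanSpace ℝ (Fin n))).surjective L
  rw [LinearIsometryEquiv.norm_map, EuclideanSpace.real_norm_sq_eq]
  simp [EuclideanSpace.inner_single_right]

lemma hardy_pointwise {n : ℕ} (i0 : Fin n) (x : EuclideanSpace ℝ (Fin n)) (hx : 0 < x i0)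
    (u : ℝ) (p : Fin n → ℝ) :
    ∑ i, (2 * u * p i * hardyV n i0 i x
      + u ^ 2 * fderiv ℝ (hardyV n i0 i) x (EuclideanSpace.single i 1))
      ≤ ∑ i, p i ^ 2 - (n : ℝ) ^ 2 / 4 * (u ^ 2 / ‖x‖ ^ 2) := by
  have h1 := hardy_norm_pos hx
  have hs : ∑ i, x i ^ 2 = ‖x‖ ^ 2 := (EuclideanSpace.real_norm_sq_eq x).symm
  have key : ∀ i, 2 * u * p i * hardyV n i0 i x
      + u ^ 2 * fderiv ℝ (hardyV n i0 i) x (EuclideanSpace.single i 1)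
      ≤ p i ^ 2 + u ^ 2 * ((if i = i0 then -(n : ℝ) * (‖x‖ ^ 2)⁻¹ else 0)
        + ((n : ℝ) ^ 2 / 4 + n) * ((‖x‖ ^ 2) ^ 2)⁻¹ * x i ^ 2 - n / 2 * (‖x‖ ^ 2)⁻¹) := by
    intro i
    rw [hardyV_fderiv i0 i hx]
    have hsq := sq_nonneg (p i - u * hardyV n i0 i x)
    have e : (hardyV n i0 i x) ^ 2 + ((if i = i0 then -((x i0) ^ 2)⁻¹ else 0)
        - (n : ℝ) / 2 * ((‖x‖ ^ 2)⁻¹ - 2 * x i ^ 2 * ((‖x‖ ^ 2) ^ 2)⁻¹))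
        = ((if i = i0 then -(n : ℝ) * (‖x‖ ^ 2)⁻¹ else 0)
        + ((n : ℝ) ^ 2 / 4 + n) * ((‖x‖ ^ 2) ^ 2)⁻¹ * x i ^ 2 - n / 2 * (‖x‖ ^ 2)⁻¹) := by
      unfold hardyV
      generalize ‖x‖ ^ 2 = r at *
      split_ifs with h
      · subst h
        have := hx.ne'
        field_simp
        ring
      · field_simp
        ring
    rw [← e]
    nlinarith
  refine (Finset.sum_le_sum fun i _ => key i).trans (le_of_eq ?_)
  rw [Finset.sum_add_distrib, ← Finset.mul_sum, Finset.sum_sub_distrib, Finset.sum_add_distrib,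
    ← Finset.mul_sum, hs]
  simp only [Finset.sum_ite_eq', Finset.mem_univ, if_true, Finset.sum_const, Finset.card_univ,
    Fintype.card_fin, nsmul_eq_mul]
  generalize ‖x‖ ^ 2 = r at *
  field_simp
  ring

theorem hardy_subset_halfspace (n : ℕ) (hn : 3 ≤ n) (i0 : Fin n) (hi0 : (i0 : ℕ) = 0)
    (Ω : Set (EuclideanSpace ℝ (Fin n))) (hΩopen : IsOpen Ω)
    (hΩsub : Ω ⊆ {x : EuclideanSpace ℝ (Fin n) | 0 < x i0})
    (h0 : (0 : EuclideanSpace ℝ (Fin n)) ∈ frontier Ω)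
    (u : EuclideanSpace ℝ (Fin n) → ℝ) (hu : ContDiff ℝ (⊤ : ℕ∞) u)
    (hcs : HasCompactSupport u) (hsupp : tsupport u ⊆ Ω) :
    ((n : ℝ) ^ 2 / 4) * ∫ x in Ω, (u x) ^ 2 / ‖x‖ ^ 2 ≤ ∫ x in Ω, ‖fderiv ℝ u x‖ ^ 2 := by
  have hu1 : ContDiff ℝ 1 u := hu.of_le (by exact_mod_cast le_top)
  have hz : ∀ x, x ∉ tsupport u → u x = 0 := fun x hx => image_eq_zero_of_notMem_tsupport hx
  have hzd : ∀ x, x ∉ tsupport u → fderiv ℝ u x = 0 := fun x hx =>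
    image_eq_zero_of_notMem_tsupport (fun h => hx (tsupport_fderiv_subset ℝ h))
  have hev : ∀ (w : EuclideanSpace ℝ (Fin n) → ℝ) x, x ∉ tsupport u →
      (fun y => u y ^ 2 * w y) =ᶠ[nhds x] fun _ => 0 := by
    intro w x hx
    filter_upwards [(isClosed_tsupport u).isOpen_compl.mem_nhds hx] with y hy
    simp [hz y hy]
  have hsm : ∀ w : EuclideanSpace ℝ (Fin n) → ℝ, (∀ x, 0 < x i0 → ContDiffAt ℝ 1 w x) →
      ContDiff ℝ 1 (fun y => u y ^ 2 * w y) := by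
    intro w hw
    rw [contDiff_iff_contDiffAt]
    intro x
    by_cases hx : x ∈ tsupport u
    · exact (hu1.contDiffAt.pow 2).mul (hw x (hΩsub (hsupp hx)))
    · exact contDiffAt_const.congr_of_eventuallyEq (hev w x hx)
  have hcs2 : ∀ w : EuclideanSpace ℝ (Fin n) → ℝ, HasCompactSupport (fun y => u y ^ 2 * w y) := by
    intro w
    refine hcs.mono' ((Function.support_subset_iff'.2 ?_))
    intro x hx
    simp [hz x hx]
  have hF := fun i => hardy_integral_zero _ (hsm _ (fun x hx => hardyV_contDiffAt i0 i hx))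
    (hcs2 (hardyV n i0 i)) (EuclideanSpace.single i 1)
  have hI1 : Integrable (fun x => u x ^ 2 / ‖x‖ ^ 2) := by
    have := hsm (fun x => (‖x‖ ^ 2)⁻¹)
      (fun x hx => (contDiff_norm_sq ℝ).contDiffAt.inv (hardy_norm_pos hx).ne')
    simpa only [div_eq_mul_inv] using
      this.continuous.integrable_of_hasCompactSupport (hcs2 _)
  have hI2 : Integrable (fun x => ‖fderiv ℝ u x‖ ^ 2) := by
    refine Continuous.integrable_of_hasCompactSupport
      ((hu1.continuous_fderiv (by norm_num)).norm.pow 2) ?_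
    refine hcs.mono' ((Function.support_subset_iff'.2 ?_))
    intro x hx
    simp [hzd x hx]
  rw [setIntegral_eq_integral_of_forall_compl_eq_zero
      (fun x hx => by simp [hz x (fun h => hx (hsupp h))]),
    setIntegral_eq_integral_of_forall_compl_eq_zero
      (fun x hx => by simp [hzd x (fun h => hx (hsupp h))])]
  have hmain : ∫ x, ∑ i, fderiv ℝ (fun y => u y ^ 2 * hardyV n i0 i y) x
      (EuclideanSpace.single i 1) ≤
      ∫ x, (‖fderiv ℝ u x‖ ^ 2 - (n : ℝ) ^ 2 / 4 * (u x ^ 2 / ‖x‖ ^ 2)) := by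
    refine integral_mono (integrable_finsetSum _ fun i _ => (hF i).1)
      (hI2.sub (hI1.const_mul _)) ?_
    intro x
    by_cases hx : x ∈ tsupport u
    · have hx0 : 0 < x i0 := hΩsub (hsupp hx)
      have := hardy_pointwise i0 x hx0 (u x)
        (fun i => fderiv ℝ u x (EuclideanSpace.single i 1))
      simp only [hardy_norm_fderiv]
      refine le_trans (le_of_eq (Finset.sum_congr rfl fun i _ => ?_)) this
      have hd := ((hu1.differentiable (by norm_num) x).hasFDerivAt.pow 2).mul
        ((hardyV_contDiffAt i0 i hx0).differentiableAt (by norm_num)).hasFDerivAt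
      erw [hd.fderiv]
      simp
      ring
    · have : ∀ i, fderiv ℝ (fun y => u y ^ 2 * hardyV n i0 i y) x = 0 := fun i => by
        rw [(hev _ x hx).fderiv_eq]
        simp
      simp [this, hz x hx, hzd x hx]
  rw [integral_finsetSum _ (fun i _ => (hF i).1), Finset.sum_eq_zero (fun i _ => (hF i).2),
    integral_sub hI2 (hI1.const_mul _), integral_const_mul] at hmain
  linarith
end
end

section
/- Let γ < n²/4 and s ∈ [0, 2), and set 2*(s) = 2(n − s)/(n − 2) for n ≥ 3. Suppose u ∈ C²(ℝⁿ₊ \ {0}) ∩ C⁰(cl(ℝⁿ₊) \ {0}) is nonnegative, vanishes on ∂ℝⁿ₊ \ {0}, solves −Δu − (γ/|x|²)u = 0 on ℝⁿ₊, and satisfies u(x) ≤ C x₁ |x|^{−α} for some constant C and some α ∈ {α₋(γ), α₊(γ)}. If moreover u(x)/(x₁|x|^{−α}) → 0 along some sequence x_i ∈ ℝⁿ₊ with |x_i| → ∞ (case α = α₋) or |x_i| → 0 (case α = α₊), then u ≡ 0 or there exists λ > 0 with u(x) = λ x₁ |x|^{−α}. -/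
open Filter Topology

noncomputable section

/-- The Euclidean Laplacian of `f : ℝⁿ → ℝ`, as the sum of second partial derivatives. -/
def lap {n : ℕ} (f : EuclideanSpace ℝ (Fin n) → ℝ) (x : EuclideanSpace ℝ (Fin n)) : ℝ :=
  ∑ i : Fin n, fderiv ℝ (fun y => fderiv ℝ f y (EuclideanSpace.single i 1)) x
    (EuclideanSpace.single i 1)

namespace Rigid

open MeasureTheory Set

abbrev Eu (n : ℕ) := EuclideanSpace ℝ (Fin n)

/-- open half space -/
def hs {n : ℕ} (i0 : Fin n) : Set (Eu n) := {x | 0 < x i0}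

/-- partial derivative -/
def pd {n : ℕ} (f : Eu n → ℝ) (i : Fin n) (x : Eu n) : ℝ :=
  fderiv ℝ f x (EuclideanSpace.single i 1)

lemma lap_eq {n : ℕ} (f : Eu n → ℝ) (x : Eu n) : lap f x = ∑ i, pd (pd f i) i x := rfl

/-- the invariant weight -/
def wt {n : ℕ} (i0 : Fin n) (x : Eu n) : ℝ := x i0 ^ 2 * (‖x‖ ^ 2) ^ (-(n : ℝ) / 2 - 1)

structure Sol {n : ℕ} (i0 : Fin n) (α : ℝ) (z : Eu n → ℝ) : Prop where
  smooth : ContDiffOn ℝ 2 z (hs i0)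
  eqn : ∀ x ∈ hs i0, x i0 * ‖x‖ ^ 2 * lap z x + 2 * ‖x‖ ^ 2 * pd z i0 x
    - 2 * α * x i0 * ∑ i, x i * pd z i x = 0

lemma isOpen_hs {n : ℕ} (i0 : Fin n) : IsOpen (hs i0) :=
  isOpen_lt continuous_const (by fun_prop)

lemma norm_sq_pos {n : ℕ} {i0 : Fin n} {x : Eu n} (hx : x ∈ hs i0) : 0 < ‖x‖ ^ 2 := by
  have : x ≠ 0 := by
    rintro rfl
    simp [hs] at hx
  positivity

lemma sum_sq {n : ℕ} (x : Eu n) : ∑ i, x i ^ 2 = ‖x‖ ^ 2 := by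
  rw [EuclideanSpace.norm_sq_eq]; simp

lemma sq_le_norm {n : ℕ} (i0 : Fin n) (x : Eu n) : x i0 ^ 2 ≤ ‖x‖ ^ 2 := by
  rw [← sum_sq]
  exact Finset.single_le_sum (f := fun i => x i ^ 2) (fun i _ => sq_nonneg _) (Finset.mem_univ i0)

lemma hasF_coord {n : ℕ} (i : Fin n) (x : Eu n) :
    HasFDerivAt (fun y : Eu n => y i) (EuclideanSpace.proj i : Eu n →L[ℝ] ℝ) x :=
  (EuclideanSpace.proj i : Eu n →L[ℝ] ℝ).hasFDerivAt

lemma hasF_q {n : ℕ} (x : Eu n) :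
    HasFDerivAt (fun y : Eu n => ‖y‖ ^ 2) ((2 : ℝ) • innerSL ℝ x) x := by
  have h := (hasStrictFDerivAt_norm_sq x).hasFDerivAt
  refine h.congr_fderiv ?_
  ext v
  simp

lemma inner_single {n : ℕ} (x : Eu n) (i : Fin n) :
    inner ℝ x (EuclideanSpace.single i (1 : ℝ)) = x i := by
  simp [EuclideanSpace.inner_single_right]

lemma proj_single {n : ℕ} (i j : Fin n) :
    (EuclideanSpace.single i (1 : ℝ) : Eu n) j = if i = j then 1 else 0 := by
  rw [PiLp.single_apply]
  simp [eq_comm]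

lemma fderiv_eq_sum {n : ℕ} (f : Eu n → ℝ) (x v : Eu n) :
    fderiv ℝ f x v = ∑ i, v i * pd f i x := by
  have h : v = ∑ i, v i • (EuclideanSpace.single i (1 : ℝ) : Eu n) := by
    ext j
    simp [Finset.sum_apply, Pi.single_apply]
  conv_lhs => rw [h]
  simp [pd]

lemma Sol.cda {n : ℕ} {i0 : Fin n} {α : ℝ} {z : Eu n → ℝ} (hz : Sol i0 α z) {x : Eu n}
    (hx : x ∈ hs i0) : ContDiffAt ℝ 2 z x :=
  hz.smooth.contDiffAt ((isOpen_hs i0).mem_nhds hx)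

lemma cda_pd {n : ℕ} {z : Eu n → ℝ} {x : Eu n} (hz : ContDiffAt ℝ 2 z x) (i : Fin n) :
    ContDiffAt ℝ 1 (pd z i) x := by
  have h : ContDiffAt ℝ 1 (fderiv ℝ z) x := hz.fderiv_right (by norm_num)
  exact h.clm_apply contDiffAt_const

lemma cda_q {n : ℕ} {i0 : Fin n} {x : Eu n} (hx : x ∈ hs i0) (p : ℝ) {k : WithTop ℕ∞} :
    ContDiffAt ℝ k (fun y : Eu n => (‖y‖ ^ 2) ^ p) x :=
  ((contDiff_norm_sq ℝ).contDiffAt).rpow_const_of_ne (norm_sq_pos hx).ne'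

lemma cda_coord {n : ℕ} (i : Fin n) (x : Eu n) {k : WithTop ℕ∞} :
    ContDiffAt ℝ k (fun y : Eu n => y i) x :=
  ((EuclideanSpace.proj i : Eu n →L[ℝ] ℝ).contDiff).contDiffAt

/-- the vector field -/
def fld {n : ℕ} (i0 : Fin n) (b : ℝ) (z φ : Eu n → ℝ) (i : Fin n) (y : Eu n) : ℝ :=
  φ y ^ 2 * (y i0 ^ 2 * (‖y‖ ^ 2) ^ (-(n : ℝ) / 2) * (z y * pd z i y)
    + b * (y i0 ^ 2 * (‖y‖ ^ 2) ^ (-(n : ℝ) / 2 - 1) * (z y ^ 2 * y i)))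

lemma div_fld {n : ℕ} {i0 : Fin n} {α : ℝ} {z φ : Eu n → ℝ} (hz : Sol i0 α z) {x : Eu n}
    (hx : x ∈ hs i0) (hφ : DifferentiableAt ℝ φ x) :
    ∑ i, pd (fld i0 (((n : ℝ) - 2 * α) / 2) z φ i) i x =
      wt i0 x * φ x ^ 2 * (‖x‖ ^ 2 * ∑ i, pd z i x ^ 2)
      + 2 * (wt i0 x * ‖x‖ ^ 2) * z x * φ x * ∑ i, pd φ i x * pd z i x
      + (n - 2 * α) * wt i0 x * z x ^ 2 * φ x * ∑ i, x i * pd φ i x := by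
  have hq := norm_sq_pos hx
  have h1 : (‖x‖ ^ 2) ^ (-(n : ℝ) / 2) = (‖x‖ ^ 2) ^ 2 * (‖x‖ ^ 2) ^ (-(n : ℝ) / 2 - 1 - 1) := by
    rw [← Real.rpow_natCast (‖x‖ ^ 2) 2, ← Real.rpow_add hq]; congr 1; push_cast; ring
  have h2 : (‖x‖ ^ 2) ^ (-(n : ℝ) / 2 - 1) = ‖x‖ ^ 2 * (‖x‖ ^ 2) ^ (-(n : ℝ) / 2 - 1 - 1) := by
    nth_rewrite 2 [← Real.rpow_one (‖x‖ ^ 2)]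
    rw [← Real.rpow_add hq]; congr 1; ring
  set Q := (‖x‖ ^ 2) ^ (-(n : ℝ) / 2 - 1 - 1) with hQ
  set q := ‖x‖ ^ 2 with hqd
  have hd' (i : Fin n) : pd (fld i0 (((n : ℝ) - 2 * α) / 2) z φ i) i x =
      (φ x ^ 2 * (x i0 ^ 2 * q ^ 2 * Q)) * pd z i x ^ 2
      + (φ x ^ 2 * (x i0 ^ 2 * q ^ 2 * Q) * z x) * pd (pd z i) i x
      + (φ x ^ 2 * (2 * x i0 * q ^ 2 * Q) * z x) * (if i = i0 then pd z i x else 0)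
      + (φ x ^ 2 * (x i0 ^ 2 * q * Q) * z x * (-(n : ℝ) + (n - 2 * α))) * (x i * pd z i x)
      + (2 * φ x * x i0 ^ 2 * q ^ 2 * Q * z x) * (pd φ i x * pd z i x)
      + ((n - 2 * α) * φ x * x i0 ^ 2 * q * Q * z x ^ 2) * (x i * pd φ i x)
      + (φ x ^ 2 * ((n - 2 * α) / 2) * x i0 ^ 2 * Q * (-(n : ℝ) - 2) * z x ^ 2) * (x i ^ 2)
      + (φ x ^ 2 * ((n - 2 * α) / 2) * 2 * x i0 * q * Q * z x ^ 2) * (if i = i0 then x i else 0)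
      + (φ x ^ 2 * ((n - 2 * α) / 2) * x i0 ^ 2 * q * Q * z x ^ 2) * 1 := by
    have hzx := (hz.cda hx).differentiableAt (by norm_num) |>.hasFDerivAt
    have hpx := (cda_pd (hz.cda hx) i).differentiableAt (by norm_num) |>.hasFDerivAt
    have hc := hasF_coord i0 x
    have hA := (hφ.hasFDerivAt.pow 2).mul
      (((hc.pow 2).mul ((hasF_q x).rpow_const (p := -(n : ℝ) / 2) (Or.inl hq.ne'))).mul
        (hzx.mul hpx) |>.add
        ((((hc.pow 2).mul ((hasF_q x).rpow_const (p := -(n : ℝ) / 2 - 1) (Or.inl hq.ne'))).mul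
        ((hzx.pow 2).mul (hasF_coord i x))).const_mul (((n : ℝ) - 2 * α) / 2)))
    have h0 : HasFDerivAt (fld i0 (((n : ℝ) - 2 * α) / 2) z φ i) _ x := hA
    rw [pd, h0.fderiv]
    simp only [add_apply, smul_apply, smul_eq_mul,
      innerSL_apply_apply, inner_single, ← hqd, ← hQ, h1, h2,
      nsmul_eq_mul, Pi.mul_apply, Pi.add_apply]
    rw [show fderiv ℝ z x (EuclideanSpace.single i 1) = pd z i x from rfl,
      show fderiv ℝ φ x (EuclideanSpace.single i 1) = pd φ i x from rfl,
      show fderiv ℝ (pd z i) x (EuclideanSpace.single i 1) = pd (pd z i) i x from rfl]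
    split_ifs with hi
    · subst hi; simp; ring
    · have hi' : ¬ i0 = i := fun h => hi h.symm
      simp [hi']; ring
  rw [Finset.sum_congr rfl (fun i _ => hd' i)]
  simp only [Finset.sum_add_distrib, ← Finset.mul_sum]
  have he := hz.eqn x hx
  rw [lap_eq] at he
  rw [sum_sq]
  simp only [Finset.sum_ite_eq', Finset.mem_univ, if_true, Finset.sum_const, Finset.card_univ,
    Fintype.card_fin, nsmul_eq_mul, wt, ← hqd, h2]
  linear_combination (φ x ^ 2 * x i0 * q * Q * z x) * he

/-- squared gradient times squared radius -/
def gE {n : ℕ} (z : Eu n → ℝ) (x : Eu n) : ℝ := ‖x‖ ^ 2 * ∑ i, pd z i x ^ 2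

lemma gE_nonneg {n : ℕ} (z : Eu n → ℝ) (x : Eu n) : 0 ≤ gE z x :=
  mul_nonneg (by positivity) (Finset.sum_nonneg fun i _ => sq_nonneg _)

lemma wt_nonneg {n : ℕ} (i0 : Fin n) (x : Eu n) : 0 ≤ wt i0 x := by
  unfold wt; positivity

lemma contDiff_of_off {n : ℕ} {k : WithTop ℕ∞} {f φ : Eu n → ℝ}
    (h1 : ∀ x ∈ tsupport φ, ContDiffAt ℝ k f x) (h2 : ∀ x ∉ tsupport φ, f x = 0) :
    ContDiff ℝ k f := by
  rw [contDiff_iff_contDiffAt]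
  intro x
  by_cases hx : x ∈ tsupport φ
  · exact h1 x hx
  · have : f =ᶠ[𝓝 x] fun _ => 0 := by
      filter_upwards [(isClosed_tsupport φ).isOpen_compl.mem_nhds hx] with y hy using h2 y hy
    exact contDiffAt_const.congr_of_eventuallyEq this

lemma continuous_of_off {n : ℕ} {f φ : Eu n → ℝ}
    (h1 : ∀ x ∈ tsupport φ, ContinuousAt f x) (h2 : ∀ x ∉ tsupport φ, f x = 0) :
    Continuous f := by
  rw [continuous_iff_continuousAt]
  intro x
  by_cases hx : x ∈ tsupport φ
  · exact h1 x hx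
  · have : f =ᶠ[𝓝 x] fun _ => 0 := by
      filter_upwards [(isClosed_tsupport φ).isOpen_compl.mem_nhds hx] with y hy using h2 y hy
    exact continuousAt_const.congr this.symm

lemma hcs_of_off {n : ℕ} {f φ : Eu n → ℝ} (hc : HasCompactSupport φ)
    (h2 : ∀ x ∉ tsupport φ, f x = 0) : HasCompactSupport f :=
  HasCompactSupport.intro hc h2

lemma pd_cont {n : ℕ} {F : Eu n → ℝ} (hF : ContDiff ℝ 1 F) (i : Fin n) :
    Continuous (pd F i) :=
  (hF.continuous_fderiv (by norm_num)).clm_apply continuous_const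

lemma pd_off {n : ℕ} {F : Eu n → ℝ} (i : Fin n) {x : Eu n} (hx : x ∉ tsupport F) :
    pd F i x = 0 := by
  have : fderiv ℝ F x = 0 := by
    by_contra h
    exact hx (support_fderiv_subset ℝ h)
  simp [pd, this]

lemma pd_integrable {n : ℕ} {F : Eu n → ℝ} (hF : ContDiff ℝ 1 F) (hc : HasCompactSupport F)
    (i : Fin n) : Integrable (pd F i) :=
  (pd_cont hF i).integrable_of_hasCompactSupport (hcs_of_off hc fun _ hx => pd_off i hx)

lemma integral_pd {n : ℕ} {F : Eu n → ℝ} (hF : ContDiff ℝ 1 F) (hc : HasCompactSupport F)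
    (i : Fin n) : ∫ x, pd F i x = 0 := by
  have := integral_mul_fderiv_eq_neg_fderiv_mul_of_integrable (μ := (volume : Measure (Eu n)))
    (f := fun _ => (1 : ℝ)) (g := F) (v := EuclideanSpace.single i 1)
    (by simp) (by simp only [one_mul]; exact pd_integrable hF hc i)
    (by simpa using hF.continuous.integrable_of_hasCompactSupport hc)
    (fun _ _ => differentiableAt_const _) (fun x _ => hF.differentiable (by norm_num) x)
  simpa [pd] using this

lemma wt_cda {n : ℕ} {i0 : Fin n} {x : Eu n} (hx : x ∈ hs i0) {k : WithTop ℕ∞} :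
    ContDiffAt ℝ k (wt i0) x :=
  ((cda_coord i0 x).pow 2).mul (cda_q hx _)

lemma cacc {n : ℕ} {i0 : Fin n} {α : ℝ} {z φ : Eu n → ℝ} (hz : Sol i0 α z)
    (hφ : ContDiff ℝ 1 φ) (hc : HasCompactSupport φ) (hs' : tsupport φ ⊆ hs i0) :
    ∫⁻ x in hs i0, ENNReal.ofReal (wt i0 x * φ x ^ 2 * gE z x) ≤
    ∫⁻ x in hs i0, ENNReal.ofReal (wt i0 x * z x ^ 2 *
      (4 * gE φ x + 2 * |n - 2 * α| * |φ x * ∑ i, x i * pd φ i x|)) := by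
  set f : Eu n → ℝ := fun x => wt i0 x * φ x ^ 2 * gE z x with hf
  set g : Eu n → ℝ := fun x => wt i0 x * z x ^ 2 *
      (4 * gE φ x + 2 * |n - 2 * α| * |φ x * ∑ i, x i * pd φ i x|) with hg
  have hφ0 : ∀ x ∉ tsupport φ, φ x = 0 := fun x hx => image_eq_zero_of_notMem_tsupport hx
  have hf0 : ∀ x ∉ tsupport φ, f x = 0 := fun x hx => by simp [hf, hφ0 x hx]
  have hg0 : ∀ x ∉ tsupport φ, g x = 0 := fun x hx => by
    simp [hg, hφ0 x hx, gE, pd_off _ hx]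
  have hgE : ∀ x ∈ tsupport φ, ContinuousAt (gE z) x := fun x hx => by
    unfold gE
    refine ContinuousAt.mul (by fun_prop) (tendsto_finsetSum _ fun i _ => ?_)
    exact (cda_pd (hz.cda (hs' hx)) i).continuousAt.pow 2
  have hgEφ : Continuous (gE φ) := by
    unfold gE
    refine Continuous.mul (by fun_prop) (continuous_finsetSum _ fun i _ => ?_)
    exact (pd_cont hφ i).pow 2
  have hDφ : Continuous fun x : Eu n => ∑ i, x i * pd φ i x := by
    refine continuous_finsetSum _ fun i _ => ?_
    exact Continuous.mul (by fun_prop) (pd_cont hφ i)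
  have hfc : Continuous f := continuous_of_off (fun x hx =>
    ((wt_cda (k := 0) (hs' hx)).continuousAt.mul (hφ.continuous.continuousAt.pow 2)).mul
      (hgE x hx)) hf0
  have hgc : Continuous g := continuous_of_off (fun x hx =>
    ((wt_cda (k := 0) (hs' hx)).continuousAt.mul ((hz.cda (hs' hx)).continuousAt.pow 2)).mul
      (by have := hφ.continuous; exact Continuous.continuousAt (by fun_prop))) hg0
  have hfi : Integrable f := hfc.integrable_of_hasCompactSupport (hcs_of_off hc hf0)
  have hgi : Integrable g := hgc.integrable_of_hasCompactSupport (hcs_of_off hc hg0)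
  set F := fun i => fld i0 (((n : ℝ) - 2 * α) / 2) z φ i with hF
  have hF0 : ∀ i, ∀ x ∉ tsupport φ, F i x = 0 := fun i x hx => by simp [hF, fld, hφ0 x hx]
  have hFd : ∀ i, ContDiff ℝ 1 (F i) := fun i => contDiff_of_off (fun x hx => by
    have h := hs' hx
    have hzz : ContDiffAt ℝ 1 z x := (hz.cda h).of_le (by norm_num)
    exact (hφ.contDiffAt.pow 2).mul
      ((((cda_coord i0 x).pow 2).mul (cda_q h _)).mul (hzz.mul (cda_pd (hz.cda h) i)) |>.add
        (contDiffAt_const.mul ((((cda_coord i0 x).pow 2).mul (cda_q h _)).mul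
          ((hzz.pow 2).mul (cda_coord i x)))))) (hF0 i)
  have hFc : ∀ i, HasCompactSupport (F i) := fun i => hcs_of_off hc (hF0 i)
  have hdi : Integrable fun x => ∑ i, pd (F i) i x :=
    integrable_finsetSum _ fun i _ => pd_integrable (hFd i) (hFc i) i
  have hd0 : ∫ x, ∑ i, pd (F i) i x = 0 := by
    rw [integral_finsetSum _ fun i _ => pd_integrable (hFd i) (hFc i) i]
    exact Finset.sum_eq_zero fun i _ => integral_pd (hFd i) (hFc i) i
  have hpt : ∀ x, f x ≤ g x + 2 * ∑ i, pd (F i) i x := by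
    intro x
    by_cases hx : x ∈ tsupport φ
    · rw [hF]
      simp only
      rw [div_fld hz (hs' hx) (hφ.differentiable (by norm_num) x)]
      simp only [hf, hg]
      have hw := wt_nonneg i0 x
      have h1 : 0 ≤ wt i0 x * ‖x‖ ^ 2 * ∑ i, (φ x * pd z i x + 2 * z x * pd φ i x) ^ 2 :=
        mul_nonneg (mul_nonneg hw (by positivity)) (Finset.sum_nonneg fun i _ => sq_nonneg _)
      have h2 : ∑ i, (φ x * pd z i x + 2 * z x * pd φ i x) ^ 2 =
          φ x ^ 2 * ∑ i, pd z i x ^ 2 + 4 * z x * φ x * ∑ i, pd φ i x * pd z i x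
            + 4 * z x ^ 2 * ∑ i, pd φ i x ^ 2 := by
        simp only [Finset.mul_sum, ← Finset.sum_add_distrib]
        exact Finset.sum_congr rfl fun i _ => by ring
      rw [h2] at h1
      have h3 : 0 ≤ wt i0 x * z x ^ 2 * (|n - 2 * α| * |φ x * ∑ i, x i * pd φ i x| +
          (n - 2 * α) * (φ x * ∑ i, x i * pd φ i x)) := by
        refine mul_nonneg (by positivity) ?_
        rw [← abs_mul]
        linarith [neg_abs_le ((n - 2 * α) * (φ x * ∑ i, x i * pd φ i x))]
      unfold gE
      linarith
    · rw [hf0 x hx, hg0 x hx]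
      have : ∑ i, pd (F i) i x = 0 := Finset.sum_eq_zero fun i _ => pd_off i (fun h => hx
        (closure_minimal (fun y hy => by by_contra h'; exact hy (hF0 i y h')) (isClosed_tsupport φ) h))
      simp [this]
  have hle : ∫ x, f x ≤ ∫ x, g x := by
    calc ∫ x, f x ≤ ∫ x, (g x + 2 * ∑ i, pd (F i) i x) :=
          integral_mono hfi (hgi.add (hdi.const_mul 2)) hpt
      _ = ∫ x, g x := by
          rw [integral_add hgi (hdi.const_mul 2), integral_const_mul, hd0]; simp
  have hfn : ∀ x, 0 ≤ f x := fun x =>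
    mul_nonneg (mul_nonneg (wt_nonneg _ _) (sq_nonneg _)) (gE_nonneg _ _)
  have hgn : ∀ x, 0 ≤ g x := fun x =>
    mul_nonneg (mul_nonneg (wt_nonneg _ _) (sq_nonneg _))
      (by have := gE_nonneg φ x; positivity)
  calc ∫⁻ x in hs i0, ENNReal.ofReal (f x) ≤ ∫⁻ x, ENNReal.ofReal (f x) :=
        setLIntegral_le_lintegral _ _
    _ = ENNReal.ofReal (∫ x, f x) :=
        (ofReal_integral_eq_lintegral_ofReal hfi (Eventually.of_forall hfn)).symm
    _ ≤ ENNReal.ofReal (∫ x, g x) := ENNReal.ofReal_le_ofReal hle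
    _ = ∫⁻ x, ENNReal.ofReal (g x) :=
        ofReal_integral_eq_lintegral_ofReal hgi (Eventually.of_forall hgn)
    _ = ∫⁻ x in hs i0, ENNReal.ofReal (g x) := by
        rw [← lintegral_indicator (isOpen_hs i0).measurableSet]
        refine lintegral_congr fun x => ?_
        by_cases hx : x ∈ hs i0
        · rw [indicator_of_mem hx]
        · rw [indicator_of_notMem hx, hg0 x fun h => hx (hs' h)]; simp

def ann (n : ℕ) (N : ℕ) : Set (Eu n) := {x | x ≠ 0 ∧ |Real.log (‖x‖ ^ 2)| ≤ 2 * N}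

lemma ann_meas (n N : ℕ) : MeasurableSet (ann n N) := by
  unfold ann
  refine MeasurableSet.inter (measurableSet_singleton (0 : Eu n)).compl ?_
  have : Measurable fun x : Eu n => |Real.log (‖x‖ ^ 2)| := by
    have h : Measurable fun x : Eu n => Real.log (‖x‖ ^ 2) := by fun_prop
    exact measurable_abs.comp h
  exact measurableSet_le this measurable_const

lemma ann_int {n : ℕ} (i0 : Fin n) : ∃ c : ℝ, 0 ≤ c ∧ ∀ N : ℕ,
    ∫⁻ x in ann n N, ENNReal.ofReal ((‖x‖ ^ 2) ^ (-(n : ℝ) / 2)) ≤ ENNReal.ofReal (c * N) := by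
  have hn : 0 < n := Fin.pos i0
  have : Nonempty (Fin n) := ⟨i0⟩
  have : Nontrivial (Eu n) := inferInstance
  refine ⟨2 * (n * (volume : Measure (Eu n)).real (Metric.ball 0 1)), by positivity, fun N => ?_⟩
  set S : Set ℝ := Icc (Real.exp (-N)) (Real.exp N) with hS
  set f : ℝ → ℝ := S.indicator (fun y => (y ^ n)⁻¹) with hf
  have hfin : Module.finrank ℝ (Eu n) = n := by simp
  have hSpos : ∀ y ∈ S, 0 < y := fun y hy => lt_of_lt_of_le (Real.exp_pos _) hy.1
  have hpow : ∀ y : ℝ, y ^ (Module.finrank ℝ (Eu n) - 1) • f y = S.indicator (fun y => y⁻¹) y := by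
    intro y
    by_cases hy : y ∈ S
    · have := hSpos y hy
      simp only [hf, indicator_of_mem hy, hfin, smul_eq_mul]
      obtain ⟨k, rfl⟩ : ∃ k, n = k + 1 := ⟨n - 1, by omega⟩
      simp only [Nat.add_sub_cancel]
      field_simp
      ring
    · simp [hf, indicator_of_notMem hy]
  have hcont : ContinuousOn (fun y : ℝ => y⁻¹) S :=
    continuousOn_inv₀.mono fun y hy => (hSpos y hy).ne'
  have hint : IntegrableOn (fun y : ℝ => y ^ (Module.finrank ℝ (Eu n) - 1) • f y) (Ioi 0) := by
    simp_rw [hpow]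
    exact ((hcont.integrableOn_compact isCompact_Icc).integrable_indicator
      measurableSet_Icc).integrableOn
  have hI : Integrable (fun x : Eu n => f ‖x‖) := (integrable_fun_norm_addHaar volume).2 hint
  have hval : ∫ x : Eu n, f ‖x‖ = 2 * (n * (volume : Measure (Eu n)).real (Metric.ball 0 1)) * N := by
    rw [integral_fun_norm_addHaar]
    simp_rw [hpow]
    rw [setIntegral_indicator measurableSet_Icc, hfin]
    have : Ioi 0 ∩ S = S := inter_eq_self_of_subset_right fun y hy => hSpos y hy
    rw [this, hS, integral_Icc_eq_integral_Ioc, ← intervalIntegral.integral_of_le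
      (Real.exp_le_exp.2 (by have : (0:ℝ) ≤ N := by positivity
                             linarith)),
      integral_inv_of_pos (Real.exp_pos _) (Real.exp_pos _), ← Real.exp_sub, Real.log_exp]
    simp only [nsmul_eq_mul, smul_eq_mul]; ring
  have hfn : ∀ x : Eu n, 0 ≤ f ‖x‖ := fun x => by
    simp only [hf]
    exact indicator_nonneg (fun y hy => by have := hSpos y hy; positivity) _
  rw [← hval, ofReal_integral_eq_lintegral_ofReal hI (Eventually.of_forall hfn),
    ← lintegral_indicator (ann_meas n N)]
  refine lintegral_mono fun x => ?_
  by_cases hx : x ∈ ann n N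
  · rw [indicator_of_mem hx]
    have hr : 0 < ‖x‖ := norm_pos_iff.2 hx.1
    have h2 := abs_le.1 hx.2
    rw [Real.log_pow] at h2
    push_cast at h2
    have hm : ‖x‖ ∈ S := ⟨(Real.le_log_iff_exp_le hr).1 (by linarith [h2.1]),
      (Real.log_le_iff_le_exp hr).1 (by linarith [h2.2])⟩
    simp only [hf, indicator_of_mem hm]
    apply ENNReal.ofReal_le_ofReal
    rw [← Real.rpow_natCast ‖x‖ 2, ← Real.rpow_mul hr.le, ← Real.rpow_natCast ‖x‖ n,
      ← Real.rpow_neg hr.le]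
    apply le_of_eq; congr 1; push_cast; ring
  · rw [indicator_of_notMem hx]; simp

def hbump : ContDiffBump (0 : ℝ) := ⟨1, 2, by norm_num, by norm_num⟩
def hcut (t : ℝ) : ℝ := hbump t
def ccut (s : ℝ) : ℝ := Real.smoothTransition (s - 1)

lemma hcut_smooth : ContDiff ℝ 1 hcut := hbump.contDiff (n := 1)
lemma ccut_smooth : ContDiff ℝ 1 ccut :=
  (Real.smoothTransition.contDiff (n := 1)).comp (contDiff_id.sub contDiff_const)
lemma hcut_nonneg (t : ℝ) : 0 ≤ hcut t := hbump.nonneg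
lemma hcut_le (t : ℝ) : hcut t ≤ 1 := hbump.le_one
lemma ccut_nonneg (t : ℝ) : 0 ≤ ccut t := Real.smoothTransition.nonneg _
lemma ccut_le (t : ℝ) : ccut t ≤ 1 := Real.smoothTransition.le_one _
lemma hcut_one {t : ℝ} (h : |t| ≤ 1) : hcut t = 1 :=
  hbump.one_of_mem_closedBall (by simpa [hbump] using h)
lemma hcut_zero {t : ℝ} (h : 2 < |t|) : hcut t = 0 :=
  hbump.zero_of_le_dist (by simpa [hbump] using h.le)
lemma ccut_zero {t : ℝ} (h : t ≤ 1) : ccut t = 0 :=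
  Real.smoothTransition.zero_of_nonpos (by linarith)
lemma ccut_one {t : ℝ} (h : 2 ≤ t) : ccut t = 1 :=
  Real.smoothTransition.one_of_one_le (by linarith)
lemma dhcut_zero {t : ℝ} (h : 2 < |t|) : deriv hcut t = 0 := by
  have : hcut =ᶠ[𝓝 t] fun _ => 0 := by
    filter_upwards [(isOpen_lt continuous_const continuous_abs).mem_nhds h] with y hy
    exact hcut_zero hy
  rw [this.deriv_eq]; simp
lemma dccut_zero {t : ℝ} (h : 2 < t) : deriv ccut t = 0 := by
  have : ccut =ᶠ[𝓝 t] fun _ => 1 := by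
    filter_upwards [lt_mem_nhds h] with y hy
    exact ccut_one hy.le
  rw [this.deriv_eq]; simp
lemma dccut_zero' {t : ℝ} (h : t < 1) : deriv ccut t = 0 := by
  have : ccut =ᶠ[𝓝 t] fun _ => 0 := by
    filter_upwards [gt_mem_nhds h] with y hy
    exact ccut_zero hy.le
  rw [this.deriv_eq]; simp

lemma dhcut_bound : ∃ M : ℝ, 0 ≤ M ∧ ∀ t, |deriv hcut t| ≤ M := by
  have hc : HasCompactSupport hcut := hbump.hasCompactSupport
  obtain ⟨C, hC⟩ := hc.deriv.exists_bound_of_continuous (hcut_smooth.continuous_deriv (by norm_num))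
  exact ⟨C, (norm_nonneg _).trans (hC 0), hC⟩

lemma dccut_bound : ∃ K : ℝ, 0 ≤ K ∧ ∀ s, |s * deriv ccut s| ≤ K := by
  have hc : HasCompactSupport fun s => s * deriv ccut s := by
    refine HasCompactSupport.intro (K := Icc 1 2) isCompact_Icc fun s hs => ?_
    by_cases h : s < 1
    · rw [dccut_zero' h, mul_zero]
    · rw [dccut_zero, mul_zero]
      by_contra h'
      exact hs ⟨by linarith, by linarith⟩
  obtain ⟨C, hC⟩ := hc.exists_bound_of_continuous
    (continuous_id.mul (ccut_smooth.continuous_deriv (by norm_num)))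
  exact ⟨C, (norm_nonneg _).trans (hC 0), hC⟩

/-- logarithmic radial variable -/
def lg {n : ℕ} (N : ℕ) (x : Eu n) : ℝ := Real.log (‖x‖ ^ 2) / N

def cut {n : ℕ} (i0 : Fin n) (N k : ℕ) (x : Eu n) : ℝ := hcut (lg N x) * ccut (k * x i0)

lemma lg_off {n : ℕ} {i0 : Fin n} {N : ℕ} (hN : 0 < N) {x : Eu n} (hx : x ∈ hs i0)
    (h : x ∉ ann n N) : 2 < |lg N x| := by
  have hq := norm_sq_pos hx
  have hx0 : x ≠ 0 := by rintro rfl; simp at hq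
  have hN' : (0 : ℝ) < N := by exact_mod_cast hN
  have : 2 * (N : ℝ) < |Real.log (‖x‖ ^ 2)| := by
    by_contra h'
    exact h ⟨hx0, not_lt.1 h'⟩
  rw [lg, abs_div, abs_of_pos hN', lt_div_iff₀ hN']
  exact this

lemma lg_cda {n : ℕ} {i0 : Fin n} {N : ℕ} {x : Eu n} (hx : x ∈ hs i0) :
    ContDiffAt ℝ 1 (lg N) x := by
  unfold lg
  exact (((contDiff_norm_sq ℝ).contDiffAt).log (norm_sq_pos hx).ne').div_const _

lemma cut_tsupport {n : ℕ} (i0 : Fin n) {N k : ℕ} (hN : 0 < N) (hk : 0 < k) :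
    tsupport (cut i0 N k) ⊆ {x | 1 ≤ k * x i0} ∩ Metric.closedBall 0 (Real.exp N) := by
  refine closure_minimal ?_ ((isClosed_le continuous_const (by fun_prop)).inter
    Metric.isClosed_closedBall)
  intro x hx
  have h1 : 1 < k * x i0 := by
    by_contra h
    exact hx (by simp [cut, ccut_zero (not_lt.1 h)])
  have hk' : (0 : ℝ) < k := by exact_mod_cast hk
  have hxs : x ∈ hs i0 := by
    by_contra h
    have : x i0 ≤ 0 := not_lt.1 h
    nlinarith
  refine ⟨h1.le, ?_⟩
  have h2 : x ∈ ann n N := by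
    by_contra h
    exact hx (by simp [cut, hcut_zero (lg_off hN hxs h)])
  have hr : 0 < ‖x‖ := norm_pos_iff.2 h2.1
  have h3 := (abs_le.1 h2.2).2
  rw [Real.log_pow] at h3
  push_cast at h3
  rw [mem_closedBall_zero_iff]
  exact (Real.log_le_iff_le_exp hr).1 (by linarith)

lemma cut_hs {n : ℕ} (i0 : Fin n) {N k : ℕ} (hN : 0 < N) (hk : 0 < k) :
    tsupport (cut i0 N k) ⊆ hs i0 := by
  intro x hx
  have h1 := (cut_tsupport i0 hN hk hx).1
  have hk' : (0 : ℝ) < k := by exact_mod_cast hk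
  by_contra h
  have : x i0 ≤ 0 := not_lt.1 h
  simp only [mem_ofPred_eq] at h1
  nlinarith

lemma cut_hcs {n : ℕ} (i0 : Fin n) {N k : ℕ} (hN : 0 < N) (hk : 0 < k) :
    HasCompactSupport (cut i0 N k) :=
  (isCompact_closedBall (0 : Eu n) (Real.exp N)).of_isClosed_subset (isClosed_tsupport _)
    (fun _ hx => (cut_tsupport i0 hN hk hx).2)

lemma cut_smooth {n : ℕ} (i0 : Fin n) {N k : ℕ} (hN : 0 < N) (hk : 0 < k) :
    ContDiff ℝ 1 (cut i0 N k) := by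
  refine contDiff_of_off (φ := cut i0 N k) (fun x hx => ?_)
    (fun x hx => image_eq_zero_of_notMem_tsupport hx)
  have h := cut_hs i0 hN hk hx
  exact (hcut_smooth.contDiffAt.comp x (lg_cda h)).mul
    (ccut_smooth.contDiffAt.comp x (contDiffAt_const.mul (cda_coord i0 x)))

lemma pd_cut {n : ℕ} {i0 : Fin n} {N k : ℕ} {x : Eu n} (hx : x ∈ hs i0) (i : Fin n) :
    pd (cut i0 N k) i x = deriv hcut (lg N x) * ccut (k * x i0) * (2 / (‖x‖ ^ 2 * N)) * x i
      + hcut (lg N x) * deriv ccut (k * x i0) * k * (if i = i0 then 1 else 0) := by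
  have hq := norm_sq_pos hx
  have h1 : HasFDerivAt (lg (n := n) N) _ x := ((hasF_q x).log hq.ne').mul_const ((N : ℝ)⁻¹)
  have h2 := ((hcut_smooth.differentiable (by norm_num) (lg N x)).hasDerivAt).comp_hasFDerivAt x h1
  have h3 := ((ccut_smooth.differentiable (by norm_num) (k * x i0)).hasDerivAt).comp_hasFDerivAt x
    ((hasF_coord i0 x).const_mul (k : ℝ))
  have h4 : HasFDerivAt (cut i0 N k) _ x := h2.mul h3
  rw [pd, h4.fderiv]
  simp only [add_apply, smul_apply, smul_eq_mul, innerSL_apply_apply, inner_single,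
    Function.comp_apply]
  have : (EuclideanSpace.proj i0 : Eu n →L[ℝ] ℝ) (EuclideanSpace.single i 1) =
      if i = i0 then 1 else 0 := proj_single i i0
  rw [this]
  rw [div_eq_mul_inv, mul_inv]
  split_ifs <;> ring

lemma gE_cut {n : ℕ} {i0 : Fin n} {N k : ℕ} {x : Eu n} (hx : x ∈ hs i0) {A B : ℝ}
    (hA : A = deriv hcut (lg N x) * ccut (k * x i0) * (2 / (‖x‖ ^ 2 * N)))
    (hB : B = hcut (lg N x) * deriv ccut (k * x i0) * k) :
    gE (cut i0 N k) x = ‖x‖ ^ 2 * (A ^ 2 * ‖x‖ ^ 2 + 2 * A * B * x i0 + B ^ 2) ∧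
    ∑ i, x i * pd (cut i0 N k) i x = A * ‖x‖ ^ 2 + B * x i0 := by
  constructor
  · rw [gE, ← sum_sq x]
    congr 1
    have : ∀ i, pd (cut i0 N k) i x ^ 2 = A ^ 2 * x i ^ 2 +
        (2 * A * B) * (if i = i0 then x i else 0) + B ^ 2 * (if i = i0 then 1 else 0) := by
      intro i
      rw [pd_cut hx, ← hA, ← hB]
      split_ifs <;> ring
    simp only [this, Finset.sum_add_distrib, ← Finset.mul_sum]
    simp
  · rw [← sum_sq x]
    have : ∀ i, x i * pd (cut i0 N k) i x = A * x i ^ 2 +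
        B * (if i = i0 then x i else 0) := by
      intro i
      rw [pd_cut hx, ← hA, ← hB]
      split_ifs <;> ring
    simp only [this, Finset.sum_add_distrib, ← Finset.mul_sum]
    simp

lemma Sol.gE_cont {n : ℕ} {i0 : Fin n} {α : ℝ} {z : Eu n → ℝ} (hz : Sol i0 α z) :
    ContinuousOn (gE z) (hs i0) := fun x hx => by
  unfold gE
  refine (ContinuousAt.mul (by fun_prop) (tendsto_finsetSum _ fun i _ => ?_)).continuousWithinAt
  exact (cda_pd (hz.cda hx) i).continuousAt.pow 2

lemma wt_cont {n : ℕ} (i0 : Fin n) : ContinuousOn (wt i0) (hs i0) := fun _ hx =>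
  (wt_cda (k := 0) hx).continuousAt.continuousWithinAt

lemma aem {n : ℕ} {i0 : Fin n} {f : Eu n → ℝ} (hf : ContinuousOn f (hs i0)) :
    AEMeasurable (fun x => ENNReal.ofReal (f x)) (volume.restrict (hs i0)) :=
  (hf.aemeasurable (isOpen_hs i0).measurableSet).ennreal_ofReal

lemma wt_eq {n : ℕ} {i0 : Fin n} {x : Eu n} (hx : x ∈ hs i0) :
    wt i0 x * ‖x‖ ^ 2 = x i0 ^ 2 * (‖x‖ ^ 2) ^ (-(n : ℝ) / 2) := by
  have hq := norm_sq_pos hx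
  have : (‖x‖ ^ 2) ^ (-(n : ℝ) / 2) = (‖x‖ ^ 2) ^ (-(n : ℝ) / 2 - 1) * ‖x‖ ^ 2 := by
    nth_rewrite 3 [← Real.rpow_one (‖x‖ ^ 2)]
    rw [← Real.rpow_add hq]; congr 1; ring
  rw [this, wt]; ring

lemma wt_le {n : ℕ} {i0 : Fin n} {x : Eu n} (hx : x ∈ hs i0) :
    wt i0 x ≤ (‖x‖ ^ 2) ^ (-(n : ℝ) / 2) := by
  have hq := norm_sq_pos hx
  have h := wt_eq hx
  have h2 := sq_le_norm i0 x
  have h3 : 0 ≤ (‖x‖ ^ 2) ^ (-(n : ℝ) / 2) := by positivity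
  nlinarith

set_option maxHeartbeats 1000000 in
lemma cut_bound {n : ℕ} {i0 : Fin n} {N k : ℕ} (hN : 0 < N) {M K β C ζ : ℝ} (hM0 : 0 ≤ M)
    (hM : ∀ t, |deriv hcut t| ≤ M) (hK0 : 0 ≤ K) (hK : ∀ s, |s * deriv ccut s| ≤ K)
    (hζ : |ζ| ≤ C) {x : Eu n} (hx : x ∈ hs i0) :
    wt i0 x * ζ ^ 2 * (4 * gE (cut i0 N k) x + 2 * |β| * |cut i0 N k x *
      ∑ i, x i * pd (cut i0 N k) i x|) ≤ (‖x‖ ^ 2) ^ (-(n : ℝ) / 2) *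
      (C ^ 2 * (4 * (2 * M + K) ^ 2 + 2 * |β| * (2 * M + K))) := by
  obtain ⟨hg, hD⟩ := gE_cut (N := N) (k := k) hx rfl rfl
  set A := deriv hcut (lg N x) * ccut (k * x i0) * (2 / (‖x‖ ^ 2 * N)) with hA
  set B := hcut (lg N x) * deriv ccut (k * x i0) * k with hB
  rw [hg, hD]
  have hq := norm_sq_pos hx
  have hN' : (1 : ℝ) ≤ N := by exact_mod_cast hN
  have hx1 : 0 < x i0 := hx
  have hw := wt_nonneg i0 x
  have hP : 0 ≤ (‖x‖ ^ 2) ^ (-(n : ℝ) / 2) := by positivity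
  have hAq : |A * ‖x‖ ^ 2| ≤ 2 * M := by
    have : A * ‖x‖ ^ 2 = deriv hcut (lg N x) * (ccut (k * x i0) * (2 / N)) := by
      have hr : ‖x‖ ≠ 0 := fun h => by rw [h] at hq; norm_num at hq
      rw [hA]; field_simp
    rw [this, abs_mul]
    have h1 : |ccut (k * x i0) * (2 / N)| ≤ 2 := by
      rw [abs_of_nonneg (mul_nonneg (ccut_nonneg _) (by positivity))]
      have : (2 : ℝ) / N ≤ 2 := div_le_self (by norm_num) hN'
      have h0 : (0 : ℝ) ≤ 2 / N := by positivity
      nlinarith [ccut_nonneg (k * x i0), ccut_le (k * x i0)]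
    nlinarith [hM (lg N x), abs_nonneg (deriv hcut (lg N x)), abs_nonneg (ccut (k * x i0) * (2 / N))]
  have hBx : |B * x i0| ≤ K := by
    have : B * x i0 = hcut (lg N x) * (k * x i0 * deriv ccut (k * x i0)) := by rw [hB]; ring
    rw [this, abs_mul, abs_of_nonneg (hcut_nonneg _)]
    nlinarith [hK (k * x i0), hcut_nonneg (lg N x), hcut_le (lg N x),
      abs_nonneg (k * x i0 * deriv ccut (k * x i0))]
  clear_value A B
  have hAx : |A * ‖x‖ * x i0| ≤ 2 * M := by
    refine le_trans ?_ hAq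
    have h1 : x i0 ≤ ‖x‖ := by
      have := sq_le_norm i0 x
      exact abs_le_of_sq_le_sq' this (norm_nonneg _) |>.2
    rw [pow_two, ← mul_assoc, abs_mul (A * ‖x‖), abs_mul (A * ‖x‖), abs_of_pos hx1, abs_norm]
    exact mul_le_mul_of_nonneg_left h1 (abs_nonneg _)
  have hAx2 : |A * x i0 ^ 2| ≤ 2 * M := by
    refine le_trans ?_ hAq
    rw [abs_mul, abs_mul, abs_of_nonneg (sq_nonneg (x i0)), abs_of_pos hq]
    exact mul_le_mul_of_nonneg_left (sq_le_norm i0 x) (abs_nonneg _)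
  have e1 : wt i0 x * (‖x‖ ^ 2 * (A ^ 2 * ‖x‖ ^ 2 + 2 * A * B * x i0 + B ^ 2)) ≤
      (‖x‖ ^ 2) ^ (-(n : ℝ) / 2) * (2 * M + K) ^ 2 := by
    rw [← mul_assoc, wt_eq hx]
    have : x i0 ^ 2 * (‖x‖ ^ 2) ^ (-(n : ℝ) / 2) * (A ^ 2 * ‖x‖ ^ 2 + 2 * A * B * x i0 + B ^ 2) =
      (‖x‖ ^ 2) ^ (-(n : ℝ) / 2) * ((A * ‖x‖ * x i0) ^ 2 + 2 * ((A * x i0 ^ 2) * (B * x i0)) +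
        (B * x i0) ^ 2) := by ring
    rw [this]
    refine mul_le_mul_of_nonneg_left ?_ hP
    have a1 : (A * ‖x‖ * x i0) ^ 2 ≤ (2 * M) ^ 2 := sq_le_sq' (abs_le.1 hAx).1 (abs_le.1 hAx).2
    have a2 : (B * x i0) ^ 2 ≤ K ^ 2 := sq_le_sq' (abs_le.1 hBx).1 (abs_le.1 hBx).2
    have a3 : (A * x i0 ^ 2) * (B * x i0) ≤ (2 * M) * K := by
      refine (le_abs_self _).trans ?_
      rw [abs_mul]
      exact mul_le_mul hAx2 hBx (abs_nonneg _) (by linarith)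
    nlinarith
  have e2 : |cut i0 N k x * (A * ‖x‖ ^ 2 + B * x i0)| ≤ 2 * M + K := by
    rw [abs_mul]
    have h1 : |cut i0 N k x| ≤ 1 := by
      rw [cut, abs_of_nonneg (mul_nonneg (hcut_nonneg _) (ccut_nonneg _))]
      exact mul_le_one₀ (hcut_le _) (ccut_nonneg _) (ccut_le _)
    have h2 : |A * ‖x‖ ^ 2 + B * x i0| ≤ 2 * M + K := (abs_add_le _ _).trans (by linarith)
    nlinarith [abs_nonneg (cut i0 N k x), abs_nonneg (A * ‖x‖ ^ 2 + B * x i0)]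
  have e3 : ζ ^ 2 ≤ C ^ 2 := sq_le_sq' (abs_le.1 hζ).1 (abs_le.1 hζ).2
  have e4 := wt_le hx
  have hMK : 0 ≤ 2 * M + K := by linarith
  have e5 : wt i0 x * (2 * |β| * |cut i0 N k x * (A * ‖x‖ ^ 2 + B * x i0)|) ≤
      (‖x‖ ^ 2) ^ (-(n : ℝ) / 2) * (2 * |β| * (2 * M + K)) := by
    gcongr
  calc _ = ζ ^ 2 * (4 * (wt i0 x * (‖x‖ ^ 2 * (A ^ 2 * ‖x‖ ^ 2 + 2 * A * B * x i0 + B ^ 2))) +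
        wt i0 x * (2 * |β| * |cut i0 N k x * (A * ‖x‖ ^ 2 + B * x i0)|)) := by ring
    _ ≤ ζ ^ 2 * (4 * ((‖x‖ ^ 2) ^ (-(n : ℝ) / 2) * (2 * M + K) ^ 2) +
        (‖x‖ ^ 2) ^ (-(n : ℝ) / 2) * (2 * |β| * (2 * M + K))) := by gcongr
    _ ≤ C ^ 2 * (4 * ((‖x‖ ^ 2) ^ (-(n : ℝ) / 2) * (2 * M + K) ^ 2) +
        (‖x‖ ^ 2) ^ (-(n : ℝ) / 2) * (2 * |β| * (2 * M + K))) := by gcongr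
    _ = _ := by ring

lemma cut_ev {n : ℕ} {i0 : Fin n} {x : Eu n} (hx : x ∈ hs i0) :
    ∀ᶠ k : ℕ in atTop, 2 < ((k + 1 : ℕ) : ℝ) * x i0 := by
  have hx1 : 0 < x i0 := hx
  obtain ⟨k0, hk0⟩ := exists_nat_gt (2 / x i0)
  filter_upwards [eventually_ge_atTop k0] with k hk
  have : (k0 : ℝ) ≤ k := by exact_mod_cast hk
  rw [div_lt_iff₀ hx1] at hk0
  push_cast
  nlinarith

lemma energy_N {n : ℕ} {i0 : Fin n} {α : ℝ} {z : Eu n → ℝ} (hz : Sol i0 α z) {C : ℝ}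
    (hC : ∀ x ∈ hs i0, |z x| ≤ C) {M : ℝ} (hM0 : 0 ≤ M)
    (hM : ∀ t, |deriv hcut t| ≤ M) {N : ℕ} (hN : 0 < N) :
    ∫⁻ x in hs i0, ENNReal.ofReal (wt i0 x * hcut (lg N x) ^ 2 * gE z x) ≤
    ∫⁻ x in hs i0, (ann n N).indicator (fun x => ENNReal.ofReal (wt i0 x * z x ^ 2 *
      (16 * M ^ 2 / N ^ 2 + 4 * |n - 2 * α| * M / N))) x := by
  obtain ⟨K, hK0, hK⟩ := dccut_bound
  obtain ⟨c, hc0, hc⟩ := ann_int i0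
  have hmem : ∀ᵐ x ∂(volume.restrict (hs i0)), x ∈ hs i0 :=
    ae_restrict_mem (isOpen_hs i0).measurableSet
  have hN' : (0 : ℝ) < N := by exact_mod_cast hN
  set F : ℕ → Eu n → ENNReal := fun k x => ENNReal.ofReal (wt i0 x * z x ^ 2 *
      (4 * gE (cut i0 N (k + 1)) x + 2 * |n - 2 * α| * |cut i0 N (k + 1) x *
        ∑ i, x i * pd (cut i0 N (k + 1)) i x|)) with hF
  set Fl : Eu n → ENNReal := fun x => ENNReal.ofReal (wt i0 x * z x ^ 2 *
      (4 * (4 * deriv hcut (lg N x) ^ 2 / N ^ 2) + 2 * |n - 2 * α| * |hcut (lg N x) *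
        (2 * deriv hcut (lg N x) / N)|)) with hFl
  set L : ℕ → Eu n → ENNReal := fun k x =>
    ENNReal.ofReal (wt i0 x * cut i0 N (k + 1) x ^ 2 * gE z x) with hL
  have hzc : ContinuousOn z (hs i0) := hz.smooth.continuousOn
  have hLm : ∀ k, AEMeasurable (L k) (volume.restrict (hs i0)) := fun k =>
    aem (((wt_cont i0).mul ((cut_smooth i0 hN k.succ_pos).continuous.continuousOn.pow 2)).mul
      hz.gE_cont)
  have hFm : ∀ k, AEMeasurable (F k) (volume.restrict (hs i0)) := fun k => by
    have hcs := cut_smooth i0 hN k.succ_pos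
    have h1 : Continuous (gE (cut i0 N (k + 1))) := by
      unfold gE
      refine Continuous.mul (by fun_prop) (continuous_finsetSum _ fun i _ => ?_)
      exact (pd_cont hcs i).pow 2
    have h2 : Continuous fun x : Eu n => ∑ i, x i * pd (cut i0 N (k + 1)) i x := by
      refine continuous_finsetSum _ fun i _ => ?_
      exact Continuous.mul (by fun_prop) (pd_cont hcs i)
    have h3 := hcs.continuous
    exact aem (((wt_cont i0).mul (hzc.pow 2)).mul
      (Continuous.continuousOn (by fun_prop)))
  have hlim : Tendsto (fun k => ∫⁻ x in hs i0, F k x) atTop (𝓝 (∫⁻ x in hs i0, Fl x)) := by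
    refine tendsto_lintegral_of_dominated_convergence' ((ann n N).indicator fun x =>
      ENNReal.ofReal ((‖x‖ ^ 2) ^ (-(n : ℝ) / 2)) * ENNReal.ofReal
      (C ^ 2 * (4 * (2 * M + K) ^ 2 + 2 * |n - 2 * α| * (2 * M + K)))) hFm ?_ ?_ ?_
    · intro k
      filter_upwards [hmem] with x hx
      by_cases ha : x ∈ ann n N
      · rw [indicator_of_mem ha, ← ENNReal.ofReal_mul (by positivity)]
        exact ENNReal.ofReal_le_ofReal (cut_bound hN hM0 hM hK0 hK (hC x hx) hx)
      · have hl := lg_off hN hx ha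
        obtain ⟨hg, hD⟩ := gE_cut (N := N) (k := k + 1) hx rfl rfl
        rw [indicator_of_notMem ha]
        simp only [hF]
        rw [hg, hD]
        simp [hcut_zero hl, dhcut_zero hl]
    · refine ne_top_of_le_ne_top ?_ (setLIntegral_le_lintegral _ _)
      rw [lintegral_indicator (ann_meas n N), lintegral_mul_const' _ _ ENNReal.ofReal_ne_top]
      exact ENNReal.mul_ne_top (ne_top_of_le_ne_top ENNReal.ofReal_ne_top (hc N))
        ENNReal.ofReal_ne_top
    · filter_upwards [hmem] with x hx
      refine tendsto_const_nhds.congr' ?_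
      filter_upwards [cut_ev hx] with k hk
      obtain ⟨hg, hD⟩ := gE_cut (N := N) (k := k + 1) hx rfl rfl
      simp only [hF, hFl]
      have hq := norm_sq_pos hx
      have hr : ‖x‖ ≠ 0 := fun h => by rw [h] at hq; norm_num at hq
      rw [hg, hD, cut, ccut_one hk.le, dccut_zero hk]
      congr 2
      have e : deriv hcut (lg N x) * 1 * (2 / (‖x‖ ^ 2 * N)) * ‖x‖ ^ 2 +
        hcut (lg N x) * 0 * ((k + 1 : ℕ) : ℝ) * x i0 = 2 * deriv hcut (lg N x) / N := by
        rw [mul_zero, zero_mul, zero_mul, add_zero, mul_one]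
        field_simp
      have e2 : ‖x‖ ^ 2 * ((deriv hcut (lg N x) * 1 * (2 / (‖x‖ ^ 2 * N))) ^ 2 * ‖x‖ ^ 2 +
          2 * (deriv hcut (lg N x) * 1 * (2 / (‖x‖ ^ 2 * N))) *
            (hcut (lg N x) * 0 * ((k + 1 : ℕ) : ℝ)) * x i0 +
          (hcut (lg N x) * 0 * ((k + 1 : ℕ) : ℝ)) ^ 2) = 4 * deriv hcut (lg N x) ^ 2 / N ^ 2 := by
        field_simp; ring
      rw [e, e2, mul_one (hcut _)]
  calc _ = ∫⁻ x in hs i0, liminf (fun k => L k x) atTop := by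
        refine lintegral_congr_ae ?_
        filter_upwards [hmem] with x hx
        symm
        refine Tendsto.liminf_eq (tendsto_const_nhds.congr' ?_)
        filter_upwards [cut_ev hx] with k hk
        simp only [hL]
        rw [cut, ccut_one hk.le, mul_one]
    _ ≤ liminf (fun k => ∫⁻ x in hs i0, L k x) atTop := lintegral_liminf_le' hLm
    _ ≤ liminf (fun k => ∫⁻ x in hs i0, F k x) atTop := by
        refine liminf_le_liminf (Eventually.of_forall fun k => ?_)
        exact cacc hz (cut_smooth i0 hN k.succ_pos) (cut_hcs i0 hN k.succ_pos)
          (cut_hs i0 hN k.succ_pos)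
    _ = ∫⁻ x in hs i0, Fl x := hlim.liminf_eq
    _ ≤ _ := by
        refine lintegral_mono_ae ?_
        filter_upwards [hmem] with x hx
        by_cases ha : x ∈ ann n N
        · rw [indicator_of_mem ha]
          refine ENNReal.ofReal_le_ofReal ?_
          refine mul_le_mul_of_nonneg_left ?_ (mul_nonneg (wt_nonneg _ _) (sq_nonneg _))
          have h1 := hM (lg N x)
          have h2 : deriv hcut (lg N x) ^ 2 ≤ M ^ 2 := sq_le_sq' (abs_le.1 h1).1 (abs_le.1 h1).2
          have h3 : |hcut (lg N x) * (2 * deriv hcut (lg N x) / N)| ≤ 2 * M / N := by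
            rw [abs_mul, abs_div, abs_mul, abs_of_nonneg (hcut_nonneg _), abs_of_pos hN', abs_two]
            calc hcut (lg N x) * (2 * |deriv hcut (lg N x)| / N)
                ≤ 1 * (2 * M / N) := by
                  gcongr
                  exact hcut_le _
              _ = _ := one_mul _
          calc _ ≤ 4 * (4 * M ^ 2 / N ^ 2) + 2 * |n - 2 * α| * (2 * M / N) := by gcongr
            _ = _ := by ring
        · have hl := lg_off hN hx ha
          rw [indicator_of_notMem ha]
          simp [hFl, hcut_zero hl, dhcut_zero hl]

lemma energy {n : ℕ} {i0 : Fin n} {α : ℝ} {z : Eu n → ℝ} (hz : Sol i0 α z) {C : ℝ}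
    (hC : ∀ x ∈ hs i0, |z x| ≤ C) {M : ℝ} (hM0 : 0 ≤ M)
    (hM : ∀ t, |deriv hcut t| ≤ M) :
    ∫⁻ x in hs i0, ENNReal.ofReal (wt i0 x * gE z x) ≤
    liminf (fun N : ℕ => ∫⁻ x in hs i0, (ann n (N + 1)).indicator (fun x =>
      ENNReal.ofReal (wt i0 x * z x ^ 2 *
      (16 * M ^ 2 / ((N + 1 : ℕ) : ℝ) ^ 2 + 4 * |n - 2 * α| * M / ((N + 1 : ℕ) : ℝ)))) x) atTop := by
  have hmem : ∀ᵐ x ∂(volume.restrict (hs i0)), x ∈ hs i0 :=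
    ae_restrict_mem (isOpen_hs i0).measurableSet
  calc _ = ∫⁻ x in hs i0, liminf (fun N : ℕ =>
        ENNReal.ofReal (wt i0 x * hcut (lg (N + 1) x) ^ 2 * gE z x)) atTop := by
        refine lintegral_congr_ae ?_
        filter_upwards [hmem] with x hx
        symm
        refine Tendsto.liminf_eq (tendsto_const_nhds.congr' ?_)
        obtain ⟨k0, hk0⟩ := exists_nat_gt |Real.log (‖x‖ ^ 2)|
        filter_upwards [eventually_ge_atTop k0] with k hk
        rw [hcut_one, one_pow, mul_one]
        have : (k0 : ℝ) ≤ k := by exact_mod_cast hk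
        have hp : (0 : ℝ) < ((k + 1 : ℕ) : ℝ) := by positivity
        rw [lg, abs_div, abs_of_pos hp, div_le_one hp]
        push_cast
        linarith
    _ ≤ liminf (fun N : ℕ => ∫⁻ x in hs i0,
        ENNReal.ofReal (wt i0 x * hcut (lg (N + 1) x) ^ 2 * gE z x)) atTop := by
        refine lintegral_liminf_le' fun N => aem (((wt_cont i0).mul (ContinuousOn.pow ?_ 2)).mul
          hz.gE_cont)
        exact fun x hx => (hcut_smooth.continuous.continuousAt.comp
          (lg_cda hx).continuousAt).continuousWithinAt
    _ ≤ _ := liminf_le_liminf (Eventually.of_forall fun N => energy_N hz hC hM0 hM N.succ_pos)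

lemma smul_hs {n : ℕ} {i0 : Fin n} {x : Eu n} (hx : x ∈ hs i0) {r : ℝ} (hr : 0 < r) :
    r • x ∈ hs i0 := by
  have hx1 : 0 < x i0 := hx
  change 0 < (r • x) i0
  simpa using mul_pos hr hx1

lemma convex_hs {n : ℕ} (i0 : Fin n) : Convex ℝ (hs i0) := by
  intro x hx y hy a b ha hb hab
  have hx1 : 0 < x i0 := hx
  have hy1 : 0 < y i0 := hy
  change 0 < (a • x + b • y) i0
  simp only [PiLp.add_apply, PiLp.smul_apply, smul_eq_mul]
  rcases ha.eq_or_lt with h | h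
  · subst h
    have : b = 1 := by linarith
    subst this
    linarith
  · have := mul_pos h hx1
    have := mul_nonneg hb hy1.le
    linarith

/-- zero energy implies constant -/
lemma Sol.const_of_zero {n : ℕ} {i0 : Fin n} {α : ℝ} {z : Eu n → ℝ} (hz : Sol i0 α z)
    (h0 : ∫⁻ x in hs i0, ENNReal.ofReal (wt i0 x * gE z x) = 0) :
    ∃ c, ∀ x ∈ hs i0, z x = c := by
  have hc : ContinuousOn (fun x => wt i0 x * gE z x) (hs i0) := (wt_cont i0).mul hz.gE_cont
  rw [lintegral_eq_zero_iff' (aem hc)] at h0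
  have h1 : (fun x => wt i0 x * gE z x) =ᵐ[volume.restrict (hs i0)] fun _ => 0 := by
    filter_upwards [h0] with x hx
    have : wt i0 x * gE z x ≤ 0 := by simpa using hx
    exact le_antisymm this (mul_nonneg (wt_nonneg _ _) (gE_nonneg _ _))
  have h2 := Measure.eqOn_open_of_ae_eq h1 (isOpen_hs i0) hc continuousOn_const
  refine (isOpen_hs i0).exists_is_const_of_fderiv_eq_zero (𝕜 := ℝ) (convex_hs i0).isPreconnected
    (hz.smooth.differentiableOn (by norm_num)) ?_
  intro x hx
  have h3 : wt i0 x * gE z x = 0 := h2 hx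
  have hq := norm_sq_pos hx
  have hx1 : 0 < x i0 := hx
  have hw : 0 < wt i0 x := by unfold wt; positivity
  have h4 : ∑ i, pd z i x ^ 2 = 0 := by
    rcases mul_eq_zero.1 h3 with h | h
    · exact absurd h hw.ne'
    · unfold gE at h
      rcases mul_eq_zero.1 h with h | h
      · exact absurd h hq.ne'
      · exact h
  rw [Finset.sum_eq_zero_iff_of_nonneg fun i _ => sq_nonneg _] at h4
  ext v
  rw [fderiv_eq_sum]
  simp only [Pi.zero_apply, zero_apply]
  refine Finset.sum_eq_zero fun i hi => ?_
  rw [pow_eq_zero_iff (by norm_num) |>.1 (h4 i hi), mul_zero]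

/-- bound on the cutoff terms for bounded solutions -/
lemma rhs_bd {n : ℕ} (i0 : Fin n) : ∃ c : ℝ, 0 ≤ c ∧ ∀ (z : Eu n → ℝ) (C A : ℝ) (N : ℕ),
    (∀ x ∈ hs i0, |z x| ≤ C) → 0 ≤ A →
    ∫⁻ x in hs i0, (ann n N).indicator (fun x => ENNReal.ofReal (wt i0 x * z x ^ 2 * A)) x ≤
      ENNReal.ofReal (c * N * (C ^ 2 * A)) := by
  obtain ⟨c, hc0, hc⟩ := ann_int i0
  refine ⟨c, hc0, fun z C A N hC hA => ?_⟩
  have hmem : ∀ᵐ x ∂(volume.restrict (hs i0)), x ∈ hs i0 :=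
    ae_restrict_mem (isOpen_hs i0).measurableSet
  calc _ ≤ ∫⁻ x in hs i0, (ann n N).indicator (fun x =>
        ENNReal.ofReal ((‖x‖ ^ 2) ^ (-(n : ℝ) / 2)) * ENNReal.ofReal (C ^ 2 * A)) x := by
        refine lintegral_mono_ae ?_
        filter_upwards [hmem] with x hx
        refine indicator_le_indicator ?_
        rw [← ENNReal.ofReal_mul (by positivity)]
        refine ENNReal.ofReal_le_ofReal ?_
        have h1 := wt_le hx
        have h2 : z x ^ 2 ≤ C ^ 2 := sq_le_sq' (abs_le.1 (hC x hx)).1 (abs_le.1 (hC x hx)).2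
        have h3 := wt_nonneg i0 x
        rw [mul_assoc]
        gcongr
    _ ≤ ∫⁻ x, (ann n N).indicator (fun x =>
        ENNReal.ofReal ((‖x‖ ^ 2) ^ (-(n : ℝ) / 2)) * ENNReal.ofReal (C ^ 2 * A)) x :=
        setLIntegral_le_lintegral _ _
    _ = (∫⁻ x in ann n N, ENNReal.ofReal ((‖x‖ ^ 2) ^ (-(n : ℝ) / 2))) *
        ENNReal.ofReal (C ^ 2 * A) := by
        rw [lintegral_indicator (ann_meas n N), lintegral_mul_const' _ _ ENNReal.ofReal_ne_top]
    _ ≤ ENNReal.ofReal (c * N) * ENNReal.ofReal (C ^ 2 * A) := by gcongr; exact hc N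
    _ = _ := by rw [← ENNReal.ofReal_mul (by positivity)]

lemma Sol.energy_fin {n : ℕ} {i0 : Fin n} {α : ℝ} {z : Eu n → ℝ} (hz : Sol i0 α z) {C : ℝ}
    (hC : ∀ x ∈ hs i0, |z x| ≤ C) :
    ∫⁻ x in hs i0, ENNReal.ofReal (wt i0 x * gE z x) ≠ ⊤ := by
  obtain ⟨M, hM0, hM⟩ := dhcut_bound
  obtain ⟨c, hc0, hc⟩ := rhs_bd i0
  refine ne_top_of_le_ne_top (b := ENNReal.ofReal (c * C ^ 2 * (16 * M ^ 2 + 4 * |n - 2 * α| * M)))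
    ENNReal.ofReal_ne_top ((energy hz hC hM0 hM).trans ?_)
  refine liminf_le_of_le (by isBoundedDefault) fun b hb => ?_
  obtain ⟨N, hN⟩ := hb.exists
  refine hN.trans ((hc z C _ (N + 1) hC (by positivity)).trans (ENNReal.ofReal_le_ofReal ?_))
  have hp : (1 : ℝ) ≤ ((N + 1 : ℕ) : ℝ) := by exact_mod_cast N.succ_pos
  set R : ℝ := ((N + 1 : ℕ) : ℝ)
  have e : c * R * (C ^ 2 * (16 * M ^ 2 / R ^ 2 + 4 * |n - 2 * α| * M / R)) =
      c * C ^ 2 * (16 * M ^ 2 / R + 4 * |n - 2 * α| * M) := by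
    field_simp
  rw [e]
  gcongr
  exact div_le_self (by positivity) hp

lemma Sol.energy_zero {n : ℕ} {i0 : Fin n} {α : ℝ} {z : Eu n → ℝ} (hz : Sol i0 α z) {C : ℝ}
    (hC : ∀ x ∈ hs i0, |z x| ≤ C) (hn : (n : ℝ) - 2 * α = 0) :
    ∫⁻ x in hs i0, ENNReal.ofReal (wt i0 x * gE z x) = 0 := by
  obtain ⟨M, hM0, hM⟩ := dhcut_bound
  obtain ⟨c, hc0, hc⟩ := rhs_bd i0
  refine le_antisymm ((energy hz hC hM0 hM).trans ?_) zero_le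
  have hlim : Tendsto (fun N : ℕ => ENNReal.ofReal (c * C ^ 2 * 16 * M ^ 2 * (1 / ((N : ℝ) + 1))))
      atTop (𝓝 0) := by
    have := ENNReal.tendsto_ofReal
      ((tendsto_one_div_add_atTop_nhds_zero_nat (𝕜 := ℝ)).const_mul (c * C ^ 2 * 16 * M ^ 2))
    simpa using this
  rw [← hlim.liminf_eq]
  refine liminf_le_liminf (Eventually.of_forall fun N => ?_)
  refine (hc z C _ (N + 1) hC (by positivity)).trans (ENNReal.ofReal_le_ofReal (le_of_eq ?_))
  have hp : (0 : ℝ) < (N : ℝ) + 1 := by positivity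
  rw [hn, abs_zero]
  push_cast
  field_simp
  ring

lemma Sol.energy_zero_of_l2 {n : ℕ} {i0 : Fin n} {α : ℝ} {z : Eu n → ℝ} (hz : Sol i0 α z) {C : ℝ}
    (hC : ∀ x ∈ hs i0, |z x| ≤ C)
    (h2 : ∫⁻ x in hs i0, ENNReal.ofReal (wt i0 x * z x ^ 2) ≠ ⊤) :
    ∫⁻ x in hs i0, ENNReal.ofReal (wt i0 x * gE z x) = 0 := by
  obtain ⟨M, hM0, hM⟩ := dhcut_bound
  refine le_antisymm ((energy hz hC hM0 hM).trans ?_) zero_le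
  have hlim : Tendsto (fun N : ℕ => (∫⁻ x in hs i0, ENNReal.ofReal (wt i0 x * z x ^ 2)) *
      ENNReal.ofReal (16 * M ^ 2 / ((N + 1 : ℕ) : ℝ) ^ 2 + 4 * |n - 2 * α| * M / ((N + 1 : ℕ) : ℝ)))
      atTop (𝓝 0) := by
    have h0 := tendsto_one_div_add_atTop_nhds_zero_nat (𝕜 := ℝ)
    have h1 : Tendsto (fun N : ℕ => 16 * M ^ 2 / ((N + 1 : ℕ) : ℝ) ^ 2 +
        4 * |n - 2 * α| * M / ((N + 1 : ℕ) : ℝ)) atTop (𝓝 0) := by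
      have := ((h0.pow 2).const_mul (16 * M ^ 2)).add (h0.const_mul (4 * |n - 2 * α| * M))
      simp only [ne_eq, OfNat.ofNat_ne_zero, not_false_eq_true, zero_pow, mul_zero, add_zero] at this
      refine this.congr fun N => ?_
      push_cast
      field_simp
    have := ENNReal.Tendsto.const_mul (ENNReal.tendsto_ofReal h1) (Or.inr h2)
    simpa using this
  rw [← hlim.liminf_eq]
  refine liminf_le_liminf (Eventually.of_forall fun N => ?_)
  rw [← lintegral_mul_const' _ _ ENNReal.ofReal_ne_top]
  refine lintegral_mono fun x => (indicator_le_self _ _ _).trans ?_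
  rw [ENNReal.ofReal_mul (mul_nonneg (wt_nonneg _ _) (sq_nonneg _))]

lemma pd_comp_smul {n : ℕ} (f : Eu n → ℝ) (r : ℝ) (i : Fin n) (x : Eu n) :
    pd (fun y => f (r • y)) i x = r * pd f i (r • x) := by
  unfold pd
  rw [fderiv_comp_smul]
  rfl

lemma pd_const_mul {n : ℕ} (f : Eu n → ℝ) (r : ℝ) (i : Fin n) (x : Eu n) :
    pd (fun y => r * f y) i x = r * pd f i x := by
  unfold pd
  have := congrFun (fderiv_const_smul_field (𝕜 := ℝ) (f := f) r) x
  have h2 : (fun y => r * f y) = r • f := rfl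
  rw [h2, this]
  rfl

lemma lap_comp_smul {n : ℕ} (f : Eu n → ℝ) (r : ℝ) (x : Eu n) :
    lap (fun y => f (r • y)) x = r ^ 2 * lap f (r • x) := by
  rw [lap_eq, lap_eq, Finset.mul_sum]
  refine Finset.sum_congr rfl fun i _ => ?_
  have : pd (fun y => f (r • y)) i = fun x => r * pd f i (r • x) :=
    funext fun x => pd_comp_smul f r i x
  rw [this, pd_const_mul (fun x => pd f i (r • x)), pd_comp_smul]
  ring

lemma pd_sub {n : ℕ} {f g : Eu n → ℝ} {x : Eu n} (hf : DifferentiableAt ℝ f x)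
    (hg : DifferentiableAt ℝ g x) (i : Fin n) :
    pd (fun y => f y - g y) i x = pd f i x - pd g i x := by
  unfold pd
  rw [fderiv_fun_sub hf hg]
  rfl

lemma pd_congr {n : ℕ} {f g : Eu n → ℝ} {x : Eu n} (h : f =ᶠ[𝓝 x] g) (i : Fin n) :
    pd f i x = pd g i x := by
  unfold pd
  rw [h.fderiv_eq]

lemma Sol.scale {n : ℕ} {i0 : Fin n} {α : ℝ} {z : Eu n → ℝ} (hz : Sol i0 α z) {r : ℝ}
    (hr : 0 < r) : Sol i0 α (fun x => z (r • x)) := by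
  refine ⟨hz.smooth.comp (by fun_prop) fun x hx => smul_hs hx hr, fun x hx => ?_⟩
  have h := hz.eqn _ (smul_hs hx hr)
  rw [lap_comp_smul, pd_comp_smul]
  simp only [pd_comp_smul]
  rw [norm_smul, Real.norm_of_nonneg hr.le] at h
  simp only [PiLp.smul_apply, smul_eq_mul] at h
  have e : ∑ i, r * x i * pd z i (r • x) = ∑ i, x i * (r * pd z i (r • x)) :=
    Finset.sum_congr rfl fun i _ => by ring
  rw [e] at h
  have : r * (x i0 * ‖x‖ ^ 2 * (r ^ 2 * lap z (r • x)) + 2 * ‖x‖ ^ 2 * (r * pd z i0 (r • x)) -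
    2 * α * x i0 * ∑ i, x i * (r * pd z i (r • x))) = 0 := by rw [← h]; ring
  exact (mul_eq_zero.1 this).resolve_left hr.ne'

lemma Sol.sub {n : ℕ} {i0 : Fin n} {α : ℝ} {z w : Eu n → ℝ} (hz : Sol i0 α z) (hw : Sol i0 α w) :
    Sol i0 α (fun x => z x - w x) := by
  have hd : ∀ {f : Eu n → ℝ}, Sol i0 α f → ∀ y ∈ hs i0, DifferentiableAt ℝ f y := fun hf y hy =>
    (hf.cda hy).differentiableAt (by norm_num)
  have hp : ∀ i, ∀ y ∈ hs i0, pd (fun x => z x - w x) i y = pd z i y - pd w i y := fun i y hy =>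
    pd_sub (hd hz y hy) (hd hw y hy) i
  refine ⟨hz.smooth.sub hw.smooth, fun x hx => ?_⟩
  have hl : lap (fun x => z x - w x) x = lap z x - lap w x := by
    rw [lap_eq, lap_eq, lap_eq, ← Finset.sum_sub_distrib]
    refine Finset.sum_congr rfl fun i _ => ?_
    have : pd (fun x => z x - w x) i =ᶠ[𝓝 x] fun y => pd z i y - pd w i y := by
      filter_upwards [(isOpen_hs i0).mem_nhds hx] with y hy using hp i y hy
    rw [pd_congr this, pd_sub ((cda_pd (hz.cda hx) i).differentiableAt (by norm_num))
      ((cda_pd (hw.cda hx) i).differentiableAt (by norm_num))]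
  rw [hl, hp i0 x hx]
  have e : ∑ i, x i * pd (fun x => z x - w x) i x = ∑ i, x i * pd z i x - ∑ i, x i * pd w i x := by
    rw [← Finset.sum_sub_distrib]
    exact Finset.sum_congr rfl fun i _ => by rw [hp i x hx]; ring
  rw [e]
  linear_combination hz.eqn x hx - hw.eqn x hx

lemma hasDeriv_ray {n : ℕ} {i0 : Fin n} {α : ℝ} {z : Eu n → ℝ} (hz : Sol i0 α z) {x : Eu n}
    (hx : x ∈ hs i0) {t : ℝ} (ht : 0 < t) :
    HasDerivAt (fun s : ℝ => z (s • x)) (∑ i, x i * pd z i (t • x)) t := by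
  have h1 : HasFDerivAt z (fderiv ℝ z (t • x)) (t • x) :=
    ((hz.cda (smul_hs hx ht)).differentiableAt (by norm_num)).hasFDerivAt
  have h2 : HasDerivAt (fun s : ℝ => s • x) x t := by
    simpa using (hasDerivAt_id t).smul_const x
  have := h1.comp_hasDerivAt t h2
  rw [fderiv_eq_sum] at this
  exact this

/-- Cauchy-Schwarz on an interval -/
lemma cs_int {f : ℝ → ℝ} {r : ℝ} (hr : 1 < r) (hf : ContinuousOn f (Icc 1 r)) :
    (∫ s in (1 : ℝ)..r, f s) ^ 2 ≤ (r - 1) * ∫ s in (1 : ℝ)..r, f s ^ 2 := by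
  have hr' : 0 < r - 1 := by linarith
  rw [← uIcc_of_le hr.le] at hf
  set I := ∫ s in (1 : ℝ)..r, f s
  set m := I / (r - 1) with hm
  have h0 : 0 ≤ ∫ s in (1 : ℝ)..r, (f s - m) ^ 2 :=
    intervalIntegral.integral_nonneg hr.le fun s _ => sq_nonneg _
  have i1 : IntervalIntegrable (fun s => f s ^ 2) volume 1 r := (hf.pow 2).intervalIntegrable
  have i2 : IntervalIntegrable (fun s => 2 * m * f s) volume 1 r :=
    (continuousOn_const.mul hf).intervalIntegrable
  have e : ∫ s in (1 : ℝ)..r, (f s - m) ^ 2 = (∫ s in (1 : ℝ)..r, f s ^ 2) - 2 * m * I +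
      m ^ 2 * (r - 1) := by
    have : ∀ s, (f s - m) ^ 2 = f s ^ 2 - 2 * m * f s + m ^ 2 := fun s => by ring
    simp only [this]
    rw [intervalIntegral.integral_add (i1.sub i2) (by simp), intervalIntegral.integral_sub i1 i2,
      intervalIntegral.integral_const_mul]
    simp only [intervalIntegral.integral_const, smul_eq_mul]
    rw [mul_comm (m ^ 2)]
  rw [e] at h0
  have hI : I = m * (r - 1) := by rw [hm]; field_simp
  rw [hI] at h0 ⊢
  nlinarith

lemma diff_sq_le {n : ℕ} {i0 : Fin n} {α : ℝ} {z : Eu n → ℝ} (hz : Sol i0 α z) {x : Eu n}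
    (hx : x ∈ hs i0) {r : ℝ} (hr : 1 < r) :
    ENNReal.ofReal ((z (r • x) - z x) ^ 2) ≤
      ENNReal.ofReal (r - 1) * ∫⁻ s in Icc 1 r, ENNReal.ofReal (gE z (s • x)) := by
  have hc : ContinuousOn (fun s : ℝ => ∑ i, x i * pd z i (s • x)) (Icc 1 r) := by
    refine continuousOn_finsetSum _ fun i _ => continuousOn_const.mul fun s hs => ?_
    have h1 := (cda_pd (hz.cda (smul_hs hx (lt_of_lt_of_le one_pos hs.1))) i).continuousAt
    exact (ContinuousAt.comp (f := fun s : ℝ => s • x) h1 (by fun_prop)).continuousWithinAt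
  have hg : ContinuousOn (fun s : ℝ => gE z (s • x)) (Icc 1 r) :=
    hz.gE_cont.comp (by fun_prop) fun s hs => smul_hs hx (lt_of_lt_of_le one_pos hs.1)
  have hft : ∫ s in (1 : ℝ)..r, ∑ i, x i * pd z i (s • x) = z (r • x) - z x := by
    rw [intervalIntegral.integral_eq_sub_of_hasDerivAt (f := fun s => z (s • x)), one_smul]
    · intro s hs
      rw [uIcc_of_le hr.le] at hs
      exact hasDeriv_ray hz hx (lt_of_lt_of_le one_pos hs.1)
    · rw [← uIcc_of_le hr.le] at hc
      exact hc.intervalIntegrable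
  have h1 := cs_int hr hc
  rw [hft] at h1
  have h2 : ∫ s in (1 : ℝ)..r, (∑ i, x i * pd z i (s • x)) ^ 2 ≤
      ∫ s in (1 : ℝ)..r, gE z (s • x) := by
    refine intervalIntegral.integral_mono_on hr.le ?_ ?_ fun s hs => ?_
    · have := hc.pow 2
      rw [← uIcc_of_le hr.le] at this
      exact this.intervalIntegrable
    · rw [← uIcc_of_le hr.le] at hg
      exact hg.intervalIntegrable
    · refine (Finset.sum_mul_sq_le_sq_mul_sq _ _ _).trans ?_
      rw [sum_sq, gE, norm_smul, mul_pow]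
      have hs1 : (1 : ℝ) ≤ ‖s‖ ^ 2 := by
        rw [Real.norm_eq_abs, sq_abs]
        nlinarith [hs.1]
      have := Finset.sum_nonneg (s := Finset.univ) fun i _ => sq_nonneg (pd z i (s • x))
      refine mul_le_mul_of_nonneg_right ?_ this
      nlinarith [sq_nonneg ‖x‖]
  have hr' : 0 ≤ r - 1 := by linarith
  have h3 := h1.trans (mul_le_mul_of_nonneg_left h2 hr')
  refine (ENNReal.ofReal_le_ofReal h3).trans ?_
  rw [ENNReal.ofReal_mul hr', intervalIntegral.integral_of_le hr.le,
    ofReal_integral_eq_lintegral_ofReal ((hg.integrableOn_Icc).mono_set Ioc_subset_Icc_self)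
      (Eventually.of_forall fun s => gE_nonneg _ _)]
  gcongr
  exact Ioc_subset_Icc_self

lemma wt_smul {n : ℕ} {i0 : Fin n} {x : Eu n} {r : ℝ} (hr : 0 < r) :
    r ^ n * wt i0 (r • x) = wt i0 x := by
  unfold wt
  rw [norm_smul, Real.norm_of_nonneg hr.le, mul_pow, Real.mul_rpow (by positivity) (by positivity)]
  simp only [PiLp.smul_apply, smul_eq_mul]
  have : r ^ n * (r ^ 2 * (r ^ 2) ^ (-(n : ℝ) / 2 - 1)) = 1 := by
    rw [← Real.rpow_natCast r n, ← Real.rpow_natCast r 2, ← Real.rpow_mul hr.le,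
      ← Real.rpow_add hr, ← Real.rpow_add hr]
    have h0 : (n : ℝ) + (((2 : ℕ) : ℝ) + ((2 : ℕ) : ℝ) * (-(n : ℝ) / 2 - 1)) = 0 := by
      push_cast
      ring
    rw [h0, Real.rpow_zero]
  linear_combination (x i0 ^ 2 * (‖x‖ ^ 2) ^ (-(n : ℝ) / 2 - 1)) * this

lemma dil_inv {n : ℕ} {i0 : Fin n} (f : Eu n → ℝ) {r : ℝ} (hr : 0 < r) :
    ∫⁻ x in hs i0, ENNReal.ofReal (wt i0 x * f (r • x)) =
      ∫⁻ x in hs i0, ENNReal.ofReal (wt i0 x * f x) := by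
  have hm := (isOpen_hs i0).measurableSet
  set G : Eu n → ENNReal := (hs i0).indicator fun x => ENNReal.ofReal (wt i0 x * f x) with hG
  have e1 : ∀ x, (hs i0).indicator (fun x => ENNReal.ofReal (wt i0 x * f (r • x))) x =
      ENNReal.ofReal (r ^ n) * G (r • x) := by
    intro x
    by_cases hx : x ∈ hs i0
    · rw [hG, indicator_of_mem hx, indicator_of_mem (smul_hs hx hr),
        ← ENNReal.ofReal_mul (by positivity), ← mul_assoc, wt_smul hr]
    · rw [hG, indicator_of_notMem hx, indicator_of_notMem, mul_zero]
      intro h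
      have := smul_hs h (inv_pos.2 hr)
      rw [smul_smul, inv_mul_cancel₀ hr.ne', one_smul] at this
      exact hx this
  rw [← lintegral_indicator hm, ← lintegral_indicator hm]
  simp only [e1]
  rw [lintegral_const_mul' _ _ ENNReal.ofReal_ne_top]
  have e2 : ∫⁻ x, G (r • x) = ∫⁻ x, G x ∂(Measure.map (r • ·) (volume : Measure (Eu n))) :=
    (lintegral_map_equiv G
      (Homeomorph.smul (isUnit_iff_ne_zero.2 hr.ne').unit).toMeasurableEquiv).symm
  rw [e2, Measure.map_addHaar_smul _ hr.ne', lintegral_smul_measure, smul_eq_mul, ← mul_assoc,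
    ← ENNReal.ofReal_mul (by positivity), finrank_euclideanSpace_fin,
    abs_of_pos (by positivity), mul_inv_cancel₀ (by positivity), ENNReal.ofReal_one, one_mul]

lemma diff_l2 {n : ℕ} {i0 : Fin n} {α : ℝ} {z : Eu n → ℝ} (hz : Sol i0 α z)
    (hE : ∫⁻ x in hs i0, ENNReal.ofReal (wt i0 x * gE z x) ≠ ⊤) {r : ℝ} (hr : 1 < r) :
    ∫⁻ x in hs i0, ENNReal.ofReal (wt i0 x * (z (r • x) - z x) ^ 2) ≠ ⊤ := by
  have hmem : ∀ᵐ x ∂(volume.restrict (hs i0)), x ∈ hs i0 :=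
    ae_restrict_mem (isOpen_hs i0).measurableSet
  have hb : ∫⁻ x in hs i0, ENNReal.ofReal (wt i0 x * (z (r • x) - z x) ^ 2) ≤
      ENNReal.ofReal (r - 1) * ∫⁻ x in hs i0, ∫⁻ s in Icc 1 r,
        ENNReal.ofReal (wt i0 x * gE z (s • x)) := by
    rw [← lintegral_const_mul' _ _ ENNReal.ofReal_ne_top]
    refine lintegral_mono_ae ?_
    filter_upwards [hmem] with x hx
    rw [ENNReal.ofReal_mul (wt_nonneg _ _)]
    simp only [ENNReal.ofReal_mul (wt_nonneg _ _)]
    rw [lintegral_const_mul' _ _ ENNReal.ofReal_ne_top, mul_left_comm]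
    gcongr
    exact diff_sq_le hz hx hr
  refine ne_top_of_le_ne_top ?_ hb
  refine ENNReal.mul_ne_top ENNReal.ofReal_ne_top ?_
  rw [lintegral_lintegral_swap]
  · have : ∫⁻ s in Icc 1 r, ∫⁻ x in hs i0, ENNReal.ofReal (wt i0 x * gE z (s • x)) =
        ∫⁻ s in Icc 1 r, ∫⁻ x in hs i0, ENNReal.ofReal (wt i0 x * gE z x) := by
      refine setLIntegral_congr_fun measurableSet_Icc fun s hs => ?_
      exact dil_inv (gE z) (lt_of_lt_of_le one_pos hs.1)
    rw [this, lintegral_const]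
    refine ENNReal.mul_ne_top hE ?_
    simp
  · rw [Measure.prod_restrict]
    refine (ContinuousOn.aemeasurable ?_
      ((isOpen_hs i0).measurableSet.prod measurableSet_Icc)).ennreal_ofReal
    refine ContinuousOn.mul ?_ ?_
    · exact (wt_cont i0).comp continuousOn_fst fun p hp => hp.1
    · refine hz.gE_cont.comp (f := fun p : Eu n × ℝ => p.2 • p.1) (by fun_prop) fun p hp => ?_
      exact smul_hs hp.1 (lt_of_lt_of_le one_pos hp.2.1)

/-- Liouville: bounded solutions are constant -/
lemma liouville {n : ℕ} {i0 : Fin n} {α : ℝ} {z : Eu n → ℝ} (hz : Sol i0 α z) {C : ℝ}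
    (hC : ∀ x ∈ hs i0, |z x| ≤ C) : ∃ c, ∀ x ∈ hs i0, z x = c := by
  have hE := hz.energy_fin hC
  have hinv : ∀ r : ℝ, 1 < r → ∀ x ∈ hs i0, z (r • x) = z x := by
    intro r hr
    have hr0 : 0 < r := by linarith
    have hs : Sol i0 α (fun x => z (r • x) - z x) := (hz.scale hr0).sub hz
    have hb : ∀ x ∈ Rigid.hs i0, |z (r • x) - z x| ≤ C + C := fun x hx =>
      (abs_sub _ _).trans (add_le_add (hC _ (smul_hs hx hr0)) (hC x hx))
    obtain ⟨c, hc⟩ := hs.const_of_zero (hs.energy_zero_of_l2 hb (diff_l2 hz hE hr))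
    intro x hx
    have hk : ∀ k : ℕ, z (r ^ k • x) = z x + k * c := by
      intro k
      induction k with
      | zero => simp
      | succ k ih =>
        have := hc _ (smul_hs hx (pow_pos hr0 k))
        rw [smul_smul, ← pow_succ'] at this
        push_cast
        linarith
    have h0 : c = 0 := by
      by_contra hne
      have hp : 0 < |c| := abs_pos.2 hne
      obtain ⟨k, hk2⟩ := exists_nat_gt ((C + C) / |c|)
      rw [div_lt_iff₀ hp] at hk2
      have h1 : (k : ℝ) * c = z (r ^ k • x) - z x := by rw [hk]; ring
      have h2 : |(k : ℝ) * c| ≤ C + C := by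
        rw [h1]
        exact (abs_sub _ _).trans (add_le_add (hC _ (smul_hs hx (pow_pos hr0 k))) (hC x hx))
      rw [abs_mul, Nat.abs_cast] at h2
      linarith
    have := hc x hx
    rw [h0] at this
    linarith
  have hD : ∀ x ∈ hs i0, ∑ i, x i * pd z i x = 0 := by
    intro x hx
    have h1 := hasDeriv_ray hz hx one_pos
    rw [one_smul] at h1
    have h2 : (fun s : ℝ => z (s • x)) =ᶠ[𝓝 1] fun _ => z x := by
      filter_upwards [lt_mem_nhds one_pos] with s hs
      rcases lt_trichotomy s 1 with h | h | h
      · have := hinv s⁻¹ ((one_lt_inv₀ hs).2 h) _ (smul_hs hx hs)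
        rw [smul_smul, inv_mul_cancel₀ hs.ne', one_smul] at this
        exact this.symm
      · rw [h, one_smul]
      · exact hinv s h x hx
    exact h1.unique ((hasDerivAt_const (1 : ℝ) (z x)).congr_of_eventuallyEq h2)
  have hz2 : Sol i0 ((n : ℝ) / 2) z := by
    refine ⟨hz.smooth, fun x hx => ?_⟩
    have := hz.eqn x hx
    rw [hD x hx] at this ⊢
    linarith
  exact hz2.const_of_zero (hz2.energy_zero hC (by ring))

lemma pd_mul {n : ℕ} {f g : Eu n → ℝ} {x : Eu n} (hf : DifferentiableAt ℝ f x)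
    (hg : DifferentiableAt ℝ g x) (i : Fin n) :
    pd (fun y => f y * g y) i x = pd f i x * g x + f x * pd g i x := by
  unfold pd
  rw [fderiv_fun_mul hf hg]
  simp only [add_apply, smul_apply, smul_eq_mul]
  ring

lemma pd_add {n : ℕ} {f g : Eu n → ℝ} {x : Eu n} (hf : DifferentiableAt ℝ f x)
    (hg : DifferentiableAt ℝ g x) (i : Fin n) :
    pd (fun y => f y + g y) i x = pd f i x + pd g i x := by
  unfold pd
  rw [fderiv_fun_add hf hg]
  rfl

lemma pd_coord {n : ℕ} (i j : Fin n) (x : Eu n) :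
    pd (fun y : Eu n => y j) i x = if i = j then 1 else 0 := by
  unfold pd
  rw [(hasF_coord j x).fderiv]
  exact proj_single i j

lemma pd_q {n : ℕ} {i0 : Fin n} {x : Eu n} (hx : x ∈ hs i0) (p : ℝ) (i : Fin n) :
    pd (fun y : Eu n => (‖y‖ ^ 2) ^ p) i x = 2 * p * (x i * (‖x‖ ^ 2) ^ (p - 1)) := by
  have h := (hasF_q x).rpow_const (p := p) (Or.inl (norm_sq_pos hx).ne')
  unfold pd
  rw [h.fderiv]
  simp only [smul_apply, smul_eq_mul, innerSL_apply_apply, inner_single]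
  ring

lemma da_q {n : ℕ} {i0 : Fin n} {x : Eu n} (hx : x ∈ hs i0) (p : ℝ) :
    DifferentiableAt ℝ (fun y : Eu n => (‖y‖ ^ 2) ^ p) x :=
  (cda_q hx p (k := 1)).differentiableAt (by norm_num)

lemma da_coord {n : ℕ} (i : Fin n) (x : Eu n) :
    DifferentiableAt ℝ (fun y : Eu n => y i) x :=
  (cda_coord i x (k := 1)).differentiableAt (by norm_num)

/-- the model solution -/
def mod {n : ℕ} (i0 : Fin n) (α : ℝ) (x : Eu n) : ℝ := x i0 * (‖x‖ ^ 2) ^ (-α / 2)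

lemma mod_cda {n : ℕ} {i0 : Fin n} {x : Eu n} (hx : x ∈ hs i0) (α : ℝ) {k : WithTop ℕ∞} :
    ContDiffAt ℝ k (mod i0 α) x := (cda_coord i0 x).mul (cda_q hx _)

lemma pd_mod {n : ℕ} {i0 : Fin n} {x : Eu n} (hx : x ∈ hs i0) (α : ℝ) (i : Fin n) :
    pd (mod i0 α) i x = (if i = i0 then 1 else 0) * (‖x‖ ^ 2) ^ (-α / 2) +
      x i0 * (-α * (x i * (‖x‖ ^ 2) ^ (-α / 2 - 1))) := by
  have h := pd_mul (da_coord i0 x) (da_q hx (-α / 2)) i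
  rw [pd_coord, pd_q hx] at h
  unfold mod
  rw [h]
  ring

lemma pd_pd_mod {n : ℕ} {i0 : Fin n} {x : Eu n} (hx : x ∈ hs i0) (α : ℝ) (i : Fin n) :
    pd (pd (mod i0 α) i) i x = (if i = i0 then 1 else 0) * (-2 * α * (x i * (‖x‖ ^ 2) ^ (-α / 2 - 1)))
      + x i0 * (-α * (‖x‖ ^ 2) ^ (-α / 2 - 1)) +
      x i0 * (α * (α + 2)) * (x i ^ 2 * (‖x‖ ^ 2) ^ (-α / 2 - 2)) := by
  have h : pd (mod i0 α) i =ᶠ[𝓝 x] fun y => (if i = i0 then (1 : ℝ) else 0) * (‖y‖ ^ 2) ^ (-α / 2) +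
      y i0 * (-α * (y i * (‖y‖ ^ 2) ^ (-α / 2 - 1))) := by
    filter_upwards [(isOpen_hs i0).mem_nhds hx] with y hy using pd_mod hy α i
  have d1 := da_q hx (-α / 2)
  have d2 := da_q hx (-α / 2 - 1)
  have d3 : DifferentiableAt ℝ (fun y : Eu n => y i * (‖y‖ ^ 2) ^ (-α / 2 - 1)) x :=
    (da_coord i x).mul d2
  rw [pd_congr h, pd_add (d1.const_mul _) ((da_coord i0 x).fun_mul (d3.const_mul _)), pd_const_mul,
    pd_mul (da_coord i0 x) (d3.const_mul _), pd_const_mul, pd_mul (da_coord i x) d2, pd_q hx,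
    pd_q hx, pd_coord, pd_coord, if_pos rfl]
  have e : -α / 2 - 1 - 1 = -α / 2 - 2 := by ring
  rw [e]
  ring

lemma lap_mod {n : ℕ} {i0 : Fin n} {x : Eu n} (hx : x ∈ hs i0) (α : ℝ) :
    lap (mod i0 α) x = -(α * (n - α)) * (x i0 * (‖x‖ ^ 2) ^ (-α / 2 - 1)) := by
  rw [lap_eq]
  simp only [pd_pd_mod hx]
  rw [Finset.sum_add_distrib, Finset.sum_add_distrib,
    ← Finset.mul_sum _ (fun i => x i ^ 2 * (‖x‖ ^ 2) ^ (-α / 2 - 2)) (x i0 * (α * (α + 2))),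
    ← Finset.sum_mul _ (fun i => x i ^ 2), sum_sq]
  have hq := norm_sq_pos hx
  have e : ‖x‖ ^ 2 * (‖x‖ ^ 2) ^ (-α / 2 - 2) = (‖x‖ ^ 2) ^ (-α / 2 - 1) := by
    nth_rewrite 1 [← Real.rpow_one (‖x‖ ^ 2)]
    rw [← Real.rpow_add hq]; congr 1; ring
  rw [e]
  simp
  ring

lemma lap_mul {n : ℕ} {i0 : Fin n} {f g : Eu n → ℝ} (hf : ∀ x ∈ hs i0, ContDiffAt ℝ 2 f x)
    (hg : ∀ x ∈ hs i0, ContDiffAt ℝ 2 g x) {x : Eu n} (hx : x ∈ hs i0) :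
    lap (fun y => f y * g y) x = lap f x * g x + 2 * ∑ i, pd f i x * pd g i x + f x * lap g x := by
  rw [lap_eq, lap_eq, lap_eq, Finset.sum_mul, Finset.mul_sum, Finset.mul_sum,
    ← Finset.sum_add_distrib, ← Finset.sum_add_distrib]
  refine Finset.sum_congr rfl fun i _ => ?_
  have h : pd (fun y => f y * g y) i =ᶠ[𝓝 x] fun y => pd f i y * g y + f y * pd g i y := by
    filter_upwards [(isOpen_hs i0).mem_nhds hx] with y hy
    exact pd_mul ((hf y hy).differentiableAt (by norm_num))
      ((hg y hy).differentiableAt (by norm_num)) i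
  have f0 := (hf x hx).differentiableAt (by norm_num)
  have g0 := (hg x hx).differentiableAt (by norm_num)
  have f1 := (cda_pd (hf x hx) i).differentiableAt (by norm_num)
  have g1 := (cda_pd (hg x hx) i).differentiableAt (by norm_num)
  rw [pd_congr h, pd_add (f1.fun_mul g0) (f0.fun_mul g1), pd_mul f1 g0, pd_mul f0 g1]
  ring

lemma lap_congr {n : ℕ} {f g : Eu n → ℝ} {x : Eu n} (h : f =ᶠ[𝓝 x] g) :
    lap f x = lap g x := by
  rw [lap_eq, lap_eq]
  refine Finset.sum_congr rfl fun i _ => ?_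
  have : pd f i =ᶠ[𝓝 x] pd g i := by
    filter_upwards [h.eventuallyEq_nhds] with y hy using pd_congr hy i
  exact pd_congr this i

lemma sol_of {n : ℕ} {i0 : Fin n} {α γ : ℝ} (hαγ : α * (n - α) = γ) {u v : Eu n → ℝ}
    (hv : ContDiffOn ℝ 2 v (hs i0)) (huv : ∀ x ∈ hs i0, u x = mod i0 α x * v x)
    (heq : ∀ x ∈ hs i0, -(lap u x) - γ / ‖x‖ ^ 2 * u x = 0) : Sol i0 α v := by
  refine ⟨hv, fun x hx => ?_⟩
  have hq := norm_sq_pos hx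
  have h1 : u =ᶠ[𝓝 x] fun y => mod i0 α y * v y := by
    filter_upwards [(isOpen_hs i0).mem_nhds hx] with y hy using huv y hy
  have h2 := heq x hx
  rw [lap_congr h1, lap_mul (fun y hy => mod_cda hy α)
    (fun y hy => hv.contDiffAt ((isOpen_hs i0).mem_nhds hy)) hx, lap_mod hx, huv x hx] at h2
  simp only [pd_mod hx] at h2
  have e0 : (‖x‖ ^ 2) ^ (-α / 2) = ‖x‖ ^ 2 * (‖x‖ ^ 2) ^ (-α / 2 - 1) := by
    nth_rewrite 2 [← Real.rpow_one (‖x‖ ^ 2)]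
    rw [← Real.rpow_add hq]; congr 1; ring
  have e1 : ∑ i, ((if i = i0 then 1 else 0) * (‖x‖ ^ 2) ^ (-α / 2) +
      x i0 * (-α * (x i * (‖x‖ ^ 2) ^ (-α / 2 - 1)))) * pd v i x =
      (‖x‖ ^ 2) ^ (-α / 2) * pd v i0 x - α * x i0 * (‖x‖ ^ 2) ^ (-α / 2 - 1) *
        ∑ i, x i * pd v i x := by
    simp only [add_mul, Finset.sum_add_distrib, Finset.mul_sum]
    rw [sub_eq_add_neg (_ * _) (Finset.sum _ _), ← Finset.sum_neg_distrib]
    congr 1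
    · simp
    · exact Finset.sum_congr rfl fun i _ => by ring
  rw [e1, mod, e0] at h2
  have hP : 0 < (‖x‖ ^ 2) ^ (-α / 2 - 1) := Real.rpow_pos_of_pos hq _
  have e2 : γ / ‖x‖ ^ 2 * (x i0 * (‖x‖ ^ 2 * (‖x‖ ^ 2) ^ (-α / 2 - 1)) * v x) =
      γ * (x i0 * (‖x‖ ^ 2) ^ (-α / 2 - 1) * v x) := by
    generalize (‖x‖ ^ 2) ^ (-α / 2 - 1) = P
    generalize ‖x‖ ^ 2 = Q at hq
    field_simp
  rw [e2, ← hαγ] at h2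
  refine (mul_eq_zero (a := (‖x‖ ^ 2) ^ (-α / 2 - 1))).1 ?_ |>.resolve_left hP.ne'
  linear_combination -h2

lemma main {n : ℕ} {i0 : Fin n} {α γ : ℝ} (hαγ : α * (n - α) = γ) {u : Eu n → ℝ}
    (hu : ContDiffOn ℝ 2 u (hs i0)) (h0 : ∀ x ∈ hs i0, 0 ≤ u x)
    (heq : ∀ x ∈ hs i0, -(lap u x) - γ / ‖x‖ ^ 2 * u x = 0) {C : ℝ}
    (hC : ∀ x ∈ hs i0, u x ≤ C * x i0 * ‖x‖ ^ (-α)) :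
    ∃ c : ℝ, 0 ≤ c ∧ ∀ x ∈ hs i0, u x = c * x i0 * ‖x‖ ^ (-α) := by
  have hmod : ∀ x : Eu n, mod i0 α x = x i0 * ‖x‖ ^ (-α) := fun x => by
    unfold mod
    rw [← Real.rpow_natCast ‖x‖ 2, ← Real.rpow_mul (norm_nonneg _)]
    congr 2
    push_cast
    ring
  have hpos : ∀ x ∈ hs i0, 0 < mod i0 α x := fun x hx =>
    mul_pos hx (Real.rpow_pos_of_pos (norm_sq_pos hx) _)
  set v : Eu n → ℝ := fun x => u x / mod i0 α x with hv
  have huv : ∀ x ∈ hs i0, u x = mod i0 α x * v x := fun x hx => by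
    rw [hv, mul_div_cancel₀ _ (hpos x hx).ne']
  have hvs : ContDiffOn ℝ 2 v (hs i0) :=
    hu.div (fun x hx => (mod_cda hx α).contDiffWithinAt) fun x hx => (hpos x hx).ne'
  have hb : ∀ x ∈ hs i0, |v x| ≤ C := fun x hx => by
    rw [abs_of_nonneg (div_nonneg (h0 x hx) (hpos x hx).le), div_le_iff₀ (hpos x hx), hmod]
    linarith [hC x hx]
  obtain ⟨c, hc⟩ := liouville (sol_of hαγ hvs huv heq) hb
  refine ⟨c, ?_, fun x hx => ?_⟩
  · have hx : (EuclideanSpace.single i0 (1 : ℝ) : Eu n) ∈ hs i0 := by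
      simp [hs]
    rw [← hc _ hx]
    exact div_nonneg (h0 _ hx) (hpos _ hx).le
  · rw [huv x hx, hc x hx, hmod]
    ring

end Rigid

theorem rigidity_entire_solutions (n : ℕ) (hn : 3 ≤ n) (i0 : Fin n) (hi0 : (i0 : ℕ) = 0)
    (γ : ℝ) (hγ : γ < (n : ℝ) ^ 2 / 4) (s : ℝ) (hs0 : 0 ≤ s) (hs2 : s < 2)
    (am ap : ℝ)
    (ham : am = (n : ℝ) / 2 - Real.sqrt ((n : ℝ) ^ 2 / 4 - γ))
    (hap : ap = (n : ℝ) / 2 + Real.sqrt ((n : ℝ) ^ 2 / 4 - γ))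
    (α : ℝ) (hα : α = am ∨ α = ap)
    (u : EuclideanSpace ℝ (Fin n) → ℝ)
    (hreg : ContDiffOn ℝ 2 u ({x : EuclideanSpace ℝ (Fin n) | 0 < x i0} \ {0}))
    (hcont : ContinuousOn u
      (closure {x : EuclideanSpace ℝ (Fin n) | 0 < x i0} \ {0}))
    (hnonneg : ∀ x : EuclideanSpace ℝ (Fin n), 0 < x i0 → 0 ≤ u x)
    (hbdry : ∀ x : EuclideanSpace ℝ (Fin n), x i0 = 0 → x ≠ 0 → u x = 0)
    (heq : ∀ x : EuclideanSpace ℝ (Fin n), 0 < x i0 →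
      -(lap u x) - γ / ‖x‖ ^ 2 * u x = 0)
    (hbound : ∃ C : ℝ, ∀ x : EuclideanSpace ℝ (Fin n), 0 < x i0 →
      u x ≤ C * x i0 * ‖x‖ ^ (-α))
    (hseq : ∃ xi : ℕ → EuclideanSpace ℝ (Fin n),
      (∀ i, 0 < xi i i0) ∧
      ((α = am ∧ Tendsto (fun i => ‖xi i‖) atTop atTop) ∨
        (α = ap ∧ Tendsto (fun i => ‖xi i‖) atTop (nhds 0))) ∧
      Tendsto (fun i => u (xi i) / (xi i i0 * ‖xi i‖ ^ (-α))) atTop (nhds 0)) :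
    (∀ x : EuclideanSpace ℝ (Fin n), 0 < x i0 → u x = 0) ∨
      ∃ lam : ℝ, 0 < lam ∧
        ∀ x : EuclideanSpace ℝ (Fin n), 0 < x i0 → u x = lam * x i0 * ‖x‖ ^ (-α) := by
  have hαγ : α * (n - α) = γ := by
    have hsq : Real.sqrt ((n : ℝ) ^ 2 / 4 - γ) ^ 2 = (n : ℝ) ^ 2 / 4 - γ :=
      Real.sq_sqrt (by linarith)
    rcases hα with h | h
    · rw [h, ham]
      linear_combination -hsq
    · rw [h, hap]
      linear_combination -hsq
  obtain ⟨C, hC⟩ := hbound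
  have hu : ContDiffOn ℝ 2 u (Rigid.hs i0) := by
    refine hreg.mono fun x hx => ⟨hx, ?_⟩
    rintro rfl
    simp [Rigid.hs] at hx
  obtain ⟨c, hc0, hc⟩ := Rigid.main (i0 := i0) hαγ hu hnonneg heq hC
  rcases hc0.eq_or_lt with h | h
  · left
    intro x hx
    rw [hc x hx, ← h, zero_mul, zero_mul]
  · exact Or.inr ⟨c, h, fun x hx => hc x hx⟩
end
end

section
/- Let u ∈ C²(cl(ℝⁿ₊) \ {0}) be nonnegative, solve −Δu − (γ/|x|²)u = 0 in ℝⁿ₊ and u = 0 on ∂ℝⁿ₊, where γ < n²/4 and n ≥ 3. Then there exist λ₋, λ₊ ≥ 0 such that u(x) = λ₋ x₁ |x|^{−α₋(γ)} + λ₊ x₁ |x|^{−α₊(γ)} for all x ∈ ℝⁿ₊. -/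
noncomputable section

open Set Filter Topology MeasureTheory
open scoped ContDiff

/-- The closed half space without the origin. -/
def SS {n : ℕ} (i0 : Fin n) : Set (EuclideanSpace ℝ (Fin n)) := {x | 0 ≤ x i0} ∩ {0}ᶜ

/-- The open half space. -/
def HH {n : ℕ} (i0 : Fin n) : Set (EuclideanSpace ℝ (Fin n)) := {x | 0 < x i0}

lemma isOpen_HH {n : ℕ} (i0 : Fin n) : IsOpen (HH i0) :=
  isOpen_lt continuous_const (by fun_prop)

lemma isClosed_CC {n : ℕ} (i0 : Fin n) :
    IsClosed {x : EuclideanSpace ℝ (Fin n) | 0 ≤ x i0} :=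
  isClosed_le continuous_const (by fun_prop)

lemma HH_sub_SS {n : ℕ} (i0 : Fin n) : HH i0 ⊆ SS i0 := by
  intro x hx
  have hx' : 0 < x i0 := hx
  refine ⟨hx'.le, ?_⟩
  rintro rfl
  simp at hx'

lemma SS_nhds {n : ℕ} {i0 : Fin n} {x : EuclideanSpace ℝ (Fin n)} (hx : 0 < x i0) :
    SS i0 ∈ 𝓝 x :=
  mem_of_superset ((isOpen_HH i0).mem_nhds hx) (HH_sub_SS i0)

lemma uniqueDiff_SS {n : ℕ} (i0 : Fin n) : UniqueDiffOn ℝ (SS i0) := by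
  apply UniqueDiffOn.inter _ isOpen_compl_singleton
  apply uniqueDiffOn_convex
  · intro x hx y hy a b ha hb _
    have h1 : 0 ≤ x i0 := hx
    have h2 : 0 ≤ y i0 := hy
    show 0 ≤ (a • x + b • y) i0
    simp
    positivity
  · refine ⟨EuclideanSpace.single i0 1, ?_⟩
    rw [mem_interior_iff_mem_nhds]
    exact mem_of_superset ((isOpen_HH i0).mem_nhds (by simp [HH])) (fun y hy => (show (0:ℝ) < y i0 from hy).le)

lemma closure_HH {n : ℕ} (i0 : Fin n) :
    closure {x : EuclideanSpace ℝ (Fin n) | 0 < x i0} \ {0} = SS i0 := by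
  have : closure {x : EuclideanSpace ℝ (Fin n) | 0 < x i0} = {x | 0 ≤ x i0} := by
    apply subset_antisymm
    · apply closure_minimal _ (isClosed_CC i0)
      intro x hx
      exact (show (0:ℝ) < x i0 from hx).le
    · intro x hx
      have hx' : 0 ≤ x i0 := hx
      have h1 : Tendsto (fun t : ℝ => x + t • EuclideanSpace.single i0 (1:ℝ)) (𝓝[>] 0) (𝓝 x) := by
        have : Continuous (fun t : ℝ => x + t • EuclideanSpace.single i0 (1:ℝ)) := by fun_prop
        have h := this.tendsto 0
        simp only [zero_smul, add_zero] at h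
        exact h.mono_left nhdsWithin_le_nhds
      apply mem_closure_of_tendsto h1
      filter_upwards [self_mem_nhdsWithin] with t ht
      have : (0:ℝ) < t := ht
      simp
      linarith
  rw [this]; rfl

section green
variable {n : ℕ} {i0 : Fin n} {w f : EuclideanSpace ℝ (Fin n) → ℝ}

/-- The vector field component. -/
def FF (i0 : Fin n) (w f : EuclideanSpace ℝ (Fin n) → ℝ) (i : Fin n)
    (x : EuclideanSpace ℝ (Fin n)) : ℝ :=
  w x * fderiv ℝ f x (EuclideanSpace.single i 1)
    - f x * fderivWithin ℝ w (SS i0) x (EuclideanSpace.single i 1)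

def FF' (i0 : Fin n) (w f : EuclideanSpace ℝ (Fin n) → ℝ) (i : Fin n)
    (x : EuclideanSpace ℝ (Fin n)) : ℝ :=
  w x * fderiv ℝ (fun y => fderiv ℝ f y (EuclideanSpace.single i 1)) x
      (EuclideanSpace.single i 1)
    - f x * fderivWithin ℝ (fun y => fderivWithin ℝ w (SS i0) y (EuclideanSpace.single i 1))
      (SS i0) x (EuclideanSpace.single i 1)

lemma contDiffOn_W (hw : ContDiffOn ℝ 2 w (SS i0)) (i : Fin n) :
    ContDiffOn ℝ 1 (fun y => fderivWithin ℝ w (SS i0) y (EuclideanSpace.single i 1)) (SS i0) := by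
  have h := ((contDiffOn_succ_iff_fderivWithin (n := 1) (uniqueDiff_SS i0)).1
    (by simpa [one_add_one_eq_two] using hw)).2.2
  exact h.clm_apply contDiffOn_const

lemma contDiff_G (hf : ContDiff ℝ 2 f) (i : Fin n) :
    ContDiff ℝ 1 (fun y => fderiv ℝ f y (EuclideanSpace.single i 1)) := by
  have h : ContDiff ℝ 1 (fderiv ℝ f) := hf.fderiv_right (by norm_num [one_add_one_eq_two])
  exact h.clm_apply contDiff_const

lemma FF_hasFDerivWithinAt (hw : ContDiffOn ℝ 2 w (SS i0)) (hf : ContDiff ℝ 2 f) (i : Fin n)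
    {x : EuclideanSpace ℝ (Fin n)} (hx : x ∈ SS i0) :
    ∃ L : EuclideanSpace ℝ (Fin n) →L[ℝ] ℝ, HasFDerivWithinAt (FF i0 w f i) L (SS i0) x ∧
      L (EuclideanSpace.single i 1) = FF' i0 w f i x := by
  have h1 := (hw.differentiableOn (by norm_num) x hx).hasFDerivWithinAt
  have h2 := ((contDiffOn_W hw i).differentiableOn (by norm_num) x hx).hasFDerivWithinAt
  have h3 := (hf.differentiable (by norm_num) x).hasFDerivAt.hasFDerivWithinAt (s := SS i0)
  have h4 := ((contDiff_G hf i).differentiable (by norm_num) x).hasFDerivAt.hasFDerivWithinAt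
    (s := SS i0)
  refine ⟨_, (h1.mul h4).sub (h3.mul h2), ?_⟩
  simp [FF']
  ring

lemma FF_eq_zero {x : EuclideanSpace ℝ (Fin n)} {i : Fin n} (hx : x ∉ tsupport f) :
    FF i0 w f i x = 0 := by
  have h1 : f =ᶠ[𝓝 x] 0 := notMem_tsupport_iff_eventuallyEq.1 hx
  have h2 : fderiv ℝ f x = 0 := by
    rw [h1.fderiv_eq]; simp
  simp [FF, h2, h1.eq_of_nhds]

lemma FF'_eq_zero {x : EuclideanSpace ℝ (Fin n)} {i : Fin n} (hx : x ∉ tsupport f) :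
    FF' i0 w f i x = 0 := by
  have h1 : f =ᶠ[𝓝 x] 0 := notMem_tsupport_iff_eventuallyEq.1 hx
  have h3 : (fun y => fderiv ℝ f y (EuclideanSpace.single i 1)) =ᶠ[𝓝 x] fun _ => (0:ℝ) := by
    filter_upwards [h1.fderiv (𝕜 := ℝ)] with y hy
    rw [hy]; simp
  have h2 : fderiv ℝ (fun y => fderiv ℝ f y (EuclideanSpace.single i 1)) x = 0 := by
    rw [h3.fderiv_eq]; simp
  simp [FF', h2, h1.eq_of_nhds]

lemma FF_lineDeriv (hw : ContDiffOn ℝ 2 w (SS i0)) (hf : ContDiff ℝ 2 f)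
    (hwb : ∀ x : EuclideanSpace ℝ (Fin n), x i0 = 0 → x ≠ 0 → w x = 0)
    (h0 : (0 : EuclideanSpace ℝ (Fin n)) ∉ tsupport f)
    (hfb : ∀ x : EuclideanSpace ℝ (Fin n), x i0 = 0 → f x = 0) (i : Fin n)
    (x : EuclideanSpace ℝ (Fin n)) :
    HasLineDerivAt ℝ ((SS i0).indicator (FF i0 w f i)) ((HH i0).indicator (FF' i0 w f i) x) x
      (EuclideanSpace.single i 1) := by
  by_cases hxt : x ∈ tsupport f
  swap
  · have : (SS i0).indicator (FF i0 w f i) =ᶠ[𝓝 x] fun _ => 0 := by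
      filter_upwards [(isClosed_tsupport f).isOpen_compl.mem_nhds hxt] with y hy
      by_cases hy' : y ∈ SS i0
      · rw [indicator_of_mem hy', FF_eq_zero hy]
      · rw [indicator_of_notMem hy']
    have h2 : (HH i0).indicator (FF' i0 w f i) x = 0 := by
      by_cases hy' : x ∈ HH i0
      · rw [indicator_of_mem hy', FF'_eq_zero hxt]
      · rw [indicator_of_notMem hy']
    rw [h2]
    have h := (hasFDerivAt_const (0:ℝ) x (𝕜 := ℝ)).congr_of_eventuallyEq this
    simpa using h.hasLineDerivAt (EuclideanSpace.single i 1)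
  have hx0 : x ≠ 0 := by rintro rfl; exact h0 hxt
  rcases lt_trichotomy (x i0) 0 with hx | hx | hx
  · have : (SS i0).indicator (FF i0 w f i) =ᶠ[𝓝 x] fun _ => 0 := by
      have : IsOpen {y : EuclideanSpace ℝ (Fin n) | y i0 < 0} :=
        isOpen_lt (by fun_prop) continuous_const
      filter_upwards [this.mem_nhds hx] with y hy
      have hy1 : y i0 < 0 := hy
      rw [indicator_of_notMem]
      exact fun h => absurd h.1 (not_le.2 hy1)
    have h2 : (HH i0).indicator (FF' i0 w f i) x = 0 := by
      rw [indicator_of_notMem]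
      exact fun h => absurd h (not_lt.2 hx.le)
    rw [h2]
    have h := (hasFDerivAt_const (0:ℝ) x (𝕜 := ℝ)).congr_of_eventuallyEq this
    simpa using h.hasLineDerivAt (EuclideanSpace.single i 1)
  · have hxS : x ∈ SS i0 := ⟨hx.ge, hx0⟩
    have h2 : (HH i0).indicator (FF' i0 w f i) x = 0 := by
      rw [indicator_of_notMem]
      exact fun h => absurd h (not_lt.2 hx.le)
    rw [h2]
    obtain ⟨L, hL, hL2⟩ := FF_hasFDerivWithinAt (i0 := i0) hw hf i hxS
    have hFx : FF i0 w f i x = 0 := by simp [FF, hwb x hx hx0, hfb x hx]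
    have hF'x : FF' i0 w f i x = 0 := by simp [FF', hwb x hx hx0, hfb x hx]
    rw [hF'x] at hL2
    set e : EuclideanSpace ℝ (Fin n) := EuclideanSpace.single i 1
    set A : Set ℝ := {t | x + t • e ∈ SS i0}
    have hline : HasDerivAt (fun t : ℝ => x + t • e) e 0 := by
      simpa using ((hasDerivAt_id (0:ℝ)).smul_const e).const_add x
    have hA : HasDerivWithinAt (fun t => (SS i0).indicator (FF i0 w f i) (x + t • e)) 0 A 0 := by
      have hL' : HasFDerivWithinAt (FF i0 w f i) L (SS i0) (x + (0:ℝ) • e) := by simpa using hL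
      have := hL'.comp_hasDerivWithinAt (0:ℝ) (hline.hasDerivWithinAt (s := A)) (fun t ht => ht)
      rw [hL2] at this
      refine this.congr (fun t ht => ?_) ?_
      · exact indicator_of_mem (show x + t • e ∈ SS i0 from ht) _
      · exact indicator_of_mem (show x + (0:ℝ) • e ∈ SS i0 by simpa using hxS) _
    have hB : HasDerivWithinAt (fun t => (SS i0).indicator (FF i0 w f i) (x + t • e)) 0 Aᶜ 0 := by
      refine (hasDerivWithinAt_const (0:ℝ) _ (0:ℝ)).congr (fun t ht => ?_) ?_
      · exact indicator_of_notMem (show x + t • e ∉ SS i0 from ht) _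
      · rw [zero_smul, add_zero, indicator_of_mem hxS, hFx]
    have := hA.union hB
    rw [union_compl_self, hasDerivWithinAt_univ] at this
    exact this
  · have hxH : x ∈ HH i0 := hx
    obtain ⟨L, hL, hL2⟩ := FF_hasFDerivWithinAt (i0 := i0) hw hf i (HH_sub_SS i0 hxH)
    rw [indicator_of_mem hxH, ← hL2]
    have h := hL.hasFDerivAt (SS_nhds hx)
    have h3 : (SS i0).indicator (FF i0 w f i) =ᶠ[𝓝 x] FF i0 w f i := by
      filter_upwards [SS_nhds hx] with y hy
      exact indicator_of_mem hy _
    exact (h.congr_of_eventuallyEq h3).hasLineDerivAt _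

lemma green (hw : ContDiffOn ℝ 2 w (SS i0)) (hf : ContDiff ℝ 2 f)
    (hwb : ∀ x : EuclideanSpace ℝ (Fin n), x i0 = 0 → x ≠ 0 → w x = 0)
    (hc : HasCompactSupport f)
    (h0 : (0 : EuclideanSpace ℝ (Fin n)) ∉ tsupport f)
    (hfb : ∀ x : EuclideanSpace ℝ (Fin n), x i0 = 0 → f x = 0) :
    ∫ x in HH i0, (w x * lap f x - f x * lap w x) = 0 := by
  set K := {x : EuclideanSpace ℝ (Fin n) | 0 ≤ x i0} ∩ tsupport f
  have hK : IsCompact K := hc.isCompact.inter_left (isClosed_CC i0)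
  have hKS : K ⊆ SS i0 := fun x hx => ⟨hx.1, by rintro rfl; exact h0 hx.2⟩
  have hF : ∀ i, Integrable ((SS i0).indicator (FF i0 w f i)) := by
    intro i
    have h1 : (SS i0).indicator (FF i0 w f i) = K.indicator (FF i0 w f i) := by
      ext x
      by_cases hx : x ∈ tsupport f
      · by_cases hx' : x ∈ SS i0
        · rw [indicator_of_mem hx', indicator_of_mem (show x ∈ K from ⟨hx'.1, hx⟩)]
        · rw [indicator_of_notMem hx', indicator_of_notMem (fun h => hx' (hKS h))]
      · simp [indicator, FF_eq_zero (i0 := i0) (w := w) (i := i) hx]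
    rw [h1, integrable_indicator_iff hK.measurableSet]
    refine ContinuousOn.integrableOn_compact hK ?_
    intro x hx
    obtain ⟨L, hL, hL2⟩ := FF_hasFDerivWithinAt (i0 := i0) hw hf i (hKS hx)
    exact (hL.continuousWithinAt).mono hKS
  have hF' : ∀ i, Integrable ((HH i0).indicator (FF' i0 w f i)) := by
    intro i
    have h1 : (HH i0).indicator (FF' i0 w f i)
        = (HH i0).indicator (K.indicator (FF' i0 w f i)) := by
      ext x
      by_cases hx : x ∈ tsupport f
      · by_cases hx' : x ∈ HH i0
        · rw [indicator_of_mem hx', indicator_of_mem hx',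
            indicator_of_mem (show x ∈ K from ⟨(show (0:ℝ) < x i0 from hx').le, hx⟩)]
        · rw [indicator_of_notMem hx', indicator_of_notMem hx']
      · simp [indicator, FF'_eq_zero (i0 := i0) (w := w) (i := i) hx]
    rw [h1]
    apply Integrable.indicator _ (isOpen_HH i0).measurableSet
    rw [integrable_indicator_iff hK.measurableSet]
    refine ContinuousOn.integrableOn_compact hK ?_
    have c1 : ContinuousOn w K := hw.continuousOn.mono hKS
    have c2 : ContinuousOn f K := hf.continuous.continuousOn
    have c3 : ContinuousOn (fun x => fderiv ℝ (fun y => fderiv ℝ f y (EuclideanSpace.single i 1)) x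
      (EuclideanSpace.single i 1)) K :=
      (((contDiff_G hf i).continuous_fderiv (by norm_num)).clm_apply continuous_const).continuousOn
    have c4 : ContinuousOn (fun x =>
      fderivWithin ℝ (fun y => fderivWithin ℝ w (SS i0) y (EuclideanSpace.single i 1))
      (SS i0) x (EuclideanSpace.single i 1)) K :=
      ((((contDiffOn_W hw i).continuousOn_fderivWithin (uniqueDiff_SS i0)
        (by norm_num)).clm_apply continuousOn_const).mono hKS)
    exact (c1.mul c3).sub (c2.mul c4)
  have hIntg : ∀ i, ∫ x, (HH i0).indicator (FF' i0 w f i) x = 0 := by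
    intro i
    have := integral_bilinear_hasLineDerivAt_right_eq_neg_left_of_integrable
      (μ := (volume : Measure (EuclideanSpace ℝ (Fin n))))
      (f := fun _ => (1:ℝ)) (f' := fun _ => (0:ℝ)) (g := (SS i0).indicator (FF i0 w f i))
      (g' := (HH i0).indicator (FF' i0 w f i)) (v := EuclideanSpace.single i 1)
      (B := ContinuousLinearMap.mul ℝ ℝ)
      (by simp) (by simpa using hF' i) (by simpa using hF i)
      (fun x _ => by
        simpa using (hasFDerivAt_const (1:ℝ) x (𝕜 := ℝ)).hasLineDerivAt (EuclideanSpace.single i 1))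
      (fun x _ => FF_lineDeriv hw hf hwb h0 hfb i x)
    simpa using this
  have hsum : ∑ i, ∫ x, (HH i0).indicator (FF' i0 w f i) x = 0 := by simp [hIntg]
  rw [← integral_finsetSum _ (fun i _ => hF' i)] at hsum
  rw [← integral_indicator (isOpen_HH i0).measurableSet, ← hsum]
  congr 1
  ext x
  by_cases hx : x ∈ HH i0
  · simp only [indicator_of_mem hx]
    simp only [lap, FF', Finset.mul_sum, Finset.sum_sub_distrib]
    congr 1
    refine Finset.sum_congr rfl fun i _ => ?_
    congr 1
    rw [fderivWithin_of_mem_nhds (SS_nhds hx)]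
    have : (fun y => fderivWithin ℝ w (SS i0) y (EuclideanSpace.single i 1)) =ᶠ[𝓝 x]
        fun y => fderiv ℝ w y (EuclideanSpace.single i 1) := by
      filter_upwards [(isOpen_HH i0).mem_nhds hx] with y hy
      rw [fderivWithin_of_mem_nhds (SS_nhds hy)]
    rw [this.fderiv_eq]
  · simp [indicator_of_notMem hx]

end green

section radial
variable {n : ℕ}

lemma hasFDerivAt_logn {x : EuclideanSpace ℝ (Fin n)} (hx : x ≠ 0) :
    HasFDerivAt (fun y : EuclideanSpace ℝ (Fin n) => Real.log ‖y‖)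
      ((‖x‖ ^ 2)⁻¹ • innerSL ℝ x) x := by
  have h1 : HasFDerivAt (fun y : EuclideanSpace ℝ (Fin n) => ‖y‖ ^ 2) (2 • innerSL ℝ x) x :=
    (hasStrictFDerivAt_norm_sq x).hasFDerivAt
  have hx2 : ‖x‖ ^ 2 ≠ 0 := by positivity
  have h2 := (h1.log hx2).const_mul (1/2 : ℝ)
  have h3 : (fun y : EuclideanSpace ℝ (Fin n) => Real.log ‖y‖)
      = fun y => 1/2 * Real.log (‖y‖^2) := by
    ext y; rw [Real.log_pow]; push_cast; ring
  rw [h3]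
  refine h2.congr_fderiv ?_
  ext v
  simp
  ring

lemma innerSL_single (x : EuclideanSpace ℝ (Fin n)) (i : Fin n) :
    innerSL ℝ x (EuclideanSpace.single i 1) = x i := by
  simp [EuclideanSpace.inner_single_right]

lemma lap_mul_radial {p : EuclideanSpace ℝ (Fin n) → ℝ} (hp : ContDiff ℝ 2 p) (k : ℝ)
    (heu : ∀ x, ∑ i, x i * fderiv ℝ p x (EuclideanSpace.single i 1) = k * p x)
    {E E' E'' : ℝ → ℝ} (hE : ∀ s, HasDerivAt E (E' s) s) (hE' : ∀ s, HasDerivAt E' (E'' s) s)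
    {x : EuclideanSpace ℝ (Fin n)} (hx : x ≠ 0) :
    lap (fun y => p y * E (Real.log ‖y‖)) x = E (Real.log ‖x‖) * lap p x
      + (‖x‖ ^ 2)⁻¹ * p x * (E'' (Real.log ‖x‖) + (n - 2 + 2 * k) * E' (Real.log ‖x‖)) := by
  have hx2 : ‖x‖ ^ 2 ≠ 0 := by positivity
  have hcomp : ∀ (E E' : ℝ → ℝ) (_ : ∀ s, HasDerivAt E (E' s) s) (y : EuclideanSpace ℝ (Fin n)),
      y ≠ 0 → HasFDerivAt (fun y : EuclideanSpace ℝ (Fin n) => E (Real.log ‖y‖))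
        (E' (Real.log ‖y‖) • ((‖y‖ ^ 2)⁻¹ • innerSL ℝ y)) y := by
    intro E E' hE y hy
    exact (hE (Real.log ‖y‖)).comp_hasFDerivAt y (hasFDerivAt_logn hy)
  have key : ∀ i : Fin n, fderiv ℝ (fun y => fderiv ℝ (fun y => p y * E (Real.log ‖y‖)) y
      (EuclideanSpace.single i 1)) x (EuclideanSpace.single i 1)
      = E (Real.log ‖x‖) * fderiv ℝ (fun y => fderiv ℝ p y (EuclideanSpace.single i 1)) x
        (EuclideanSpace.single i 1)
        + 2 * E' (Real.log ‖x‖) * (‖x‖ ^ 2)⁻¹ * (x i * fderiv ℝ p x (EuclideanSpace.single i 1))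
        + p x * (E'' (Real.log ‖x‖) - 2 * E' (Real.log ‖x‖)) * (‖x‖ ^ 2)⁻¹ ^ 2 * (x i) ^ 2
        + p x * E' (Real.log ‖x‖) * (‖x‖ ^ 2)⁻¹ := by
    intro i
    have h1 : (fun y => fderiv ℝ (fun y => p y * E (Real.log ‖y‖)) y
      (EuclideanSpace.single i 1)) =ᶠ[𝓝 x] fun y => p y * (E' (Real.log ‖y‖) *
        ((‖y‖ ^ 2)⁻¹ * y i)) + E (Real.log ‖y‖) * fderiv ℝ p y (EuclideanSpace.single i 1) := by
      filter_upwards [isOpen_compl_singleton.mem_nhds hx] with y hy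
      have := ((hp.differentiable (by norm_num) y).hasFDerivAt.mul (hcomp E E' hE y hy)).fderiv
      erw [this]
      simp [EuclideanSpace.inner_single_right]
    rw [h1.fderiv_eq]
    have d1 := (hp.differentiable (by norm_num) x).hasFDerivAt
    have d2 := hcomp E E' hE x hx
    have d3 := hcomp E' E'' hE' x hx
    have d4 := ((contDiff_G hp i).differentiable (by norm_num) x).hasFDerivAt
    have d5 : HasFDerivAt (fun y : EuclideanSpace ℝ (Fin n) => (‖y‖ ^ 2)⁻¹)
        ((-((‖x‖ ^ 2) ^ 2)⁻¹) • (2 • innerSL ℝ x)) x :=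
      (hasDerivAt_inv hx2).comp_hasFDerivAt x (hasStrictFDerivAt_norm_sq x).hasFDerivAt
    have d6 : HasFDerivAt (fun y : EuclideanSpace ℝ (Fin n) => y i)
        (EuclideanSpace.proj i : EuclideanSpace ℝ (Fin n) →L[ℝ] ℝ) x :=
      (EuclideanSpace.proj i : EuclideanSpace ℝ (Fin n) →L[ℝ] ℝ).hasFDerivAt
    have := ((d1.mul (d3.mul (d5.mul d6))).add (d2.mul d4)).fderiv
    erw [this]
    simp [EuclideanSpace.inner_single_right]
    field_simp
    ring
  unfold lap
  rw [Finset.sum_congr rfl (fun i _ => key i)]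
  simp only [Finset.sum_add_distrib, ← Finset.mul_sum]
  rw [heu x]
  have hns : ∑ i, (x i) ^ 2 = ‖x‖ ^ 2 := by rw [EuclideanSpace.real_norm_sq_eq]
  rw [hns]
  simp only [Finset.sum_const, Finset.card_univ, Fintype.card_fin, nsmul_eq_mul]
  field_simp
  ring

/-- monomials -/
def mono (m : Fin n → ℕ) (x : EuclideanSpace ℝ (Fin n)) : ℝ := ∏ i, x i ^ m i

lemma contDiff_mono (m : Fin n → ℕ) (k : WithTop ℕ∞) : ContDiff ℝ k (mono m) := by
  unfold mono
  apply contDiff_prod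
  intro i _
  exact ((EuclideanSpace.proj i : EuclideanSpace ℝ (Fin n) →L[ℝ] ℝ).contDiff).pow _

lemma mono_split (m : Fin n → ℕ) (i : Fin n) (x : EuclideanSpace ℝ (Fin n)) :
    mono m x = x i ^ m i * ∏ j ∈ Finset.univ.erase i, x j ^ m j := by
  unfold mono
  exact (Finset.mul_prod_erase Finset.univ (fun j => x j ^ m j) (Finset.mem_univ i)).symm

lemma mono_update (m : Fin n → ℕ) (i : Fin n) (k : ℕ) (x : EuclideanSpace ℝ (Fin n)) :
    mono (Function.update m i k) x = x i ^ k * ∏ j ∈ Finset.univ.erase i, x j ^ m j := by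
  rw [mono_split _ i]
  congr 1
  · simp
  · refine Finset.prod_congr rfl fun j hj => ?_
    rw [Function.update_of_ne (Finset.ne_of_mem_erase hj)]

lemma fderiv_mono (m : Fin n → ℕ) (i : Fin n) (x : EuclideanSpace ℝ (Fin n)) :
    fderiv ℝ (mono m) x (EuclideanSpace.single i 1)
      = m i * mono (Function.update m i (m i - 1)) x := by
  have hd : DifferentiableAt ℝ (mono m) x := (contDiff_mono m 1).differentiable (by norm_num) x
  rw [← hd.lineDeriv_eq_fderiv]
  apply HasLineDerivAt.lineDeriv
  unfold HasLineDerivAt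
  have h : (fun t : ℝ => mono m (x + t • EuclideanSpace.single i 1))
      = fun t => (x i + t) ^ m i * ∏ j ∈ Finset.univ.erase i, x j ^ m j := by
    ext t
    rw [mono_split _ i]
    congr 1
    · simp
    · refine Finset.prod_congr rfl fun j hj => ?_
      have := Finset.ne_of_mem_erase hj
      simp [this]
  rw [h, mono_update]
  have h2 : HasDerivAt (fun t : ℝ => (x i + t)) 1 0 := (hasDerivAt_id (0:ℝ)).const_add _
  have h3 := (h2.pow (m i)).mul_const (∏ j ∈ Finset.univ.erase i, x j ^ m j)
  simp only [add_zero, mul_one] at h3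
  rw [← mul_assoc]
  exact h3

lemma euler_mono (m : Fin n → ℕ) (x : EuclideanSpace ℝ (Fin n)) :
    ∑ i, x i * fderiv ℝ (mono m) x (EuclideanSpace.single i 1)
      = ((∑ i, m i : ℕ) : ℝ) * mono m x := by
  push_cast
  rw [Finset.sum_mul]
  refine Finset.sum_congr rfl fun i _ => ?_
  rw [fderiv_mono, mono_update, mono_split m i]
  rcases Nat.eq_zero_or_pos (m i) with h | h
  · simp [h]
  · obtain ⟨k, hk⟩ := Nat.exists_eq_add_of_lt h
    rw [hk]
    simp
    ring

lemma lap_mono (m : Fin n → ℕ) (x : EuclideanSpace ℝ (Fin n)) :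
    lap (mono m) x = ∑ i, ((m i : ℝ) * ((m i - 1 : ℕ) : ℝ))
      * mono (Function.update m i (m i - 2)) x := by
  unfold lap
  refine Finset.sum_congr rfl fun i _ => ?_
  have : (fun y => fderiv ℝ (mono m) y (EuclideanSpace.single i 1))
      = fun y => (m i : ℝ) * mono (Function.update m i (m i - 1)) y := by
    ext y; rw [fderiv_mono]
  rw [this, fderiv_const_mul ((contDiff_mono _ 1).differentiable (by norm_num) x)]
  simp [fderiv_mono, mul_assoc, Nat.sub_sub]

lemma abs_coord_le (x : EuclideanSpace ℝ (Fin n)) (i : Fin n) : |x i| ≤ ‖x‖ := by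
  simpa using PiLp.norm_apply_le x i

lemma abs_mono_le (m : Fin n → ℕ) (i : Fin n) (hm : 1 ≤ m i) (x : EuclideanSpace ℝ (Fin n)) :
    |mono m x| ≤ |x i| * ‖x‖ ^ (∑ i, m i - 1) := by
  rw [mono_split m i, abs_mul, abs_pow, Finset.abs_prod]
  obtain ⟨k, hk⟩ := Nat.exists_eq_add_of_le hm
  have h1 : ∏ j ∈ Finset.univ.erase i, |x j ^ m j| ≤ ∏ j ∈ Finset.univ.erase i, ‖x‖ ^ m j := by
    apply Finset.prod_le_prod
    · intro j _; positivity
    · intro j _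
      rw [abs_pow]
      gcongr
      exact abs_coord_le x j
  have h2 : ∑ j, m j - 1 = k + ∑ j ∈ Finset.univ.erase i, m j := by
    rw [← Finset.add_sum_erase _ _ (Finset.mem_univ i)]
    omega
  rw [h2, hk, pow_add, pow_add, ← Finset.prod_pow_eq_pow_sum, pow_one]
  have h3 : |x i| ^ k ≤ ‖x‖ ^ k := by
    gcongr; exact abs_coord_le x i
  calc |x i| * |x i| ^ k * _ ≤ |x i| * ‖x‖ ^ k * ∏ j ∈ Finset.univ.erase i, ‖x‖ ^ m j := by
        gcongr
    _ = _ := by ring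

end radial

section phi
variable {n : ℕ}

def Phi (D : EuclideanSpace ℝ (Fin n) → ℝ) (ζ : ℝ → ℝ) : ℝ := ∫ x, D x * ζ (Real.log ‖x‖)

def ann (n : ℕ) (R : ℝ) : Set (EuclideanSpace ℝ (Fin n)) :=
  {x | Real.exp (-R) ≤ ‖x‖ ∧ ‖x‖ ≤ Real.exp R}

lemma isCompact_ann (R : ℝ) : IsCompact (ann n R) := by
  apply Metric.isCompact_of_isClosed_isBounded
  · exact (isClosed_le continuous_const continuous_norm).inter
      (isClosed_le continuous_norm continuous_const)
  · apply (Metric.isBounded_closedBall (x := (0 : EuclideanSpace ℝ (Fin n)))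
      (r := Real.exp R)).subset
    intro x hx
    simpa using hx.2

lemma mem_ann_iff {R : ℝ} {x : EuclideanSpace ℝ (Fin n)} (hx : x ≠ 0) :
    x ∈ ann n R ↔ |Real.log ‖x‖| ≤ R := by
  have h : 0 < ‖x‖ := norm_pos_iff.2 hx
  unfold ann
  rw [abs_le, Real.le_log_iff_exp_le h, Real.log_le_iff_le_exp h]
  rfl

lemma zero_notMem_ann (R : ℝ) : (0 : EuclideanSpace ℝ (Fin n)) ∉ ann n R := by
  intro h
  have h1 := h.1
  simp at h1
  linarith [Real.exp_pos (-R)]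

structure LI (D : EuclideanSpace ℝ (Fin n) → ℝ) : Prop where
  zero : D 0 = 0
  int : ∀ R, IntegrableOn D (ann n R)

structure Tst (ζ : ℝ → ℝ) : Prop where
  smooth : ContDiff ℝ ∞ ζ
  cpt : HasCompactSupport ζ

lemma Tst.bdd {ζ : ℝ → ℝ} (h : Tst ζ) :
    ∃ R, 0 < R ∧ ∀ s, R < |s| → ζ s = 0 := by
  obtain ⟨R, hR⟩ := h.cpt.isCompact.isBounded.subset_closedBall 0
  refine ⟨max R 1, by positivity, fun s hs => ?_⟩
  by_contra hne
  have := hR (subset_tsupport _ hne)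
  simp at this
  exact absurd hs (not_lt.2 (this.trans (le_max_left _ _)))

lemma Tst.bddC {ζ : ℝ → ℝ} (h : Tst ζ) : ∃ C, 0 ≤ C ∧ ∀ s, |ζ s| ≤ C := by
  obtain ⟨C, hC⟩ := h.cpt.exists_bound_of_continuous h.smooth.continuous
  exact ⟨C, (norm_nonneg _).trans (hC 0), fun s => by simpa using hC s⟩

lemma Tst.deriv {ζ : ℝ → ℝ} (h : Tst ζ) : Tst (deriv ζ) :=
  ⟨(contDiff_infty_iff_deriv.1 h.smooth).2, h.cpt.deriv⟩

lemma Tst.shift {ζ : ℝ → ℝ} (h : Tst ζ) (t : ℝ) : Tst (fun s => ζ (s - t)) := by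
  refine ⟨h.smooth.comp (contDiff_id.sub contDiff_const), ?_⟩
  exact h.cpt.comp_homeomorph (Homeomorph.subRight t)

lemma Tst.mul_smooth {ζ g : ℝ → ℝ} (h : Tst ζ) (hg : ContDiff ℝ ∞ g) :
    Tst (fun s => g s * ζ s) :=
  ⟨hg.mul h.smooth, h.cpt.mul_left⟩

lemma Tst.hasDerivAt {ζ : ℝ → ℝ} (h : Tst ζ) (s : ℝ) : HasDerivAt ζ (_root_.deriv ζ s) s :=
  (h.smooth.differentiable (by norm_num) s).hasDerivAt

lemma measurable_logn : Measurable (fun x : EuclideanSpace ℝ (Fin n) => Real.log ‖x‖) :=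
  Real.measurable_log.comp measurable_norm

lemma LI.integrable {D : EuclideanSpace ℝ (Fin n) → ℝ} (hD : LI D) {g : ℝ → ℝ}
    (hg : Measurable g) {C R : ℝ} (hC : ∀ s, |g s| ≤ C) (hR : ∀ s, R < |s| → g s = 0) :
    Integrable (fun x => D x * g (Real.log ‖x‖)) := by
  have h1 : (fun x => D x * g (Real.log ‖x‖))
      = fun x => (ann n R).indicator D x * g (Real.log ‖x‖) := by
    ext x
    by_cases hx : x ∈ ann n R
    · rw [indicator_of_mem hx]
    · rw [indicator_of_notMem hx, zero_mul]
      by_cases hx0 : x = 0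
      · rw [hx0, hD.zero, zero_mul]
      · rw [mem_ann_iff hx0, not_le] at hx
        rw [hR _ hx, mul_zero]
  rw [h1]
  have h2 : Integrable ((ann n R).indicator D) :=
    (integrable_indicator_iff (isCompact_ann R).measurableSet).2 (hD.int R)
  exact h2.mul_bdd (c := C) (hg.comp measurable_logn).aestronglyMeasurable
    (Eventually.of_forall fun x => by simpa using hC _)

lemma LI.integrable_tst {D : EuclideanSpace ℝ (Fin n) → ℝ} (hD : LI D) {g : ℝ → ℝ}
    (hg : Tst g) : Integrable (fun x => D x * g (Real.log ‖x‖)) := by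
  obtain ⟨R, _, hR⟩ := hg.bdd
  obtain ⟨C, _, hC⟩ := hg.bddC
  exact hD.integrable hg.smooth.continuous.measurable hC hR

lemma Phi_hasDerivAt {D : EuclideanSpace ℝ (Fin n) → ℝ} (hD : LI D) {ζ : ℝ → ℝ}
    (hζ : Tst ζ) (t : ℝ) :
    HasDerivAt (fun t => Phi D (fun s => ζ (s - t))) (- Phi D (fun s => deriv ζ (s - t))) t := by
  obtain ⟨R, hR0, hR⟩ := hζ.deriv.bdd
  obtain ⟨C, hC0, hC⟩ := hζ.deriv.bddC
  have hb : Integrable (fun x => |D x| * (Icc (t - 1 - R) (t + 1 + R)).indicator (fun _ => C)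
      (Real.log ‖x‖)) := by
    have hD' : LI (fun x => |D x|) := ⟨by simp [hD.zero], fun R => (hD.int R).abs⟩
    refine hD'.integrable (C := C) (R := |t| + 1 + R) (measurable_const.indicator measurableSet_Icc)
      (fun s => ?_) (fun s hs => ?_)
    · by_cases h : s ∈ Icc (t - 1 - R) (t + 1 + R)
      · rw [indicator_of_mem h, abs_of_nonneg hC0]
      · rw [indicator_of_notMem h, abs_zero]; exact hC0
    · rw [indicator_of_notMem]
      rintro ⟨h1, h2⟩
      apply absurd hs (not_lt.2 _)
      rw [abs_le]
      constructor
      · linarith [neg_abs_le t]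
      · linarith [le_abs_self t]
  have := (hasDerivAt_integral_of_dominated_loc_of_deriv_le
    (μ := (volume : Measure (EuclideanSpace ℝ (Fin n))))
    (F := fun t x => D x * ζ (Real.log ‖x‖ - t))
    (F' := fun t x => - (D x * deriv ζ (Real.log ‖x‖ - t))) (x₀ := t)
    (Metric.ball_mem_nhds t one_pos)
    (Eventually.of_forall fun t => (hD.integrable_tst (hζ.shift t)).aestronglyMeasurable)
    (hD.integrable_tst (hζ.shift t))
    (hD.integrable_tst (hζ.deriv.shift t)).neg.aestronglyMeasurable
    (Eventually.of_forall fun x t' ht' => ?_) hb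
    (Eventually.of_forall fun x t' _ => ?_)).2
  · rw [integral_neg] at this
    exact this
  · rw [norm_neg, norm_mul, Real.norm_eq_abs, Real.norm_eq_abs]
    apply mul_le_mul_of_nonneg_left _ (abs_nonneg _)
    rw [Metric.mem_ball, Real.dist_eq, abs_lt] at ht'
    by_cases h : Real.log ‖x‖ ∈ Icc (t - 1 - R) (t + 1 + R)
    · rw [indicator_of_mem h]; exact hC _
    · rw [indicator_of_notMem h]
      rw [hR, abs_zero]
      by_contra hlt
      rw [not_lt, abs_le] at hlt
      exact h ⟨by linarith [hlt.1], by linarith [hlt.2]⟩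
  · have h1 : HasDerivAt (fun t => Real.log ‖x‖ - t) (-1) t' := by
      simpa using (hasDerivAt_id t').const_sub (Real.log ‖x‖)
    have h2 := ((hζ.hasDerivAt (Real.log ‖x‖ - t')).comp t' h1).const_mul (D x)
    exact h2.congr_deriv (by ring)

lemma Phi_fubini {D : EuclideanSpace ℝ (Fin n) → ℝ} (hD : LI D) {ζ ξ : ℝ → ℝ}
    (hζ : Tst ζ) (hξ : Tst ξ) :
    ∫ t, Phi D (fun s => ζ (s - t)) * ξ t = ∫ t, Phi D (fun s => ξ (s - t)) * ζ t := by
  have main : ∀ {ζ ξ : ℝ → ℝ}, Tst ζ → Tst ξ → ∫ t, Phi D (fun s => ζ (s - t)) * ξ t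
      = ∫ x, D x * ∫ t, ζ (Real.log ‖x‖ - t) * ξ t := by
    intro ζ ξ hζ hξ
    have e1 : ∀ t, Phi D (fun s => ζ (s - t)) * ξ t
        = ∫ x, D x * ζ (Real.log ‖x‖ - t) * ξ t := by
      intro t
      rw [Phi, integral_mul_const]
    simp_rw [e1]
    obtain ⟨R, hR0, hR⟩ := hζ.bdd
    obtain ⟨C, hC0, hC⟩ := hζ.bddC
    obtain ⟨R', hR0', hR'⟩ := hξ.bdd
    rw [integral_integral_swap]
    · congr 1
      ext x
      rw [← integral_const_mul]
      congr 1
      ext t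
      ring
    · have h1 : (Function.uncurry fun t (x : EuclideanSpace ℝ (Fin n)) =>
          D x * ζ (Real.log ‖x‖ - t) * ξ t)
          = fun z => (ξ z.1 * (ann n (R + R')).indicator D z.2) * ζ (Real.log ‖z.2‖ - z.1) := by
        ext ⟨t, x⟩
        simp only [Function.uncurry]
        by_cases hx : x ∈ ann n (R + R')
        · rw [indicator_of_mem hx]; ring
        · rw [indicator_of_notMem hx]
          by_cases hx0 : x = 0
          · rw [hx0, hD.zero]; ring
          · rw [mem_ann_iff hx0, not_le] at hx
            by_cases ht : R' < |t|
            · rw [hR' t ht]; ring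
            · rw [hR (Real.log ‖x‖ - t)]
              · ring
              · have := abs_sub_abs_le_abs_sub (Real.log ‖x‖) t
                linarith
      rw [h1]
      have h2 : Integrable ((ann n (R + R')).indicator D) :=
        (integrable_indicator_iff (isCompact_ann _).measurableSet).2 (hD.int _)
      have h3 : Integrable ξ := hξ.smooth.continuous.integrable_of_hasCompactSupport hξ.cpt
      refine (h3.mul_prod h2).mul_bdd (c := C) ?_ (Eventually.of_forall fun x => by simpa using hC _)
      apply Measurable.aestronglyMeasurable
      exact hζ.smooth.continuous.measurable.comp
        ((measurable_logn.comp measurable_snd).sub measurable_fst)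
  rw [main hζ hξ, main hξ hζ]
  congr 1
  ext x
  congr 1
  rw [← integral_sub_left_eq_self _ _ (Real.log ‖x‖)]
  congr 1
  ext t
  rw [sub_sub_cancel, mul_comm]

/-- Solutions of the second order linear equation. -/
lemma ode_sol {M M' : ℝ → ℝ} {ν : ℝ} (hν : 0 < ν) (h1 : ∀ t, HasDerivAt M (M' t) t)
    (h2 : ∀ t, HasDerivAt M' (ν ^ 2 * M t) t) :
    ∃ a b : ℝ, ∀ t, M t = a * Real.exp (ν * t) + b * Real.exp (-(ν * t)) := by
  have hA : ∀ t, HasDerivAt (fun t => Real.exp (-(ν * t)) * (M' t + ν * M t)) 0 t := by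
    intro t
    have e : HasDerivAt (fun t => Real.exp (-(ν * t))) (Real.exp (-(ν * t)) * (-ν)) t := by
      have : HasDerivAt (fun t => -(ν * t)) (-ν) t := by
        have h := ((hasDerivAt_id t).const_mul ν).neg
        rw [mul_one] at h
        exact h
      exact this.exp
    have := e.mul ((h2 t).add ((h1 t).const_mul ν))
    exact this.congr_deriv (by simp only [Pi.add_apply]; ring)
  have hB : ∀ t, HasDerivAt (fun t => Real.exp (ν * t) * (M' t - ν * M t)) 0 t := by
    intro t
    have e : HasDerivAt (fun t => Real.exp (ν * t)) (Real.exp (ν * t) * ν) t := by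
      have : HasDerivAt (fun t => ν * t) ν t := by
        simpa using (hasDerivAt_id t).const_mul ν
      exact this.exp
    have := e.mul ((h2 t).sub ((h1 t).const_mul ν))
    exact this.congr_deriv (by simp only [Pi.sub_apply]; ring)
  have cA := is_const_of_deriv_eq_zero (fun t => (hA t).differentiableAt) (fun t => (hA t).deriv)
  have cB := is_const_of_deriv_eq_zero (fun t => (hB t).differentiableAt) (fun t => (hB t).deriv)
  refine ⟨(M' 0 + ν * M 0) / (2 * ν), -(M' 0 - ν * M 0) / (2 * ν), fun t => ?_⟩
  have h3 := cA t 0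
  have h4 := cB t 0
  simp at h3 h4
  have hee : Real.exp (ν * t) * Real.exp (-(ν * t)) = 1 := by
    rw [← Real.exp_add]; simp
  rw [← h3, ← h4]
  field_simp
  linear_combination (-2 * ν * M t) * hee

lemma nonneg_of_exp {a b ν : ℝ} (hν : 0 < ν)
    (h : ∀ t, 0 ≤ a * Real.exp (ν * t) + b * Real.exp (-(ν * t))) : 0 ≤ a := by
  have h1 : ∀ t, 0 ≤ a + b * Real.exp (-(2 * ν * t)) := by
    intro t
    have := mul_nonneg (h t) (Real.exp_pos (-(ν * t))).le
    have e1 : Real.exp (ν * t) * Real.exp (-(ν * t)) = 1 := by rw [← Real.exp_add]; simp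
    have e2 : Real.exp (-(ν * t)) * Real.exp (-(ν * t)) = Real.exp (-(2 * ν * t)) := by
      rw [← Real.exp_add]; ring_nf
    rw [← e2]
    calc _ ≤ _ := this
      _ = _ := by linear_combination a * e1
  have h2 : Tendsto (fun t => a + b * Real.exp (-(2 * ν * t))) atTop (𝓝 (a + b * 0)) := by
    apply Tendsto.const_add
    apply Tendsto.const_mul
    apply Real.tendsto_exp_neg_atTop_nhds_zero.comp
    exact tendsto_id.const_mul_atTop (by positivity)
  have := ge_of_tendsto' h2 h1
  simpa using this

lemma exp_growth {a b ν μ C c : ℝ} (hμ : 0 < μ) (hν : μ < ν)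
    (h : ∀ t, |a * Real.exp (ν * t) + b * Real.exp (-(ν * t))|
      ≤ C * Real.exp (μ * t) + c * Real.exp (-(μ * t))) : a = 0 := by
  have h1 : ∀ t, |a| ≤ |b| * Real.exp (-(2 * ν * t)) + C * Real.exp (-((ν - μ) * t))
      + c * Real.exp (-((ν + μ) * t)) := by
    intro t
    have := mul_le_mul_of_nonneg_right (h t) (Real.exp_pos (-(ν * t))).le
    rw [← abs_of_pos (Real.exp_pos (-(ν * t))), ← abs_mul, abs_of_pos (Real.exp_pos (-(ν * t)))]
      at this
    have e1 : Real.exp (ν * t) * Real.exp (-(ν * t)) = 1 := by rw [← Real.exp_add]; simp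
    have e2 : Real.exp (-(ν * t)) * Real.exp (-(ν * t)) = Real.exp (-(2 * ν * t)) := by
      rw [← Real.exp_add]; ring_nf
    have e3 : Real.exp (μ * t) * Real.exp (-(ν * t)) = Real.exp (-((ν - μ) * t)) := by
      rw [← Real.exp_add]; ring_nf
    have e4 : Real.exp (-(μ * t)) * Real.exp (-(ν * t)) = Real.exp (-((ν + μ) * t)) := by
      rw [← Real.exp_add]; ring_nf
    have e5 : (a * Real.exp (ν * t) + b * Real.exp (-(ν * t))) * Real.exp (-(ν * t))
        = a + b * Real.exp (-(2 * ν * t)) := by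
      rw [← e2]; linear_combination a * e1
    rw [e5, add_mul, mul_assoc C, e3, mul_assoc c, e4] at this
    have h6 : |a| ≤ |a + b * Real.exp (-(2 * ν * t))| + |b * Real.exp (-(2 * ν * t))| := by
      have := abs_sub (a + b * Real.exp (-(2 * ν * t))) (b * Real.exp (-(2 * ν * t)))
      simpa using this
    rw [abs_mul b, abs_of_pos (Real.exp_pos _)] at h6
    linarith
  have h2 : ∀ k : ℝ, 0 < k → Tendsto (fun t : ℝ => Real.exp (-(k * t))) atTop (𝓝 0) := by
    intro k hk
    apply Real.tendsto_exp_neg_atTop_nhds_zero.comp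
    exact tendsto_id.const_mul_atTop hk
  have h3 := (((h2 (2 * ν) (by linarith)).const_mul |b|).add
    ((h2 (ν - μ) (by linarith)).const_mul C)).add ((h2 (ν + μ) (by linarith)).const_mul c)
  have := ge_of_tendsto' h3 h1
  simp at this
  exact this

end phi

section main
variable {n : ℕ}

/-- The density appearing in the moments. -/
def DD (i0 : Fin n) (w : EuclideanSpace ℝ (Fin n) → ℝ) (m : Fin n → ℕ) :
    EuclideanSpace ℝ (Fin n) → ℝ :=
  (HH i0).indicator (fun x => w x * mono m x *
    Real.exp (-((((∑ i, m i : ℕ) : ℝ) + ((n : ℝ) + 2) / 2) * Real.log ‖x‖)))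

structure Sol (i0 : Fin n) (γ : ℝ) (w : EuclideanSpace ℝ (Fin n) → ℝ) : Prop where
  reg : ContDiffOn ℝ 2 w (SS i0)
  eqn : ∀ x : EuclideanSpace ℝ (Fin n), 0 < x i0 → lap w x = - ((‖x‖ ^ 2)⁻¹ * γ * w x)
  bd : ∀ x : EuclideanSpace ℝ (Fin n), x i0 = 0 → x ≠ 0 → w x = 0

lemma ne_zero_of_HH {i0 : Fin n} {x : EuclideanSpace ℝ (Fin n)} (hx : 0 < x i0) : x ≠ 0 := by
  rintro rfl
  simp at hx

lemma zero_notMem_HH (i0 : Fin n) : (0 : EuclideanSpace ℝ (Fin n)) ∉ HH i0 := by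
  simp [HH]

lemma continuousOn_logn (s : Set (EuclideanSpace ℝ (Fin n))) (hs : ∀ x ∈ s, x ≠ 0) :
    ContinuousOn (fun x : EuclideanSpace ℝ (Fin n) => Real.log ‖x‖) s :=
  continuous_norm.continuousOn.log (fun x hx => norm_ne_zero_iff.2 (hs x hx))

lemma LI_DD {i0 : Fin n} {w : EuclideanSpace ℝ (Fin n) → ℝ} (hw : ContinuousOn w (SS i0))
    (m : Fin n → ℕ) : LI (DD i0 w m) := by
  refine ⟨indicator_of_notMem (zero_notMem_HH i0) _, fun R => ?_⟩
  unfold IntegrableOn DD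
  rw [integrable_indicator_iff (isOpen_HH i0).measurableSet]
  unfold IntegrableOn
  rw [Measure.restrict_restrict (isOpen_HH i0).measurableSet]
  set K := ann n R ∩ {x : EuclideanSpace ℝ (Fin n) | 0 ≤ x i0}
  have hK : IsCompact K := (isCompact_ann R).inter_right (isClosed_CC i0)
  have hKS : K ⊆ SS i0 := fun x hx => ⟨hx.2, by
    rintro rfl
    exact zero_notMem_ann R hx.1⟩
  have hsub : HH i0 ∩ ann n R ⊆ K := fun x hx => ⟨hx.2, (show (0:ℝ) < x i0 from hx.1).le⟩
  refine IntegrableOn.mono_set (t := K) (ContinuousOn.integrableOn_compact hK ?_) hsub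
  refine ((hw.mono hKS).mul (contDiff_mono m 0).continuous.continuousOn).mul ?_
  exact ((continuousOn_const.mul (continuousOn_logn K (fun x hx => (hKS hx).2))).neg).rexp

lemma contDiffAt_logn {x : EuclideanSpace ℝ (Fin n)} (hx : x ≠ 0) (k : WithTop ℕ∞) :
    ContDiffAt ℝ k (fun x : EuclideanSpace ℝ (Fin n) => Real.log ‖x‖) x :=
  (contDiffAt_norm ℝ hx).log (norm_ne_zero_iff.2 hx)

lemma exp_log2 {x : EuclideanSpace ℝ (Fin n)} (hx : x ≠ 0) :
    Real.exp (-(2 * Real.log ‖x‖)) = (‖x‖ ^ 2)⁻¹ := by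
  have : 0 < ‖x‖ := norm_pos_iff.2 hx
  rw [Real.exp_neg, two_mul, Real.exp_add, Real.exp_log this, sq]

lemma moment_identity {i0 : Fin n} {γ : ℝ} {w : EuclideanSpace ℝ (Fin n) → ℝ}
    (hw : Sol i0 γ w) (m : Fin n → ℕ) (hm : 1 ≤ m i0) {ζ : ℝ → ℝ} (hζ : Tst ζ) :
    Phi (DD i0 w m) (deriv (deriv ζ))
      - (((n : ℝ) / 2 + ((∑ i, m i : ℕ) : ℝ) - 1) ^ 2 - γ) * Phi (DD i0 w m) ζ
      + ∑ i, ((m i : ℝ) * ((m i - 1 : ℕ) : ℝ))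
        * Phi (DD i0 w (Function.update m i (m i - 2))) ζ = 0 := by
  set k : ℝ := ((∑ i, m i : ℕ) : ℝ) with hk
  set b : ℝ := (n : ℝ) / 2 + k - 1 with hb
  set E : ℝ → ℝ := fun s => Real.exp (-(b * s)) * ζ s with hEdef
  set E' : ℝ → ℝ := fun s => Real.exp (-(b * s)) * (deriv ζ s - b * ζ s) with hE'def
  set E'' : ℝ → ℝ := fun s => Real.exp (-(b * s)) *
    (deriv (deriv ζ) s - 2 * b * deriv ζ s + b ^ 2 * ζ s) with hE''def
  have hexp : ∀ s, HasDerivAt (fun s => Real.exp (-(b * s))) (Real.exp (-(b * s)) * (-b)) s := by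
    intro s
    have : HasDerivAt (fun t => -(b * t)) (-b) s := by
      have h := ((hasDerivAt_id s).const_mul b).neg
      rw [mul_one] at h
      exact h
    exact this.exp
  have hE : ∀ s, HasDerivAt E (E' s) s := by
    intro s
    exact ((hexp s).mul (hζ.hasDerivAt s)).congr_deriv (by simp only [E']; ring)
  have hE' : ∀ s, HasDerivAt E' (E'' s) s := by
    intro s
    exact ((hexp s).mul ((hζ.deriv.hasDerivAt s).sub ((hζ.hasDerivAt s).const_mul b))).congr_deriv
      (by simp only [E'', Pi.sub_apply]; ring)
  have hEt : Tst E := hζ.mul_smooth (g := fun s => Real.exp (-(b * s)))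
    ((contDiff_const.mul contDiff_id).neg.exp)
  obtain ⟨R, hR0, hR⟩ := hEt.bdd
  set f : EuclideanSpace ℝ (Fin n) → ℝ := fun y => mono m y * E (Real.log ‖y‖) with hf
  have hm0 : ∀ x : EuclideanSpace ℝ (Fin n), x i0 = 0 → mono m x = 0 := by
    intro x hx
    rw [mono_split m i0, hx, zero_pow (by omega), zero_mul]
  have hsupp : ∀ x, x ∉ ann n R → f x = 0 := by
    intro x hx
    by_cases hx0 : x = 0
    · simp [hf, hm0 x (by simp [hx0])]
    · rw [mem_ann_iff hx0, not_le] at hx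
      simp [hf, hR _ hx]
  have hts : tsupport f ⊆ ann n R := by
    apply closure_minimal _ (isCompact_ann R).isClosed
    intro x hx
    by_contra h
    exact hx (hsupp x h)
  have h0 : (0 : EuclideanSpace ℝ (Fin n)) ∉ tsupport f := fun h => zero_notMem_ann R (hts h)
  have hcs : HasCompactSupport f := (isCompact_ann R).of_isClosed_subset (isClosed_tsupport f) hts
  have hfC : ContDiff ℝ 2 f := by
    rw [contDiff_iff_contDiffAt]
    intro x
    by_cases hx : x = 0
    · have : f =ᶠ[𝓝 x] fun _ => 0 := by
        rw [hx]
        exact notMem_tsupport_iff_eventuallyEq.1 h0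
      exact contDiffAt_const.congr_of_eventuallyEq this
    · apply (contDiff_mono m 2).contDiffAt.mul
      have : ContDiff ℝ 2 E := by exact_mod_cast contDiff_infty.1 hEt.smooth 2
      exact this.contDiffAt.comp x (contDiffAt_logn hx 2)
  have hgreen := green hw.reg hfC hw.bd hcs h0 (fun x hx => by simp [hf, hm0 x hx])
  rw [← integral_indicator (isOpen_HH i0).measurableSet] at hgreen
  have hLI := fun m => LI_DD (i0 := i0) hw.reg.continuousOn m
  have hpt : (HH i0).indicator (fun x => w x * lap f x - f x * lap w x)
      = fun x => (DD i0 w m x * deriv (deriv ζ) (Real.log ‖x‖)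
      - (b ^ 2 - γ) * (DD i0 w m x * ζ (Real.log ‖x‖)))
      + ∑ i, ((m i : ℝ) * ((m i - 1 : ℕ) : ℝ))
        * (DD i0 w (Function.update m i (m i - 2)) x * ζ (Real.log ‖x‖)) := by
    ext x
    by_cases hx : x ∈ HH i0
    swap
    · simp [DD, indicator_of_notMem hx]
    have hx' : 0 < x i0 := hx
    have hx0 := ne_zero_of_HH hx'
    rw [indicator_of_mem hx, hf,
      lap_mul_radial (contDiff_mono m 2) k (euler_mono m) hE hE' hx0, hw.eqn x hx', lap_mono]
    have e1 : ∀ i, ((m i : ℝ) * ((m i - 1 : ℕ) : ℝ))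
        * (DD i0 w (Function.update m i (m i - 2)) x * ζ (Real.log ‖x‖))
        = w x * E (Real.log ‖x‖) * (((m i : ℝ) * ((m i - 1 : ℕ) : ℝ))
          * mono (Function.update m i (m i - 2)) x) := by
      intro i
      by_cases hi : 2 ≤ m i
      · have hsum : ((∑ j, Function.update m i (m i - 2) j : ℕ) : ℝ) = k - 2 := by
          rw [hk, Finset.sum_update_of_mem (Finset.mem_univ i),
            ← Finset.add_sum_erase _ _ (Finset.mem_univ i), Finset.sdiff_singleton_eq_erase]
          push_cast [Nat.cast_sub hi]
          ring
        simp only [DD, indicator_of_mem hx, hsum, hEdef]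
        have : k - 2 + ((n:ℝ) + 2) / 2 = b := by rw [hb]; ring
        rw [this]
        ring
      · have : (m i : ℝ) * ((m i - 1 : ℕ) : ℝ) = 0 := by
          have : m i = 0 ∨ m i = 1 := by omega
          rcases this with h | h <;> simp [h]
        rw [this]; ring
    simp only [e1, ← Finset.mul_sum]
    have e2 : DD i0 w m x = w x * mono m x * (Real.exp (-(b * Real.log ‖x‖)) * (‖x‖ ^ 2)⁻¹) := by
      simp only [DD, indicator_of_mem hx]
      rw [← exp_log2 hx0, ← Real.exp_add, ← hk, hb]
      congr 2
      ring
    rw [e2]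
    simp only [hEdef, hE'def, hE''def]
    have : (n : ℝ) - 2 + 2 * k = 2 * b := by rw [hb]; ring
    rw [this]
    ring
  rw [hpt, integral_add, integral_sub, integral_const_mul, integral_finsetSum] at hgreen
  · simp only [integral_const_mul] at hgreen
    exact hgreen
  · intro i _
    exact ((hLI _).integrable_tst hζ).const_mul _
  · exact (hLI _).integrable_tst hζ.deriv.deriv
  · exact ((hLI _).integrable_tst hζ).const_mul _
  · exact ((hLI _).integrable_tst hζ.deriv.deriv).sub (((hLI _).integrable_tst hζ).const_mul _)
  · exact integrable_finsetSum _ fun i _ => ((hLI _).integrable_tst hζ).const_mul _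

lemma moment_ode {i0 : Fin n} {γ : ℝ} {w : EuclideanSpace ℝ (Fin n) → ℝ}
    (hw : Sol i0 γ w) (m : Fin n → ℕ) (hm : 1 ≤ m i0)
    (hlow : ∀ i, 2 ≤ m i → ∀ ζ : ℝ → ℝ, Tst ζ → (∀ s, 0 ≤ ζ s) →
      Phi (DD i0 w (Function.update m i (m i - 2))) ζ = 0)
    {ν : ℝ} (hν : 0 < ν) (hν2 : ν ^ 2 = ((n : ℝ) / 2 + ((∑ i, m i : ℕ) : ℝ) - 1) ^ 2 - γ)
    {ζ : ℝ → ℝ} (hζ : Tst ζ) (hpos : ∀ s, 0 ≤ ζ s) :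
    ∃ a b : ℝ, ∀ t, Phi (DD i0 w m) (fun s => ζ (s - t))
      = a * Real.exp (ν * t) + b * Real.exp (-(ν * t)) := by
  have hLI := LI_DD (i0 := i0) hw.reg.continuousOn m
  refine ode_sol hν (fun t => Phi_hasDerivAt hLI hζ t) (fun t => ?_)
  have h := (Phi_hasDerivAt hLI hζ.deriv t).neg
  refine h.congr_deriv ?_
  rw [neg_neg]
  have hid := moment_identity hw m hm (hζ.shift t)
  have hd : deriv (deriv fun s => ζ (s - t)) = fun s => deriv (deriv ζ) (s - t) := by
    have h1 : deriv (fun s => ζ (s - t)) = fun s => deriv ζ (s - t) := by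
      ext s; rw [deriv_comp_sub_const]
    rw [h1]
    ext s; rw [deriv_comp_sub_const]
  rw [hd, ← hν2] at hid
  have hz : ∑ i, ((m i : ℝ) * ((m i - 1 : ℕ) : ℝ))
        * Phi (DD i0 w (Function.update m i (m i - 2))) (fun s => ζ (s - t)) = 0 := by
    apply Finset.sum_eq_zero
    intro i _
    by_cases hi : 2 ≤ m i
    · rw [hlow i hi _ (hζ.shift t) (fun s => hpos _), mul_zero]
    · have : m i = 0 ∨ m i = 1 := by omega
      rcases this with h | h <;> simp [h]
  rw [hz] at hid
  linarith

end main

section main2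
variable {n : ℕ}

/-- explicit solution -/
def fs (i0 : Fin n) (α : ℝ) (x : EuclideanSpace ℝ (Fin n)) : ℝ :=
  x i0 * Real.exp (-(α * Real.log ‖x‖))

lemma mono_single (i0 : Fin n) (x : EuclideanSpace ℝ (Fin n)) :
    mono (Pi.single i0 1) x = x i0 := by
  rw [mono_split _ i0]
  rw [Finset.prod_eq_one]
  · simp
  · intro j hj
    simp [Finset.ne_of_mem_erase hj]

lemma Sol_fs (i0 : Fin n) {γ α : ℝ} (hα : α ^ 2 - n * α + γ = 0) : Sol i0 γ (fs i0 α) := by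
  have hfs : fs i0 α = fun x => mono (Pi.single i0 1) x * Real.exp (-(α * Real.log ‖x‖)) := by
    ext x; rw [mono_single]; rfl
  refine ⟨?_, ?_, ?_⟩
  · intro x hx
    apply ContDiffAt.contDiffWithinAt
    rw [hfs]
    exact (contDiff_mono _ 2).contDiffAt.mul ((contDiffAt_const.mul (contDiffAt_logn hx.2 2)).neg.exp)
  · intro x hx
    have hx0 := ne_zero_of_HH hx
    have hexp : ∀ s, HasDerivAt (fun s => Real.exp (-(α * s))) ((-α) * Real.exp (-(α * s))) s := by
      intro s
      have : HasDerivAt (fun t => -(α * t)) (-α) s := by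
        have h := ((hasDerivAt_id s).const_mul α).neg
        rw [mul_one] at h
        exact h
      exact this.exp.congr_deriv (by ring)
    rw [hfs, lap_mul_radial (contDiff_mono _ 2) _ (euler_mono _)
      (E := fun s => Real.exp (-(α * s))) hexp (fun s => (hexp s).const_mul (-α)) hx0, lap_mono]
    have h1 : ∑ i, (((Pi.single i0 1 : Fin n → ℕ) i : ℝ) *
        (((Pi.single i0 1 : Fin n → ℕ) i - 1 : ℕ) : ℝ)) * mono (Function.update
          (Pi.single i0 1 : Fin n → ℕ) i ((Pi.single i0 1 : Fin n → ℕ) i - 2)) x = 0 := by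
      apply Finset.sum_eq_zero
      intro i _
      by_cases hi : i = i0
      · subst hi; simp
      · simp [hi]
    have h2 : ((∑ i, (Pi.single i0 1 : Fin n → ℕ) i : ℕ) : ℝ) = 1 := by simp
    rw [h1, h2]
    linear_combination ((‖x‖ ^ 2)⁻¹ * mono (Pi.single i0 1) x * Real.exp (-(α * Real.log ‖x‖))) * hα
  · intro x hx _
    simp [fs, hx]

lemma Sol.sub_smul {i0 : Fin n} {γ : ℝ} {w v : EuclideanSpace ℝ (Fin n) → ℝ}
    (hw : Sol i0 γ w) (hv : Sol i0 γ v) (c : ℝ) : Sol i0 γ (fun x => w x - c * v x) := by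
  refine ⟨hw.reg.sub (contDiffOn_const.mul hv.reg), ?_, ?_⟩
  · intro x hx
    have hC : ∀ {w : EuclideanSpace ℝ (Fin n) → ℝ}, Sol i0 γ w → ∀ y, 0 < y i0 →
        ContDiffAt ℝ 2 w y := fun hw y hy => hw.reg.contDiffAt (SS_nhds hy)
    have key : lap (fun x => w x - c * v x) x = lap w x - c * lap v x := by
      unfold lap
      rw [Finset.mul_sum, ← Finset.sum_sub_distrib]
      refine Finset.sum_congr rfl fun i _ => ?_
      have h1 : (fun y => fderiv ℝ (fun x => w x - c * v x) y (EuclideanSpace.single i 1))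
          =ᶠ[𝓝 x] fun y => fderiv ℝ w y (EuclideanSpace.single i 1)
            - c * fderiv ℝ v y (EuclideanSpace.single i 1) := by
        filter_upwards [(isOpen_HH i0).mem_nhds hx] with y hy
        have d1 := (hC hw y hy).differentiableAt (by norm_num)
        have d2 := (hC hv y hy).differentiableAt (by norm_num)
        have := (d1.hasFDerivAt.sub (d2.hasFDerivAt.const_mul c)).fderiv
        erw [this]
        simp
      rw [h1.fderiv_eq]
      have hD : ∀ {w : EuclideanSpace ℝ (Fin n) → ℝ}, Sol i0 γ w →
          DifferentiableAt ℝ (fun y => fderiv ℝ w y (EuclideanSpace.single i 1)) x := by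
        intro w hw
        have h : ContDiffAt ℝ 1 (fderiv ℝ w) x :=
          (hC hw x hx).fderiv_right (by norm_num [one_add_one_eq_two])
        exact (h.clm_apply contDiffAt_const).differentiableAt (by norm_num)
      have := ((hD hw).hasFDerivAt.sub ((hD hv).hasFDerivAt.const_mul c)).fderiv
      erw [this]
      simp
    rw [key, hw.eqn x hx, hv.eqn x hx]
    ring
  · intro x hx hx0
    simp [hw.bd x hx hx0, hv.bd x hx hx0]

lemma Phi_fs_shift (i0 : Fin n) (α : ℝ) (ζ : ℝ → ℝ) (t : ℝ) :
    Phi (DD i0 (fs i0 α) (Pi.single i0 1)) (fun s => ζ (s - t))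
      = Real.exp (((n : ℝ) / 2 - α) * t) * Phi (DD i0 (fs i0 α) (Pi.single i0 1)) ζ := by
  unfold Phi
  have h := Measure.integral_comp_smul (volume : Measure (EuclideanSpace ℝ (Fin n)))
    (fun x => DD i0 (fs i0 α) (Pi.single i0 1) x * ζ (Real.log ‖x‖ - t)) (Real.exp t)
  have hfr : Module.finrank ℝ (EuclideanSpace ℝ (Fin n)) = n := by simp
  have hpos : 0 < ((Real.exp t) ^ n)⁻¹ := by positivity
  rw [hfr, abs_of_pos hpos, smul_eq_mul] at h
  have h2 : (fun x : EuclideanSpace ℝ (Fin n) => DD i0 (fs i0 α) (Pi.single i0 1) (Real.exp t • x)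
      * ζ (Real.log ‖Real.exp t • x‖ - t))
      = fun x => Real.exp ((2 - α - 1 - ((n : ℝ) + 2) / 2) * t) *
        (DD i0 (fs i0 α) (Pi.single i0 1) x * ζ (Real.log ‖x‖)) := by
    ext x
    by_cases hx : x ∈ HH i0
    · have hx' : 0 < x i0 := hx
      have hx0 := ne_zero_of_HH hx'
      have hxt : Real.exp t • x ∈ HH i0 := by
        show 0 < (Real.exp t • x) i0
        simp
        positivity
      have hl : Real.log ‖Real.exp t • x‖ = t + Real.log ‖x‖ := by
        rw [norm_smul, Real.norm_eq_abs, abs_of_pos (Real.exp_pos t),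
          Real.log_mul (Real.exp_pos t).ne' (norm_ne_zero_iff.2 hx0), Real.log_exp]
      simp only [DD, indicator_of_mem hx, indicator_of_mem hxt, mono_single, fs, hl]
      rw [add_sub_cancel_left]
      simp only [PiLp.smul_apply, smul_eq_mul]
      have e : Real.exp t * Real.exp t * Real.exp (-(α * (t + Real.log ‖x‖))) *
        Real.exp (-((((∑ i, (Pi.single i0 1 : Fin n → ℕ) i : ℕ) : ℝ) + ((n : ℝ) + 2) / 2)
          * (t + Real.log ‖x‖)))
        = Real.exp ((2 - α - 1 - ((n : ℝ) + 2) / 2) * t) * (Real.exp (-(α * Real.log ‖x‖)) *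
        Real.exp (-((((∑ i, (Pi.single i0 1 : Fin n → ℕ) i : ℕ) : ℝ) + ((n : ℝ) + 2) / 2)
          * Real.log ‖x‖))) := by
        simp only [← Real.exp_add]
        congr 1
        have h2 : ((∑ i, (Pi.single i0 1 : Fin n → ℕ) i : ℕ) : ℝ) = 1 := by simp
        rw [h2]
        ring
      linear_combination (x i0 ^ 2 * ζ (Real.log ‖x‖)) * e
    · have hxt : Real.exp t • x ∉ HH i0 := by
        intro h
        apply hx
        have h1 : 0 < (Real.exp t • x) i0 := h
        simp only [PiLp.smul_apply, smul_eq_mul] at h1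
        exact (mul_pos_iff_of_pos_left (Real.exp_pos t)).1 h1
      simp only [DD, indicator_of_notMem hx, indicator_of_notMem hxt]
      ring
  rw [h2, integral_const_mul] at h
  have h3 : ((Real.exp t) ^ n) * (((Real.exp t) ^ n)⁻¹ *
      ∫ x, DD i0 (fs i0 α) (Pi.single i0 1) x * ζ (Real.log ‖x‖ - t))
      = ∫ x, DD i0 (fs i0 α) (Pi.single i0 1) x * ζ (Real.log ‖x‖ - t) := by
    field_simp
  rw [← h3, ← h, ← mul_assoc, ← Real.exp_nat_mul, ← Real.exp_add]
  congr 2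
  ring

/-- A standard bump. -/
lemma exists_bump (R : ℝ) (hR : 0 < R) : ∃ ζ : ℝ → ℝ, Tst ζ ∧ (∀ s, 0 ≤ ζ s) ∧
    ∀ s, |s| < R → 0 < ζ s := by
  let B : ContDiffBump (0 : ℝ) := ⟨R / 2, R, by positivity, by linarith⟩
  refine ⟨B, ⟨B.contDiff, B.hasCompactSupport⟩, fun s => B.nonneg, fun s hs => ?_⟩
  apply B.pos_of_mem_ball
  simpa using hs

lemma DD_nonneg {i0 : Fin n} {w : EuclideanSpace ℝ (Fin n) → ℝ}
    (hw : ∀ x : EuclideanSpace ℝ (Fin n), 0 < x i0 → 0 ≤ w x)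
    (x : EuclideanSpace ℝ (Fin n)) : 0 ≤ DD i0 w (Pi.single i0 1) x := by
  apply indicator_nonneg
  intro x hx
  have hx' : 0 < x i0 := hx
  rw [mono_single]
  have := hw x hx'
  positivity

lemma Phi_nonneg {i0 : Fin n} {w : EuclideanSpace ℝ (Fin n) → ℝ}
    (hw : ∀ x : EuclideanSpace ℝ (Fin n), 0 < x i0 → 0 ≤ w x) {ζ : ℝ → ℝ} (hζ : ∀ s, 0 ≤ ζ s) :
    0 ≤ Phi (DD i0 w (Pi.single i0 1)) ζ :=
  integral_nonneg fun x => mul_nonneg (DD_nonneg hw x) (hζ _)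

lemma continuousOn_fs (i0 : Fin n) (α : ℝ) : ContinuousOn (fs i0 α) (SS i0) := by
  have h : ContinuousOn (fun x : EuclideanSpace ℝ (Fin n) => x i0) (SS i0) := by fun_prop
  exact h.mul ((continuousOn_const.mul (continuousOn_logn _ (fun x hx => hx.2))).neg).rexp

lemma isOpen_annulus (i0 : Fin n) (R : ℝ) :
    IsOpen (HH i0 ∩ {x : EuclideanSpace ℝ (Fin n) | |Real.log ‖x‖| < R}) := by
  have : ContinuousOn (fun x : EuclideanSpace ℝ (Fin n) => |Real.log ‖x‖|) (HH i0) :=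
    (continuousOn_logn _ (fun x hx => ne_zero_of_HH (i0 := i0) hx)).abs
  exact this.isOpen_inter_preimage (isOpen_HH i0) (isOpen_Iio (a := R))

lemma Phi_fs_pos (i0 : Fin n) (α : ℝ) {ζ : ℝ → ℝ} (hζ : Tst ζ) (h0 : ∀ s, 0 ≤ ζ s)
    (h1 : ∀ s, |s| < 1 → 0 < ζ s) : 0 < Phi (DD i0 (fs i0 α) (Pi.single i0 1)) ζ := by
  have hfs : ∀ x : EuclideanSpace ℝ (Fin n), 0 < x i0 → 0 < fs i0 α x := by
    intro x hx
    unfold fs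
    positivity
  unfold Phi
  rw [integral_pos_iff_support_of_nonneg
    (fun x => mul_nonneg (DD_nonneg (fun x hx => (hfs x hx).le) x) (h0 _))
    ((LI_DD (continuousOn_fs i0 α) _).integrable_tst hζ)]
  refine lt_of_lt_of_le ((isOpen_annulus i0 1).measure_pos volume ?_) (measure_mono ?_)
  · refine ⟨EuclideanSpace.single i0 1, ?_, ?_⟩
    · simp [HH]
    · simp
  · rintro x ⟨hx, hx2⟩
    have hx' : 0 < x i0 := hx
    have a1 := hfs x hx'
    have a2 := h1 _ hx2
    simp only [Function.mem_support, DD, indicator_of_mem hx, mono_single]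
    positivity

end main2

section main3
variable {n : ℕ}

/-- Generators of the approximating algebra. -/
def genf (i0 i : Fin n) (x : EuclideanSpace ℝ (Fin n)) : ℝ := if i = i0 then x i ^ 2 else x i

lemma continuous_genf (i0 i : Fin n) : Continuous (genf i0 i) := by
  unfold genf
  split_ifs <;> fun_prop

lemma density {i0 : Fin n} {d : EuclideanSpace ℝ (Fin n) → ℝ} (hd : ContinuousOn d (SS i0))
    (hmom : ∀ m : Fin n → ℕ, Odd (m i0) → ∀ ζ : ℝ → ℝ, Tst ζ → (∀ s, 0 ≤ ζ s) →
      Phi (DD i0 d m) ζ = 0) (x₀ : EuclideanSpace ℝ (Fin n)) (hx₀ : 0 < x₀ i0) : d x₀ = 0 := by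
  obtain ⟨η, hη, hη0, hη1⟩ := exists_bump (|Real.log ‖x₀‖| + 1) (by positivity)
  obtain ⟨R, hR0, hR⟩ := hη.bdd
  set X : EuclideanSpace ℝ (Fin n) → ℝ :=
    (HH i0).indicator (fun x => d x * x i0 * η (Real.log ‖x‖)) with hX
  set K := ann n R ∩ {x : EuclideanSpace ℝ (Fin n) | 0 ≤ x i0} with hKdef
  have hK : IsCompact K := (isCompact_ann R).inter_right (isClosed_CC i0)
  have hKS : K ⊆ SS i0 := fun x hx => ⟨hx.2, by
    rintro rfl
    exact zero_notMem_ann R hx.1⟩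
  have hXK : ∀ x, x ∉ K → X x = 0 := by
    intro x hx
    by_cases hxH : x ∈ HH i0
    · rw [hX, indicator_of_mem hxH]
      have hx' : 0 < x i0 := hxH
      have h1 : x ∉ ann n R := fun h => hx ⟨h, hx'.le⟩
      rw [mem_ann_iff (ne_zero_of_HH hx'), not_le] at h1
      rw [hR _ h1, mul_zero]
    · rw [hX, indicator_of_notMem hxH]
  -- weighted test functions
  have htst : ∀ c : ℝ, Tst (fun s => Real.exp (c * s) * η s) := fun c =>
    hη.mul_smooth (g := fun s => Real.exp (c * s)) ((contDiff_const.mul contDiff_id).exp)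
  have hDDX : ∀ (v : EuclideanSpace ℝ (Fin n) → ℝ) (m : Fin n → ℕ) (x : EuclideanSpace ℝ (Fin n)),
      DD i0 v m x * (Real.exp ((((∑ i, m i : ℕ) : ℝ) + ((n : ℝ) + 2) / 2) * Real.log ‖x‖)
        * η (Real.log ‖x‖)) = (HH i0).indicator (fun x => v x * mono m x * η (Real.log ‖x‖)) x := by
    intro v m x
    by_cases hxH : x ∈ HH i0
    · simp only [DD, indicator_of_mem hxH, Real.exp_neg]
      field_simp
    · simp only [DD, indicator_of_notMem hxH, zero_mul]
  have hintv : ∀ (v : EuclideanSpace ℝ (Fin n) → ℝ) (_ : ContinuousOn v (SS i0)) (m : Fin n → ℕ),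
      Integrable ((HH i0).indicator (fun x => v x * mono m x * η (Real.log ‖x‖))) := by
    intro v hv m
    have := (LI_DD hv m).integrable_tst (htst (((∑ i, m i : ℕ) : ℝ) + ((n : ℝ) + 2) / 2))
    exact this.congr (Eventually.of_forall fun x => hDDX v m x)
  have hXint : Integrable X := by
    have := hintv d hd (Pi.single i0 1)
    simpa only [mono_single] using this
  -- monomials
  have hsplit : ∀ (s : Fin n → ℕ) (x : EuclideanSpace ℝ (Fin n)),
      X x * ∏ i, genf i0 i x ^ s i = (HH i0).indicator (fun x => d x *
        mono (fun i => if i = i0 then 2 * s i + 1 else s i) x * η (Real.log ‖x‖)) x := by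
    intro s x
    by_cases hxH : x ∈ HH i0
    · simp only [hX, indicator_of_mem hxH]
      have h1 : mono (fun i => if i = i0 then 2 * s i + 1 else s i) x
          = x i0 * ∏ i, genf i0 i x ^ s i := by
        rw [mono_split _ i0, ← Finset.mul_prod_erase _ _ (Finset.mem_univ i0), ← mul_assoc]
        congr 1
        · simp [genf]; ring
        · refine Finset.prod_congr rfl fun j hj => ?_
          simp [genf, Finset.ne_of_mem_erase hj]
      rw [h1]; ring
    · simp only [hX, indicator_of_notMem hxH, zero_mul]
  have hPint : ∀ P : MvPolynomial (Fin n) ℝ,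
      Integrable (fun x => X x * MvPolynomial.eval (fun i => genf i0 i x) P) ∧
      ∫ x, X x * MvPolynomial.eval (fun i => genf i0 i x) P = 0 := by
    intro P
    have e : (fun x => X x * MvPolynomial.eval (fun i => genf i0 i x) P)
        = fun x => ∑ s ∈ P.support, P.coeff s * (HH i0).indicator (fun x => d x *
        mono (fun i => if i = i0 then 2 * s i + 1 else s i) x * η (Real.log ‖x‖)) x := by
      ext x
      rw [MvPolynomial.eval_eq', Finset.mul_sum]
      refine Finset.sum_congr rfl fun s _ => ?_
      rw [← hsplit]
      ring
    rw [e]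
    have hi : ∀ s ∈ P.support, Integrable (fun x => P.coeff s * (HH i0).indicator (fun x => d x *
        mono (fun i => if i = i0 then 2 * s i + 1 else s i) x * η (Real.log ‖x‖)) x) :=
      fun s _ => (hintv d hd _).const_mul _
    refine ⟨integrable_finsetSum _ hi, ?_⟩
    rw [integral_finsetSum _ hi]
    refine Finset.sum_eq_zero fun s _ => ?_
    rw [integral_const_mul]
    set m : Fin n → ℕ := fun i => if i = i0 then 2 * s i + 1 else s i with hm
    have := hmom m (by simp [hm]) _ (htst (((∑ i, m i : ℕ) : ℝ) + ((n : ℝ) + 2) / 2))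
      (fun s => mul_nonneg (Real.exp_pos _).le (hη0 s))
    unfold Phi at this
    simp only [hDDX] at this
    rw [this, mul_zero]
  -- approximation
  have : CompactSpace K := isCompact_iff_compactSpace.1 hK
  let gen : Fin n → C(K, ℝ) := fun i => ⟨fun x => genf i0 i x.1,
    (continuous_genf i0 i).comp continuous_subtype_val⟩
  let A : Subalgebra ℝ C(K, ℝ) := (MvPolynomial.aeval (R := ℝ) gen).range
  have hgen : ∀ i, gen i ∈ A := fun i => ⟨MvPolynomial.X i, by simp⟩
  have hsep : A.SeparatesPoints := by
    intro x y hxy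
    have : ∃ i, x.1 i ≠ y.1 i := by
      by_contra h
      push Not at h
      apply hxy
      apply Subtype.ext
      ext i
      exact h i
    obtain ⟨i, hi⟩ := this
    refine ⟨gen i, ⟨gen i, hgen i, rfl⟩, ?_⟩
    show genf i0 i x.1 ≠ genf i0 i y.1
    unfold genf
    split_ifs with h
    · subst h
      intro h2
      have hx1 : 0 ≤ x.1 i := x.2.2
      have hy1 : 0 ≤ y.1 i := y.2.2
      exact hi ((pow_left_inj₀ hx1 hy1 (by norm_num)).1 h2)
    · exact hi
  have htop := ContinuousMap.subalgebra_topologicalClosure_eq_top_of_separatesPoints A hsep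
  let dK : C(K, ℝ) := ⟨fun x => d x.1, (hd.mono hKS).restrict⟩
  have happ : ∀ ε > 0, ∃ P : MvPolynomial (Fin n) ℝ, ∀ x ∈ K,
      |d x - MvPolynomial.eval (fun i => genf i0 i x) P| ≤ ε := by
    intro ε hε
    have hmem : dK ∈ A.topologicalClosure := by rw [htop]; trivial
    have hmem' : dK ∈ closure (A : Set C(K, ℝ)) := hmem
    obtain ⟨g, ⟨P, hP⟩, hg⟩ := Metric.mem_closure_iff.1 hmem' ε hε
    refine ⟨P, fun x hx => ?_⟩
    have h1 := (ContinuousMap.dist_lt_iff hε).1 hg ⟨x, hx⟩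
    rw [Real.dist_eq] at h1
    have h2 : g ⟨x, hx⟩ = MvPolynomial.eval (fun i => genf i0 i x) P := by
      rw [← hP]
      have := MvPolynomial.map_aeval gen
        ((ContinuousMap.evalAlgHom ℝ ℝ (⟨x, hx⟩ : K)) : C(K, ℝ) →+* ℝ) P
      have h3 : ((ContinuousMap.evalAlgHom ℝ ℝ (⟨x, hx⟩ : K)) : C(K, ℝ) →+* ℝ).comp
          (algebraMap ℝ C(K, ℝ)) = RingHom.id ℝ :=
        Subsingleton.elim _ _
      rw [h3] at this
      exact this
    rw [← h2]
    exact h1.le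
  have hddint : Integrable (fun x => X x * d x) := by
    have := hintv (fun x => d x * d x) (hd.mul hd) (Pi.single i0 1)
    refine this.congr (Eventually.of_forall fun x => ?_)
    simp only [mono_single]
    by_cases hxH : x ∈ HH i0
    · simp only [hX, indicator_of_mem hxH]; ring
    · simp only [hX, indicator_of_notMem hxH, zero_mul]
  have hle : ∀ ε > 0, |∫ x, X x * d x| ≤ ε * ∫ x, |X x| := by
    intro ε hε
    obtain ⟨P, hP⟩ := happ ε hε
    obtain ⟨hP1, hP2⟩ := hPint P
    have e1 : ∫ x, X x * d x = ∫ x, (X x * d x - X x * MvPolynomial.eval (fun i => genf i0 i x) P) := by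
      rw [integral_sub hddint hP1, hP2, sub_zero]
    rw [e1, ← integral_const_mul, ← Real.norm_eq_abs]
    apply norm_integral_le_of_norm_le (hXint.abs.const_mul ε)
    refine Eventually.of_forall fun x => ?_
    by_cases hx : x ∈ K
    · rw [← mul_sub, Real.norm_eq_abs, abs_mul, mul_comm]
      exact mul_le_mul_of_nonneg_right (hP x hx) (abs_nonneg _)
    · simp [hXK x hx]
  have hzero : ∫ x, X x * d x = 0 := by
    rw [← abs_eq_zero]
    apply le_antisymm _ (abs_nonneg _)
    have h1 : Tendsto (fun ε : ℝ => ε * ∫ x, |X x|) (𝓝[>] 0) (𝓝 (0 * ∫ x, |X x|)) :=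
      (tendsto_id.mono_left nhdsWithin_le_nhds).mul_const _
    rw [zero_mul] at h1
    refine ge_of_tendsto h1 ?_
    filter_upwards [self_mem_nhdsWithin] with ε hε
    exact hle ε hε
  have hnn : ∀ x, 0 ≤ X x * d x := by
    intro x
    by_cases hxH : x ∈ HH i0
    · simp only [hX, indicator_of_mem hxH]
      have hx' : 0 < x i0 := hxH
      have := mul_nonneg (mul_nonneg (mul_self_nonneg (d x)) hx'.le) (hη0 (Real.log ‖x‖))
      nlinarith
    · simp only [hX, indicator_of_notMem hxH, zero_mul, le_refl]
  rw [integral_eq_zero_iff_of_nonneg hnn hddint] at hzero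
  have heqOn : EqOn (fun x => d x * x i0 * η (Real.log ‖x‖) * d x) (fun _ => 0) (HH i0) := by
    refine Measure.eqOn_open_of_ae_eq (μ := volume) ?_ (isOpen_HH i0) ?_ continuousOn_const
    · filter_upwards [ae_restrict_of_ae hzero, ae_restrict_mem (isOpen_HH i0).measurableSet]
        with x hx hxH
      simp only [hX, indicator_of_mem hxH] at hx
      exact hx
    · have c1 := hd.mono (HH_sub_SS i0)
      have c2 : ContinuousOn (fun x : EuclideanSpace ℝ (Fin n) => x i0) (HH i0) := by fun_prop
      have c3 : ContinuousOn (fun x : EuclideanSpace ℝ (Fin n) => η (Real.log ‖x‖)) (HH i0) :=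
        hη.smooth.continuous.comp_continuousOn
          (continuousOn_logn _ (fun x hx => ne_zero_of_HH (i0 := i0) hx))
      exact ((c1.mul c2).mul c3).mul c1
  have hfin := heqOn (show x₀ ∈ HH i0 from hx₀)
  have hηp := hη1 (Real.log ‖x₀‖) (by linarith)
  simp only at hfin
  by_contra hne
  have : d x₀ * x₀ i0 * η (Real.log ‖x₀‖) * d x₀ ≠ 0 := by positivity
  exact this hfin

end main3

section main4
variable {n : ℕ}

lemma Phi_sub_smul {i0 : Fin n} {w v : EuclideanSpace ℝ (Fin n) → ℝ}
    (hw : ContinuousOn w (SS i0)) (hv : ContinuousOn v (SS i0)) (c : ℝ) (m : Fin n → ℕ)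
    {ζ : ℝ → ℝ} (hζ : Tst ζ) :
    Phi (DD i0 (fun x => w x - c * v x) m) ζ
      = Phi (DD i0 w m) ζ - c * Phi (DD i0 v m) ζ := by
  unfold Phi
  rw [← integral_const_mul, ← integral_sub ((LI_DD hw m).integrable_tst hζ)
    (((LI_DD hv m).integrable_tst hζ).const_mul c)]
  congr 1
  ext x
  unfold DD
  by_cases hx : x ∈ HH i0
  · simp only [indicator_of_mem hx]; ring
  · simp only [indicator_of_notMem hx]; ring

lemma Phi_dom {i0 : Fin n} {d W : EuclideanSpace ℝ (Fin n) → ℝ}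
    (hW : ContinuousOn W (SS i0)) (hdW : ∀ x : EuclideanSpace ℝ (Fin n), 0 < x i0 → |d x| ≤ W x)
    (m : Fin n → ℕ) (hm : 1 ≤ m i0) {ζ : ℝ → ℝ} (hζ : Tst ζ) (h0 : ∀ s, 0 ≤ ζ s) :
    |Phi (DD i0 d m) ζ| ≤ Phi (DD i0 W (Pi.single i0 1)) ζ := by
  unfold Phi
  rw [← Real.norm_eq_abs]
  apply norm_integral_le_of_norm_le ((LI_DD hW _).integrable_tst hζ)
  refine Eventually.of_forall fun x => ?_
  rw [Real.norm_eq_abs, abs_mul, abs_of_nonneg (h0 _)]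
  refine mul_le_mul_of_nonneg_right ?_ (h0 _)
  unfold DD
  by_cases hx : x ∈ HH i0
  · have hx' : 0 < x i0 := hx
    have hn0 : 0 < ‖x‖ := norm_pos_iff.2 (ne_zero_of_HH hx')
    simp only [indicator_of_mem hx, mono_single]
    rw [abs_mul, abs_mul, Real.abs_exp]
    have hk : 1 ≤ ∑ i, m i := hm.trans (Finset.single_le_sum (f := m) (fun _ _ => Nat.zero_le _)
      (Finset.mem_univ i0))
    have h1 := abs_mono_le m i0 hm x
    rw [abs_of_pos hx'] at h1
    have hs : ∑ i, (Pi.single i0 1 : Fin n → ℕ) i = 1 := by simp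
    rw [hs]
    have e : ‖x‖ ^ (∑ i, m i - 1) * Real.exp (-((((∑ i, m i : ℕ) : ℝ) + ((n : ℝ) + 2) / 2) * Real.log ‖x‖))
        = Real.exp (-((((1 : ℕ) : ℝ) + ((n : ℝ) + 2) / 2) * Real.log ‖x‖)) := by
      nth_rewrite 1 [← Real.exp_log hn0]
      rw [← Real.exp_nat_mul, ← Real.exp_add, Nat.cast_sub hk]
      congr 1
      ring
    rw [← e]
    calc _ ≤ W x * (x i0 * ‖x‖ ^ (∑ i, m i - 1)) * Real.exp (-((((∑ i, m i : ℕ) : ℝ) + ((n : ℝ) + 2) / 2) * Real.log ‖x‖)) := by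
          refine mul_le_mul_of_nonneg_right ?_ (Real.exp_pos _).le
          exact mul_le_mul (hdW x hx') h1 (abs_nonneg _) ((abs_nonneg _).trans (hdW x hx'))
      _ = _ := by ring
  · simp only [indicator_of_notMem hx]; simp

lemma int_exp_pos {ζ : ℝ → ℝ} (hζ : Tst ζ) (h0 : ∀ s, 0 ≤ ζ s)
    (h1 : ∀ s, |s| < 1 → 0 < ζ s) (κ : ℝ) :
    0 < ∫ t, Real.exp (κ * t) * ζ t := by
  have hc : Continuous fun t => Real.exp (κ * t) * ζ t :=
    (by fun_prop : Continuous fun t => Real.exp (κ * t)).mul hζ.smooth.continuous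
  refine hc.integral_pos_of_hasCompactSupport_nonneg_nonzero hζ.cpt.mul_left
    (fun t => mul_nonneg (Real.exp_pos _).le (h0 t)) (x := 0) ?_
  have := h1 0 (by simp)
  simp [this.ne']

/-- If the moments against all translates of one bump vanish, all moments vanish. -/
lemma Phi_all_zero {D : EuclideanSpace ℝ (Fin n) → ℝ} (hD : LI D) {ζ₀ : ℝ → ℝ} (hζ₀ : Tst ζ₀)
    (h0 : ∀ s, 0 ≤ ζ₀ s) (h1 : ∀ s, |s| < 1 → 0 < ζ₀ s)
    (hz : ∀ t, Phi D (fun s => ζ₀ (s - t)) = 0) {ζ : ℝ → ℝ} (hζ : Tst ζ) {μ a b : ℝ} (hμ : 0 < μ)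
    (hab : ∀ t, Phi D (fun s => ζ (s - t)) = a * Real.exp (μ * t) + b * Real.exp (-(μ * t))) :
    Phi D ζ = 0 := by
  set Cp := ∫ t, Real.exp (μ * t) * ζ₀ t
  set Cm := ∫ t, Real.exp (-μ * t) * ζ₀ t
  have hCp : 0 < Cp := int_exp_pos hζ₀ h0 h1 μ
  have hCm : 0 < Cm := int_exp_pos hζ₀ h0 h1 (-μ)
  have hIntg : ∀ κ, Integrable (fun t => Real.exp (κ * t) * ζ₀ t) := fun κ =>
    ((by fun_prop : Continuous fun t => Real.exp (κ * t)).mul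
      hζ₀.smooth.continuous).integrable_of_hasCompactSupport hζ₀.cpt.mul_left
  have key : ∀ c, (a * Cp) * Real.exp (μ * c) + (b * Cm) * Real.exp (-(μ * c)) = 0 := by
    intro c
    have hf := Phi_fubini hD (hζ.shift c) hζ₀
    have e2 : ∫ t, Phi D (fun s => ζ₀ (s - t)) * ζ (t - c) = 0 := by
      simp [hz]
    rw [e2] at hf
    rw [← hf]
    have e3 : ∀ t, Phi D (fun s => ζ (s - t - c)) * ζ₀ t
        = (a * Real.exp (μ * c)) * (Real.exp (μ * t) * ζ₀ t)
          + (b * Real.exp (-(μ * c))) * (Real.exp (-μ * t) * ζ₀ t) := by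
      intro t
      have : (fun s => ζ (s - t - c)) = fun s => ζ (s - (t + c)) := by
        ext s; congr 1; ring
      rw [this, hab]
      have a1 : Real.exp (μ * (t + c)) = Real.exp (μ * t) * Real.exp (μ * c) := by
        rw [← Real.exp_add]; congr 1; ring
      have a2 : Real.exp (-(μ * (t + c))) = Real.exp (-μ * t) * Real.exp (-(μ * c)) := by
        rw [← Real.exp_add]; congr 1; ring
      rw [a1, a2]; ring
    simp only [e3]
    rw [integral_add ((hIntg _).const_mul _) ((hIntg _).const_mul _), integral_const_mul,
      integral_const_mul]
    ring
  have ha1 : 0 ≤ a * Cp := nonneg_of_exp hμ fun t => (key t).ge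
  have ha2 : 0 ≤ -(a * Cp) := nonneg_of_exp (b := -(b * Cm)) hμ fun t => by linarith [key t]
  have ha : a * Cp = 0 := by linarith
  have hb : b * Cm = 0 := by
    have := key 0
    rw [ha] at this
    simpa using this
  have ha' : a = 0 := by simpa [hCp.ne'] using ha
  have hb' : b = 0 := by simpa [hCm.ne'] using hb
  have := hab 0
  rw [ha', hb'] at this
  simpa using this

lemma moments_vanish {i0 : Fin n} {γ μ : ℝ} (hμ : 0 < μ) (hμ2 : μ ^ 2 = (n : ℝ) ^ 2 / 4 - γ)
    (hn : 3 ≤ n)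
    {d W : EuclideanSpace ℝ (Fin n) → ℝ} (hd : Sol i0 γ d) (hW : Sol i0 γ W)
    (hdW : ∀ x : EuclideanSpace ℝ (Fin n), 0 < x i0 → |d x| ≤ W x)
    (hbase : ∀ ζ : ℝ → ℝ, Tst ζ → (∀ s, 0 ≤ ζ s) → Phi (DD i0 d (Pi.single i0 1)) ζ = 0)
    (k : ℕ) : ∀ m : Fin n → ℕ, ∑ i, m i = k → Odd (m i0) → ∀ ζ : ℝ → ℝ, Tst ζ → (∀ s, 0 ≤ ζ s) →
      Phi (DD i0 d m) ζ = 0 := by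
  induction k using Nat.strong_induction_on with
  | _ k ih =>
  intro m hmk hodd ζ hζ h0
  have hm : 1 ≤ m i0 := hodd.pos
  have hk : m i0 ≤ k := by
    rw [← hmk]
    exact Finset.single_le_sum (f := m) (fun _ _ => Nat.zero_le _) (Finset.mem_univ i0)
  have hsplit : m i0 + ∑ i ∈ Finset.univ.erase i0, m i = k := by
    rw [Finset.add_sum_erase _ _ (Finset.mem_univ i0), hmk]
  by_cases hk1 : k = 1
  · have hms : m = Pi.single i0 1 := by
      have h1 : m i0 = 1 := by omega
      have h2 : ∑ i ∈ Finset.univ.erase i0, m i = 0 := by omega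
      ext i
      by_cases hi : i = i0
      · subst hi; simp [h1]
      · simp only [Pi.single_eq_of_ne hi]
        exact (Finset.sum_eq_zero_iff.1 h2) i (Finset.mem_erase.2 ⟨hi, Finset.mem_univ _⟩)
    rw [hms]
    exact hbase ζ hζ h0
  · have hk2 : 2 ≤ k := by omega
    have hk2' : (2 : ℝ) ≤ k := by exact_mod_cast hk2
    have hn' : (3 : ℝ) ≤ n := by exact_mod_cast hn
    set V := ((n : ℝ) / 2 + (k : ℝ) - 1) ^ 2 - γ with hV
    have hVμ : μ ^ 2 < V := by rw [hμ2, hV]; nlinarith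
    have hνμ : μ < Real.sqrt V := Real.lt_sqrt_of_sq_lt hVμ
    have hV0 : 0 ≤ V := (sq_nonneg μ).trans hVμ.le
    have hlow : ∀ i, 2 ≤ m i → ∀ ζ : ℝ → ℝ, Tst ζ → (∀ s, 0 ≤ ζ s) →
        Phi (DD i0 d (Function.update m i (m i - 2))) ζ = 0 := by
      intro i hi ζ hζ h0
      have hs : ∑ j, Function.update m i (m i - 2) j = k - 2 := by
        rw [Finset.sum_update_of_mem (Finset.mem_univ i), ← hmk,
          ← Finset.add_sum_erase _ _ (Finset.mem_univ i), Finset.sdiff_singleton_eq_erase]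
        omega
      refine ih (k - 2) (by omega) _ hs ?_ ζ hζ h0
      by_cases hii : i = i0
      · subst hii
        rw [Function.update_self]
        exact Nat.Odd.sub_even hi hodd even_two
      · rw [Function.update_of_ne (Ne.symm hii)]
        exact hodd
    obtain ⟨a, b, hab⟩ := moment_ode hd m hm hlow (hμ.trans hνμ)
      (by rw [Real.sq_sqrt hV0, hmk]) hζ h0
    obtain ⟨C, c, hCc⟩ := moment_ode hW (Pi.single i0 1) (by simp) (by
        intro i hi
        by_cases hii : i = i0
        · subst hii; simp at hi
        · simp [Pi.single_eq_of_ne hii] at hi) hμ (by simp; rw [hμ2]; ring) hζ h0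
    have hb1 : ∀ t, |a * Real.exp (Real.sqrt V * t) + b * Real.exp (-(Real.sqrt V * t))|
        ≤ C * Real.exp (μ * t) + c * Real.exp (-(μ * t)) := by
      intro t
      rw [← hab, ← hCc]
      exact Phi_dom hW.reg.continuousOn hdW m hm (hζ.shift t) (fun s => h0 _)
    have ha : a = 0 := exp_growth hμ hνμ hb1
    have hb : b = 0 := by
      refine exp_growth (b := a) (C := c) (c := C) hμ hνμ fun t => ?_
      have := hb1 (-t)
      simp only [mul_neg, neg_neg] at this
      rw [add_comm, add_comm (c * _)]
      exact this
    have := hab 0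
    rw [ha, hb] at this
    simpa using this

end main4

theorem classification_positive_solutions_halfspace (n : ℕ) (hn : 3 ≤ n)
    (i0 : Fin n) (hi0 : (i0 : ℕ) = 0) (γ : ℝ) (hγ : γ < (n : ℝ) ^ 2 / 4)
    (am ap : ℝ)
    (ham : am = (n : ℝ) / 2 - Real.sqrt ((n : ℝ) ^ 2 / 4 - γ))
    (hap : ap = (n : ℝ) / 2 + Real.sqrt ((n : ℝ) ^ 2 / 4 - γ))
    (u : EuclideanSpace ℝ (Fin n) → ℝ)
    (hreg : ContDiffOn ℝ 2 u
      (closure {x : EuclideanSpace ℝ (Fin n) | 0 < x i0} \ {0}))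
    (hnonneg : ∀ x : EuclideanSpace ℝ (Fin n), 0 < x i0 → 0 ≤ u x)
    (heq : ∀ x : EuclideanSpace ℝ (Fin n), 0 < x i0 →
      -(lap u x) - γ / ‖x‖ ^ 2 * u x = 0)
    (hbdry : ∀ x : EuclideanSpace ℝ (Fin n), x i0 = 0 → x ≠ 0 → u x = 0) :
    ∃ lm lp : ℝ, 0 ≤ lm ∧ 0 ≤ lp ∧
      ∀ x : EuclideanSpace ℝ (Fin n), 0 < x i0 →
        u x = lm * x i0 * ‖x‖ ^ (-am) + lp * x i0 * ‖x‖ ^ (-ap) := by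
  set μ := Real.sqrt ((n : ℝ) ^ 2 / 4 - γ) with hμdef
  have hμ : 0 < μ := Real.sqrt_pos.2 (by linarith)
  have hμ2 : μ ^ 2 = (n : ℝ) ^ 2 / 4 - γ := Real.sq_sqrt (by linarith)
  have hu : Sol i0 γ u := by
    refine ⟨by rw [← closure_HH]; exact hreg, fun x hx => ?_, hbdry⟩
    have := heq x hx
    rw [div_eq_mul_inv] at this
    linarith
  have hm : Sol i0 γ (fs i0 am) := Sol_fs i0 (by rw [ham]; linear_combination hμ2)
  have hp : Sol i0 γ (fs i0 ap) := Sol_fs i0 (by rw [hap]; linear_combination hμ2)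
  have ode1 : ∀ {w : EuclideanSpace ℝ (Fin n) → ℝ}, Sol i0 γ w → ∀ {ζ : ℝ → ℝ}, Tst ζ →
      (∀ s, 0 ≤ ζ s) → ∃ a b : ℝ, ∀ t, Phi (DD i0 w (Pi.single i0 1)) (fun s => ζ (s - t))
      = a * Real.exp (μ * t) + b * Real.exp (-(μ * t)) := by
    intro w hw ζ hζ h0
    exact moment_ode hw (Pi.single i0 1) (by simp) (by
        intro i hi
        by_cases hii : i = i0
        · subst hii; simp at hi
        · simp [Pi.single_eq_of_ne hii] at hi) hμ (by simp; rw [hμ2]; ring) hζ h0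
  obtain ⟨ζ₀, hζ₀, h0, h1⟩ := exists_bump 1 one_pos
  obtain ⟨a, b, hab⟩ := ode1 hu hζ₀ h0
  have hpos : ∀ t, 0 ≤ a * Real.exp (μ * t) + b * Real.exp (-(μ * t)) := fun t => by
    rw [← hab]; exact Phi_nonneg hnonneg (fun s => h0 _)
  have ha : 0 ≤ a := nonneg_of_exp hμ hpos
  have hb : 0 ≤ b := nonneg_of_exp (b := a) hμ fun t => by
    have := hpos (-t)
    simp only [mul_neg, neg_neg] at this
    linarith
  set Pm := Phi (DD i0 (fs i0 am) (Pi.single i0 1)) ζ₀ with hPm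
  set Pp := Phi (DD i0 (fs i0 ap) (Pi.single i0 1)) ζ₀ with hPp
  have hPm0 : 0 < Pm := Phi_fs_pos i0 am hζ₀ h0 h1
  have hPp0 : 0 < Pp := Phi_fs_pos i0 ap hζ₀ h0 h1
  have hlm : 0 ≤ a / Pm := by positivity
  have hlp : 0 ≤ b / Pp := by positivity
  have hd1 := hu.sub_smul hm (a / Pm)
  have hd := hd1.sub_smul hp (b / Pp)
  have hW := (hu.sub_smul hm (-(a / Pm))).sub_smul hp (-(b / Pp))
  have hz : ∀ t, Phi (DD i0 (fun x => u x - a / Pm * fs i0 am x - b / Pp * fs i0 ap x)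
      (Pi.single i0 1)) (fun s => ζ₀ (s - t)) = 0 := by
    intro t
    rw [Phi_sub_smul hd1.reg.continuousOn hp.reg.continuousOn _ _ (hζ₀.shift t),
      Phi_sub_smul hu.reg.continuousOn hm.reg.continuousOn _ _ (hζ₀.shift t), hab,
      Phi_fs_shift, Phi_fs_shift, ← hPm, ← hPp]
    have e1 : (n : ℝ) / 2 - am = μ := by rw [ham]; ring
    have e2 : ((n : ℝ) / 2 - ap) * t = -(μ * t) := by rw [hap]; ring
    rw [e1, e2]
    field_simp
    ring
  have hfs : ∀ (α : ℝ) (x : EuclideanSpace ℝ (Fin n)), 0 < x i0 → 0 ≤ fs i0 α x := by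
    intro α x hx
    unfold fs
    positivity
  have hzero := density hd.reg.continuousOn (fun m hodd =>
    moments_vanish hμ hμ2 hn hd hW (fun x hx => by
      have g1 := hnonneg x hx
      have g2 := mul_nonneg hlm (hfs am x hx)
      have g3 := mul_nonneg hlp (hfs ap x hx)
      rw [abs_le]
      constructor <;> linarith) (fun ζ hζ hζ0 => by
        obtain ⟨a', b', hab'⟩ := ode1 hd hζ hζ0
        exact Phi_all_zero (LI_DD hd.reg.continuousOn _) hζ₀ h0 h1 hz hζ hμ hab')
      _ m rfl hodd)
  refine ⟨a / Pm, b / Pp, hlm, hlp, fun x hx => ?_⟩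
  have hx0 := hzero x hx
  have hn0 : 0 < ‖x‖ := norm_pos_iff.2 (ne_zero_of_HH hx)
  have e : ∀ α : ℝ, ‖x‖ ^ (-α) = Real.exp (-(α * Real.log ‖x‖)) := by
    intro α
    rw [Real.rpow_def_of_pos hn0]
    congr 1
    ring
  rw [e, e]
  unfold fs at hx0
  linarith
end
end
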